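/- Let n ≥ 6 be an integer and let G be a subgraph of the complete bipartite graph K_{n+3,n+3}. If G contains a cycle of length 2(n−1), then G contains a cycle of length 2n, or the bipartite complement of G in K_{n+3,n+3} contains a cycle of length 8. -/

import Mathlib

open SimpleGraph Sum

/-- The complete bipartite graph `K_{t,t}` with both parts a copy of `Fin t`. -/
abbrev Kbb (t : ℕ) : SimpleGraph (Fin t ⊕ Fin t) := completeBipartiteGraph (Fin t) (Fin t)

/-- `G` contains a cycle of length `m`. -/
def HasCycleLen {V : Type*} (G : SimpleGraph V) (m : ℕ) : Prop :=
  ∃ (v : V) (w : G.Walk v v), w.IsCycle ∧ w.length = m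

/-- Every subgraph `G` of `K_{b,b}` contains a cycle of length `m`, or its bipartite
complement in `K_{b,b}` contains a cycle of length `n`. -/
def BRprop (m n b : ℕ) : Prop :=
  ∀ G : SimpleGraph (Fin b ⊕ Fin b), G ≤ Kbb b →
    HasCycleLen G m ∨ HasCycleLen (Kbb b \ G) n

/-- The first `k` base-`9` digits of `n`, turned into vertex labels whose parities alternate,
starting with parity `s`. -/
def alternatingLabels : ℕ → ℕ → ℕ → List ℕ
  | 0, _, _ => []
  | k + 1, s, n => (2 * (n % 9) + s) :: alternatingLabels k (1 - s) (n / 9)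

/-- The bit of an adjacency mask on the labels `0, …, 17` recording the pair `(u, w)`. -/
def pairBit (u w : ℕ) : ℕ := 18 * u + w

/-- The bit `e` of `M`, in a form which the kernel evaluates quickly. -/
def hasBit (M e : ℕ) : Bool := Nat.beq (Nat.land (Nat.shiftRight M e) 1) 1

/-- `u :: l` is a path in the mask `M` such that `l` avoids the set of labels encoded by `U`. -/
def isPathFrom (M : ℕ) : List ℕ → ℕ → ℕ → Bool
  | [], _, _ => true
  | w :: l, u, U => hasBit M (Nat.add (Nat.mul 18 u) w) && !hasBit U w &&
      isPathFrom M l w (Nat.lor U (Nat.pow 2 w))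

/-- `l` has no repetition and consecutive labels are joined in the mask `M`. -/
def isPathIn (M : ℕ) : List ℕ → Bool
  | [] => true
  | u :: l => isPathFrom M l u (Nat.pow 2 u)

/-- Add the edge encoded by `e = 18 * u + w`, in both directions, to a mask. -/
def insertEdge (M e : ℕ) : ℕ := M ||| 2 ^ e ||| 2 ^ pairBit (e % 18) (e / 18)

/-- `2 * n` encodes an `8`-cycle in `B` and `2 * n + 1` a path on `12` labels from `0` to `9`
in `R`. -/
def closesLeaf (R B t : ℕ) : Bool :=
  if t % 2 = 0 then
    match alternatingLabels 8 0 (t / 2) with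
    | [] => false
    | u :: l => isPathIn B (u :: l) && hasBit B (pairBit (l.getLastD u) u)
  else isPathIn R (0 :: (alternatingLabels 10 1 (t / 2) ++ [9]))

/-- As `closesLeaf`, but `2 * n + 1` may also encode two edges of `R` from a label `≥ 10` to even
labels `≥ 10`. -/
def closesLeafOrCherry (R B t : ℕ) : Bool :=
  closesLeaf R B t ||
    match alternatingLabels 3 0 (t / 2) with
    | [u, w, u'] => Nat.ble 10 u && Nat.ble 10 w && Nat.ble 10 u' && isPathIn R [u, w, u']
    | _ => false

/-- Verify a decision tree, listed in preorder, against a stack of pending pairs of masks: numbers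
below `324` branch on an edge being in the first or in the second mask, others are leaves. -/
def refutes (leaf : ℕ → ℕ → ℕ → Bool) : List ℕ → List (ℕ × ℕ) → Bool
  | [], st => st.isEmpty
  | _ :: _, [] => false
  | t :: ts, (R, B) :: st =>
    if t < 324 then
      ((t / 18 + t % 18) % 2 == 1) &&
        refutes leaf ts ((insertEdge R t, B) :: (R, insertEdge B t) :: st)
    else leaf R B (t - 324) && refutes leaf ts st

/-- The mask of the path `0, 1, …, 9`. -/
def pathMask : ℕ := [1, 20, 39, 58, 77, 96, 115, 134, 153].foldl insertEdge 0


/-- Decision tree producing a path, an octagon or a cherry. -/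
def cherryTree : List ℕ :=
  [191, 227, 1397, 263, 1559, 299, 1721, 197, 233, 1451, 269, 1613, 305, 1775, 267, 195, 1595, 231,
   1597, 303, 1761, 193, 229, 1415, 265, 1577, 301, 1739, 11, 49, 3388719989, 53, 3388720313,
   59493956, 13, 53, 3388720315, 47, 3388719829, 64716836, 83845634, 229, 265, 1579, 63654764,
   85933004, 229, 193, 1415, 265, 1579, 301, 1741, 195, 231, 1433, 303, 1757, 11, 51, 3388720151,
   53, 3388720313, 66751556, 13, 15, 217, 3388719037, 181, 3388719021, 76240220, 83507234,
   83845634, 73102604, 195, 231, 1433, 303, 1757, 11, 51, 3388720151, 53, 3388720313, 265, 301,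
   1743, 78506276, 78530756, 15, 47, 3388719831, 53, 3388720317, 265, 301, 1743, 74164676,
   76431236, 265, 301, 1743, 75435714, 76511394, 193, 265, 1577, 301, 1739, 11, 49, 3388719989, 53,
   3388720313, 303, 231, 1759, 74073956, 76146116, 15, 13, 181, 3388719019, 53, 3388720315, 47,
   3388719829, 289, 303, 3388719075, 76431236, 72394016, 303, 231, 1759, 64704834, 66830274,
   67670114, 85709804, 193, 229, 1415, 265, 1577, 301, 1739, 231, 195, 1433, 267, 1597, 305, 233,
   1777, 73309964, 73334444, 195, 267, 1595, 303, 1757, 187, 157, 3667326859, 121, 3412235179, 123,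
   3413298061, 155, 3581233417, 119, 3411172297, 233, 269, 1615, 305, 1777, 64717800, 269, 305,
   1779, 76496514, 74384520, 223, 259, 295, 233, 125, 3423926881, 161, 3849079681, 269, 1615, 119,
   159, 3755546065, 81719402, 84909480, 119, 159, 3755546065, 157, 3669452623, 161, 305,
   3868211557, 62565962, 72245642, 125, 269, 3433492819, 305, 3443058757, 121, 155, 3584422063,
   159, 3756608947, 85829162, 64821480, 83833800, 233, 269, 1615, 82311332, 75897590, 233, 305,
   1777, 64481252, 57132932, 305, 269, 1779, 82285448, 76480808, 269, 305, 1779, 64678604,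
   82756364, 303, 195, 1757, 231, 1759, 267, 1761, 301, 229, 1741, 265, 1743, 305, 233, 1777, 269,
   1779, 11, 181, 3388719017, 289, 17, 3388719077, 15, 3388719075, 63666428, 81955616, 15, 49,
   3388720047, 53, 3388720371, 73010750, 75422268, 74126444, 233, 269, 1615, 82664204, 74359724,
   269, 233, 1615, 305, 1779, 265, 229, 1579, 301, 1743, 267, 195, 1595, 231, 1597, 11, 181,
   3388719017, 253, 15, 3388719057, 13, 3388719055, 73308510, 57248060, 13, 53, 3388720351, 51,
   3388720189, 63679552, 64678590, 76485164, 267, 231, 1597, 63745484, 76146764, 229, 265, 1579,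
   301, 1741, 231, 195, 1433, 267, 1597, 233, 305, 1777, 11, 181, 3388719017, 217, 17, 3388719041,
   15, 3388719039, 63550112, 76240220, 17, 49, 3388720013, 51, 3388720175, 82575554, 77234432,
   66804044, 82667084, 267, 231, 1597, 82641164, 82638284, 305, 197, 1775, 233, 1777, 269, 1779,
   303, 195, 1757, 231, 1759, 267, 1761, 265, 193, 1577, 229, 1579, 301, 1743, 299, 227, 1723, 263,
   1725, 11, 53, 3388720367, 51, 3388720205, 69044990, 15, 47, 3388719885, 53, 3388720371,
   78256670, 75435228, 83726924, 299, 227, 1723, 263, 1725, 11, 53, 3388720367, 51, 3388720205,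
   229, 193, 1415, 63679550, 69043550, 15, 47, 3388719885, 53, 3388720371, 193, 229, 1415,
   72892670, 73955390, 229, 193, 1415, 75188988, 82677308, 301, 193, 1739, 229, 1741, 13, 51,
   3388720207, 53, 3388720369, 227, 263, 1561, 64625630, 69043550, 11, 15, 49, 3388720047, 289,
   3388719075, 53, 3388720371, 253, 263, 3388719053, 74306750, 64792238, 227, 263, 1561, 83741468,
   83571548, 65754108, 83806124, 301, 193, 1739, 229, 1741, 265, 1743, 299, 227, 1723, 263, 1725,
   295, 161, 3868211557, 119, 3439870111, 121, 3440932993, 155, 3609931231, 157, 3696024673, 125,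
   3443058757, 195, 231, 1433, 267, 1595, 84881472, 267, 231, 1597, 82757148, 65740830, 187, 223,
   195, 123, 3413298061, 159, 3753420301, 231, 1433, 157, 125, 3701339083, 82534434, 83793956, 119,
   161, 3870337321, 293, 3392630911, 85, 3392683399, 157, 3698150437, 257, 87, 267, 3389389777,
   81574916, 83571872, 64440896, 123, 231, 3422863999, 125, 85, 3395872045, 83, 3395858923,
   82756832, 82757634, 73076514, 195, 267, 1595, 75906194, 63647474, 267, 231, 1597, 63180914,
   75897590, 267, 231, 1597, 82549004, 76133804, 267, 195, 1595, 231, 1597, 263, 227, 1561, 299,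
   1725, 265, 229, 1579, 11, 51, 3388720187, 49, 3388720025, 68824672, 15, 49, 3388720029, 47,
   3388719867, 73308832, 73309950, 82523084, 229, 193, 1415, 83846444, 83729804, 227, 263, 1561,
   299, 1723, 229, 193, 1415, 265, 1579, 231, 195, 1433, 11, 49, 3388720007, 51, 3388720169,
   82546754, 17, 15, 289, 3388719077, 217, 3388719039, 83018336, 82666112, 77234432, 74359724,
   76264844, 193, 229, 1415, 82521644, 83571404, 265, 193, 1577, 229, 1579, 301, 1743, 231, 195,
   1433, 267, 1597, 303, 1759, 197, 233, 1451, 269, 1613, 263, 299, 1725, 83726924, 76498124, 299,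
   227, 1723, 263, 1725, 76485164, 49, 255, 3388728655, 253, 3388720015, 219, 217, 87, 3388805119,
   15, 3388719039, 13, 3388726237, 227, 83, 3388778875, 69795702, 76483710, 76130780, 73335812, 51,
   219, 3388727359, 217, 3388720159, 255, 253, 85, 3388793455, 13, 3388719055, 15, 3388727697, 83,
   227, 3388779847, 76483710, 73333782, 76130780, 73335812, 269, 233, 1615, 68824672, 82546754,
   269, 197, 1613, 233, 1615, 267, 195, 1595, 303, 1761, 13, 53, 3388720351, 51, 3388720189, 299,
   227, 1723, 78491392, 78505792, 15, 53, 3388720353, 49, 3388720029, 299, 227, 1723, 85944512,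
   59493472, 227, 299, 1723, 72984510, 76483710, 263, 227, 1561, 299, 1725, 47, 85, 3388794103, 89,
   3388820347, 195, 303, 1757, 74319874, 60543394, 51, 49, 83, 3388781143, 255, 3388728655, 253,
   3388720015, 87, 291, 289, 3388797955, 74121980, 74359652, 83766274, 195, 303, 1757, 63771392,
   83804992, 74398592, 74165324, 263, 227, 1561, 299, 1725, 267, 195, 1595, 303, 1761, 47, 85,
   3388794103, 87, 3388807225, 197, 233, 1451, 83571874, 82520674, 49, 87, 3388807387, 83,
   3388781143, 197, 233, 1451, 83689954, 82637314, 233, 197, 1451, 82755232, 83804992, 85813484,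
   303, 195, 1757, 85829324, 85945964, 231, 195, 1433, 267, 1597, 303, 1759, 229, 193, 1415, 301,
   1741, 233, 197, 1451, 269, 1615, 13, 51, 3388720171, 53, 3388720333, 299, 263, 1725, 69084194,
   78530594, 15, 49, 3388720011, 53, 3388720335, 263, 299, 1725, 78373634, 76199234, 299, 263,
   1725, 58340192, 85697312, 227, 263, 1561, 299, 1723, 11, 49, 3388720007, 51, 3388720169, 197,
   269, 1613, 85763714, 68850914, 13, 47, 3388719847, 51, 3388720171, 197, 269, 1613, 85815554,
   68732834, 197, 269, 1613, 66946752, 73333472, 72958604, 227, 263, 1561, 299, 1723, 233, 197,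
   1451, 269, 1615, 11, 51, 3388720169, 53, 3388720331, 193, 301, 1739, 66751394, 78530594, 13, 15,
   47, 3388719849, 217, 3388719039, 53, 3388720335, 181, 193, 3388719019, 78297314, 85688078, 301,
   193, 1739, 85632512, 75228192, 73333472, 64834124, 269, 197, 1613, 76483724, 85931564, 269, 197,
   1613, 233, 1615, 267, 195, 1595, 303, 1761, 263, 227, 1561, 299, 1725, 259, 125, 3433492819,
   155, 3600365293, 119, 3430304173, 159, 3772552177, 193, 229, 1415, 301, 1739, 74165318, 229,
   301, 1741, 73102598, 83690916, 187, 223, 295, 193, 157, 3667326859, 121, 3412235179, 229, 1415,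
   155, 125, 3605679703, 85931556, 64717478, 119, 159, 3774677941, 161, 3860771383, 157, 229,
   3676892797, 85709798, 74397158, 121, 301, 3440932993, 229, 3421801117, 125, 83, 3395740825, 87,
   3395767069, 69756514, 82667076, 63628836, 193, 229, 1415, 64678568, 63742532, 301, 193, 1739,
   63771368, 66920648, 229, 301, 1741, 66812594, 64834088, 229, 301, 1741, 66817004, 64717484, 299,
   227, 1723, 263, 1725, 301, 193, 1739, 229, 1741, 303, 11, 51, 3388720205, 49, 3388720043,
   68824670, 13, 51, 3388720207, 47, 3388719883, 63744350, 65754108, 63771404, 74008364, 193, 301,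
   1739, 74358284, 74397164, 227, 263, 1561, 299, 1723, 301, 193, 1739, 229, 1741, 195, 303, 1757,
   85945964, 85698284, 195, 267, 1595, 303, 1757, 47, 219, 3388727035, 217, 3388719835, 183, 181,
   15, 3388719021, 11, 3388724777, 193, 229, 1415, 85632674, 75461472, 73413500, 85689554, 51, 183,
   3388725901, 181, 3388720141, 219, 217, 15, 3388726239, 185, 3389152213, 11, 3388719035, 221, 53,
   197, 193, 229, 3389264065, 85632674, 75461472, 75228192, 75227544, 73649696, 73413500, 85689554,
   197, 233, 1451, 66932996, 82457474, 229, 233, 193, 1415, 197, 1451, 11, 49, 3388720007, 53,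
   3388720331, 303, 267, 1761, 78412514, 78376514, 15, 13, 47, 3388719847, 217, 3388719037, 53,
   3388720333, 289, 303, 3388719075, 78297314, 65988860, 267, 303, 1761, 85932032, 73333472,
   85632512, 83806124, 85698284, 229, 193, 1415, 301, 1741, 303, 267, 1761, 85813484, 85944524,
   267, 195, 1595, 303, 1761, 85931564, 303, 195, 1757, 299, 301, 263, 1725, 193, 1739, 13, 51,
   3388720207, 47, 3388719883, 233, 197, 1451, 82637150, 83689790, 11, 51, 3388720205, 289,
   3388719071, 49, 3388720043, 53, 181, 197, 3388720303, 82691870, 85107776, 78504350, 197, 233,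
   1451, 64820988, 64704348, 85826444, 85698284, 193, 195, 197, 301, 1739, 233, 1451, 87, 49,
   3388804471, 53, 3388804795, 299, 263, 1725, 78415556, 76146116, 83, 85, 183, 3388790539, 185,
   3389140459, 123, 3394454869, 255, 257, 119, 3391929613, 76278120, 66812576, 66930656, 299, 263,
   1725, 60466118, 83609798, 85892198, 76483724, 85931564, 85944524]

/-- Top of the decision tree producing a path or an octagon from a cherry. -/
def rootTree : List ℕ :=
  [263, 299, 185, 324, 221, 325, 293, 326, 257, 327, 47, 219, 3388727035, 217, 3388719835, 289,
   3388719871, 183, 3388725577, 253, 3388719853, 291, 3388729951, 187, 225, 5130915373, 261,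
   5905756351, 44748662, 295, 225, 5159613187, 261, 5934454165, 44748662, 28057604, 155, 223,
   3590799355, 259, 3600365293, 297, 6671031391, 225, 5121349435, 189, 4346508457, 261, 5896190413,
   187, 3581233417, 181, 255, 3388728565, 291, 3388730023, 34567916, 289, 255, 3388728619, 219,
   3388727161, 47074316, 45062618, 83, 328, 119, 329, 11, 330, 331, 119, 332, 83, 333, 47, 334,
   155, 335, 185, 336, 221, 337, 257, 338, 11, 339, 255, 340, 219, 341, 183, 342, 259, 343, 187,
   344, 345, 119, 346, 83, 347, 47, 348, 155, 349, 195, 87, 350, 123, 351, 51, 352, 159, 353, 219,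
   354, 183, 355, 181, 356, 187, 357, 223, 358, 217, 359, 197, 360, 361, 183, 362, 219, 363, 223,
   364, 187, 365, 366]

set_option maxRecDepth 100000 in
/-- Subtrees referred to by `rootTree`. -/
def branches : List (List ℕ) := [
  [259, 3430540369, 83, 3389127337, 223, 3420974431, 255, 3389134627, 295, 3440106307, 219,
   3389133169, 291, 3389136085, 119, 3392276617, 183, 221, 3389249809, 293, 3389486005, 253,
   3388725685, 217, 3388725667, 257, 3389367907, 47, 3388725577, 289, 3388725703, 155, 189,
   4346508457, 261, 5896190413, 187, 3581233417, 44012858, 121, 193, 3393339499, 229, 3393501337,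
   301, 3393737533, 181, 187, 11, 3388719017, 49, 3392854219, 157, 3648431179, 13, 3405608779, 15,
   87, 3389060301, 267, 3388725699, 69687878, 267, 123, 3394682317, 51, 3389135599, 159,
   3774914137, 17, 197, 3388719023, 53, 3388724783, 71999532, 125, 305, 3395863297, 85473432,
   77179848, 67779374, 26289374, 37407596, 125, 269, 3395745199, 305, 3395863297, 197, 3395465263,
   89, 3395115343, 181, 187, 301, 53, 3394979983, 225, 5130915373, 161, 3820618063, 261,
   5905756351, 297, 6680597329, 13, 3388725715, 189, 15, 87, 3389060301, 267, 3388725699, 69743678,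
   159, 195, 4518695341, 58300332, 58287048, 82397642, 66357240, 82305410, 25588094, 51, 303,
   3389137057, 195, 3388725901, 87, 3389075821, 181, 229, 269, 123, 3393917101, 157, 3679254757,
   49, 3389133979, 161, 3861007579, 81508812, 80344724, 63888846, 35152592, 49, 265, 3389135437,
   85, 3389075659, 305, 303, 161, 3870573517, 159, 3784480075, 81626892, 61199744, 85231878, 159,
   303, 3784480075, 229, 233, 157, 3679254757, 13, 3388725679, 161, 3851441641, 17, 3388725683, 87,
   123, 3394052461, 77296488, 81406572, 83138658, 26242718, 89, 197, 3389166703, 53, 3389075983,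
   193, 85, 3388790539, 78477612, 82574898, 79307052, 187, 225, 5130915373, 221, 3411526591, 261,
   5905756351, 297, 6680597329, 257, 3411644689, 293, 3411762787, 155, 3581233417, 189, 11, 181,
   3388719017, 253, 3388719053, 28070564, 47, 217, 3388719835, 181, 3388719817, 28187222, 85, 229,
   3411579079, 193, 3389140459, 28195970, 87, 267, 3411710299, 195, 3389153581, 72503348, 89, 305,
   3411841519, 197, 3389166703, 35665304, 121, 193, 3412235179, 265, 4378394917, 62937392, 195,
   123, 3413298061, 159, 4518695341, 53, 17, 305, 3389137219, 217, 3389133023, 197, 181,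
   3388719023, 28187222, 35665304, 71816010, 71829132, 305, 267, 161, 3870573517, 53, 3389137219,
   51, 3389135599, 60373932, 72503348, 15746628, 43806956, 51, 303, 3389137057, 231, 3389134141,
   267, 3389135599, 11, 181, 3388719017, 253, 3388719053, 73567454, 15, 217, 3389133021, 289,
   3389135937, 73446494, 85, 193, 3389140459, 121, 195, 3392990551, 289, 3392990353, 253,
   3392990335, 35970494, 63153690, 229, 265, 225, 5238502651, 261, 6003777691, 45575366, 60123776,
   67588412, 53, 305, 3389137219, 233, 3389134303, 269, 3389135761, 181, 197, 3388720303, 125,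
   3394979983, 47, 3388719817, 195, 303, 257, 3389373325, 221, 3389255227, 82070708, 83138658,
   83099292, 253, 17, 3389134481, 11, 3388719053, 47, 3388719853, 303, 195, 3389163085, 77142524,
   83138652, 85232912, 161, 233, 3851441641, 305, 3870573517, 195, 303, 253, 3389163085, 217,
   3389163067, 34248272, 69050626, 36044384, 159, 303, 3784480075, 231, 3765348199, 267,
   3774914137, 269, 197, 217, 3389174731, 289, 3389174767, 73446494, 69040546, 78527750, 195, 87,
   3389153581, 231, 253, 3389160169, 155, 3595287079, 297, 6694650991, 289, 3389160187, 261,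
   5919810013, 225, 267, 5324596093, 305, 197, 5165163793, 69037988, 69743678, 15320840, 197, 269,
   305, 217, 3389174731, 297, 6705279811, 289, 3389174767, 261, 5940004771, 46848200, 78501346,
   78501344, 35927744, 269, 233, 305, 217, 3389135851, 253, 3389134411, 225, 5410689535, 297,
   6950805553, 34242440, 78485506, 36083750, 78485504],
  [183, 3389249809, 83, 3389245435, 187, 3411526591, 291, 3389254183, 295, 3440224405, 119,
   3392394715, 259, 3430658467, 255, 3389252725, 219, 47, 3388727035, 257, 3389369365, 253,
   3388727143, 289, 3388727161, 181, 3388727107, 293, 3389487463, 155, 223, 3590799355, 297,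
   6671031391, 225, 5121349435, 28191596, 123, 267, 3394683775, 231, 3394520479, 303, 3394801873,
   195, 3394447579, 87, 3394053919, 223, 217, 159, 3734642719, 297, 6690163267, 51, 3416371039, 15,
   3415174719, 11, 3388719035, 225, 13, 157, 4659942397, 193, 3388727119, 69740206, 301, 85,
   3421381213, 157, 3698504731, 121, 5162801833, 17, 197, 3388727123, 89, 3389178401, 58300332,
   269, 125, 5155361659, 77273610, 77299970, 68625338, 73917410, 73447952, 73799312, 125, 89,
   3395116801, 233, 3395583361, 197, 3395510461, 269, 3395746657, 305, 3395864755, 267, 303, 223,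
   217, 15, 3388727157, 159, 3775032235, 51, 3389253697, 297, 6874396147, 161, 3820736161, 53,
   3416371201, 225, 13, 157, 4659942397, 193, 3388727119, 28642118, 193, 121, 3393384697, 58287048,
   69079824, 83487704, 37292450, 36087170, 75896934, 74834052, 121, 193, 3393384697, 229,
   3393457597, 265, 3393620893, 85, 3392991037, 217, 223, 195, 197, 49, 3392854237, 157,
   3648549277, 87, 3421040041, 161, 3841993801, 81508812, 60164060, 60162602, 25239614, 37289534,
   49, 265, 3389253535, 85, 3389193757, 305, 195, 53, 3389255317, 17, 3388727177, 15, 3388727121,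
   67927524, 61479662, 61639556, 195, 15, 3388727121, 159, 3755900359, 51, 3389250781, 17, 89, 269,
   3388727159, 233, 3388818241, 217, 3389178401, 82973534, 79307052, 77414568, 301, 305, 13,
   3388727173, 157, 3698504731, 161, 3870691615, 53, 3389255317, 17, 3388727177, 87, 51,
   3389193919, 68979048, 81508812, 38196374, 18828302, 223, 155, 3590799355, 257, 3421210627, 297,
   6690163267, 293, 3421328725, 189, 4365640333, 261, 5915322289, 225, 11, 181, 3388719017, 217,
   3388719035, 28174262, 47, 217, 3388719835, 289, 3388719871, 46848200, 85, 193, 3421026919, 229,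
   3389258557, 37748948, 87, 267, 3421276237, 231, 3389271679, 73568948, 89, 233, 3389284801, 269,
   3421289359, 83133464, 121, 265, 5153235895, 229, 3421801117, 63962708, 195, 123, 5135166901,
   159, 3755900359, 51, 3389250781, 53, 17, 161, 181, 3389249663, 217, 3799008001, 28174262,
   68679852, 71816010, 71829132, 301, 231, 269, 49, 3389254993, 123, 3394520479, 159, 3762986239,
   161, 3861125677, 72192012, 79548710, 47080148, 66093342, 37754636, 49, 265, 3389253535, 193,
   3389250619, 301, 3389254993, 293, 257, 11, 181, 3388719017, 253, 3388719053, 35308076, 13, 253,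
   3389252575, 181, 3389367757, 35308076, 87, 267, 3389389777, 303, 3389507875, 76244522, 231, 195,
   289, 3389276827, 217, 3389368969, 63144716, 66329532, 58023932, 66334352, 63054032, 51, 303,
   3389255155, 267, 3389253697, 195, 3389250781, 257, 293, 231, 3389370337, 181, 15, 3389485857,
   11, 3388719017, 47, 3388719817, 229, 193, 3389370247, 75893850, 75906972, 253, 15, 3389488773,
   123, 3393917137, 11, 3388719053, 47, 3388719853, 229, 265, 3389488381, 73794336, 75906972,
   37409054, 75772130, 75900290, 159, 303, 3784598173, 195, 3755900359, 229, 193, 289, 3389263705,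
   253, 3389263687, 35270654, 38050592, 68817310, 157, 265, 3688938793, 301, 3698504731, 193,
   3669806917, 231, 303, 253, 3389281183, 181, 3389281147, 35308076, 59392994, 59367074, 193, 229,
   289, 3389263705, 253, 3389263687, 297, 6684140269, 257, 189, 4454331931, 35266280, 24882404,
   195, 267, 303, 253, 3389250889, 261, 6080423293, 189, 4549873213, 289, 3389253823, 43781000,
   68817310, 68817794, 35847556, 267, 231, 303, 181, 3389279689, 189, 4379812093, 289, 3389279743,
   261, 5939059987, 43685960, 38050592, 34784834, 71990438],
  [255, 3389488921, 183, 3389486005, 259, 3430894663, 83, 3389481631, 223, 3421328725, 119,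
   3392630911, 187, 3411762787, 219, 3389487463, 47, 217, 3388719835, 289, 3388719871, 291,
   3388729951, 34328804, 155, 297, 6671031391, 261, 5896190413, 295, 3609931231, 47190956, 291,
   217, 3388730041, 181, 3388730023, 253, 3388730059, 257, 3389372281, 51, 195, 3389486977, 231,
   3389488435, 87, 3389430115, 267, 3389489893, 303, 3388730275, 289, 295, 123, 3393917155, 15,
   3388729155, 11, 3388719071, 225, 5159613187, 261, 5934454165, 189, 4384772209, 159, 3712914595,
   297, 13, 121, 3434306593, 193, 3388730035, 63153690, 193, 85, 3440158795, 17, 305, 3388719077,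
   233, 3388730057, 76492256, 197, 125, 6685911739, 77273610, 69808802, 73767930, 35663828,
   25383632, 16256876, 49, 301, 3388730113, 85, 3389429953, 265, 3389489731, 295, 289, 231, 225,
   5159613187, 261, 5934454165, 189, 4384772209, 13, 3388729153, 11, 3388719071, 87, 3440290015,
   159, 3765702493, 297, 17, 305, 3388719077, 233, 3388730057, 66927794, 197, 125, 6685911739,
   77273610, 60124730, 66452468, 60136538, 65980058, 66334352, 53, 89, 3389430277, 197, 3389487139,
   305, 3388730437, 231, 229, 265, 295, 159, 3765702493, 157, 3679609051, 85, 3440394991, 125,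
   3435503077, 79425132, 38214068, 59088074, 79266952, 73653068, 123, 267, 3394686691, 87,
   3394056835, 197, 229, 125, 3395513377, 161, 3842229997, 157, 3679609051, 81511692, 68815832,
   69039122, 193, 13, 3388730035, 157, 3670043113, 121, 3393387613, 17, 89, 269, 3388730075, 305,
   3388821157, 289, 3389414597, 85101872, 69003852, 68979048, 231, 269, 159, 3765702493, 15,
   3388730055, 17, 3388730075, 85, 121, 3392993953, 59414568, 67928964, 78367352, 16792934, 11,
   217, 3388719035, 289, 3388719071, 34328804, 121, 301, 3393693793, 229, 297, 6693351913, 261,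
   5918510935, 46954796, 34337552, 123, 303, 3394756675, 267, 225, 5154298777, 297, 6703980733,
   34334636, 75665570, 125, 305, 3395819557, 269, 189, 4380520681, 297, 6705043615, 35384396,
   85231508, 157, 265, 3689174989, 229, 3679609051, 301, 295, 3696024673, 64077872, 66099632, 195,
   51, 3389486977, 159, 3756136555, 17, 89, 305, 3389520997, 289, 3389414597, 229, 197, 193, 217,
   3388817683, 34328804, 85224120, 35390228, 85237242, 79268172, 77142408, 233, 301, 303, 53,
   3389488597, 85, 3389494753, 87, 3389507875, 78242892, 35388770, 72594096, 36070628],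
  [219, 3389369365, 295, 3440342503, 223, 3421210627, 119, 3392512813, 83, 3389363533, 187,
   3411644689, 183, 3389367907, 291, 3389372281, 47, 255, 3388728493, 181, 3388719817, 253,
   3388719853, 18389444, 155, 259, 3600365293, 297, 6671031391, 261, 5896190413, 46954796, 49, 229,
   3389370175, 301, 3389373091, 193, 3389368717, 85, 265, 3389376655, 255, 3389311855, 63147632,
   259, 225, 5150047249, 189, 4375206271, 87, 123, 3427181137, 231, 3430724077, 73650156, 195, 231,
   303, 51, 3389368879, 217, 3389368969, 181, 3389370409, 289, 3389369005, 53, 197, 3389369041, 89,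
   125, 3427194259, 81930138, 60534556, 233, 161, 3851677837, 121, 265, 3431367055, 255,
   3425936815, 63843098, 60373932, 60374176, 69868708, 60429472, 25309650, 265, 255, 3388728655,
   37512752, 64077872, 53, 197, 3389369041, 233, 3389370499, 305, 3389373415, 89, 269, 3389402899,
   255, 3389312179, 83212628, 229, 193, 301, 157, 3679490953, 181, 3389370247, 189, 4454331931,
   217, 3389368807, 225, 5219606971, 289, 3389368843, 297, 6769288927, 11, 269, 3388720349, 253,
   3388719053, 85232912, 85, 259, 3430947151, 253, 3388795669, 37743098, 51, 195, 3389368879, 231,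
   3389370337, 15, 87, 269, 3389401473, 267, 3389389777, 85100522, 15746628, 72367110, 231, 159,
   3765584395, 125, 253, 3394980019, 269, 3395701459, 85232912, 79425132, 68654550, 59088076,
   79266814, 79266952, 157, 229, 3679490953, 193, 3669925015, 301, 3698622829, 305, 197, 233, 161,
   3870809713, 181, 3389373487, 189, 4645650691, 225, 5420491669, 217, 3389373505, 85, 261,
   5628514735, 265, 3389376655, 66219206, 51, 195, 3389368879, 87, 267, 3389389777, 255,
   3389312017, 73095242, 25309650, 303, 195, 231, 159, 3784716271, 123, 255, 3394449037, 261,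
   5919573817, 44397428, 72180492, 59370946, 68651236, 68812954, 34746928, 35809666, 78381826, 267,
   87, 3389389777, 123, 3394638577, 125, 89, 181, 3395118979, 255, 3395118259, 259, 3427194259,
   217, 3395118997, 37516964, 70055052, 78359532, 181, 255, 3388728565, 303, 195, 3389373325,
   72713570, 75901730, 189, 259, 4375206271, 303, 195, 4559557249, 72594050, 75665570, 217, 255,
   3388728583, 195, 231, 3389368969, 73763330, 72713570, 225, 259, 5150047249, 303, 231,
   5334398227, 73566050, 75665570, 289, 255, 3388728619, 303, 195, 3389369005, 72713570, 75901730,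
   297, 259, 6699729205, 303, 231, 6864948307, 73447952, 75665570, 269, 89, 3389402899, 125,
   3395701459, 51, 195, 3389368879, 253, 255, 123, 3393917137, 17, 3388719059, 15, 3388727697,
   67929288, 72362192, 72504734, 123, 87, 259, 3427181137, 255, 3394055377, 34567916, 79502892,
   79305612, 87, 123, 259, 3427181137, 255, 3394055377, 34567916, 75369462, 78359540],
  [255, 3388780333, 291, 3388781791, 219, 3388778875, 183, 3388777417, 51, 303, 3388782763, 267,
   3388781305, 231, 3388779847, 195, 3388778389, 187, 225, 5130915373, 261, 5905756351, 72503348,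
   259, 225, 5150047249, 297, 6699729205, 73918868, 75665570, 49, 193, 3388778227, 301, 3388782601,
   265, 3388781143, 157, 225, 5101171525, 261, 5876012503, 44953250, 231, 195, 223, 3423139561,
   187, 3413691721, 63147632, 62262140, 63035756, 121, 265, 3393615061, 193, 3393378865, 231, 195,
   223, 3423139561, 187, 3413691721, 63147632, 59353610, 59368496, 123, 195, 3394441747, 267,
   3394677943, 303, 3394796041, 229, 301, 223, 3422430973, 295, 3441326653, 75901730, 25296494,
   25296172, 193, 229, 181, 3388779757, 223, 3422076679, 187, 3412628839, 217, 3388778317, 253,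
   289, 265, 3388779793, 301, 3388779811, 66083738, 27706244, 18389444, 267, 195, 303, 181,
   3388781377, 187, 3413809819, 259, 3432705499, 289, 3388778515, 34120004, 28484816, 25296172,
   74745780, 231, 267, 303, 223, 3423375757, 259, 3432823597, 217, 3388781395, 289, 3388779973,
   35182724, 75665616, 74745618, 25179532],
  [259, 3430304173, 223, 3420738235, 187, 3411172297, 295, 3439870111, 157, 229, 3679018561, 193,
   3669452623, 265, 3688584499, 181, 255, 3388728565, 291, 3388730023, 63147632, 289, 255,
   3388728619, 219, 3388727161, 37512752, 62819294, 159, 267, 3774677941, 231, 3765112003, 51, 181,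
   3712914865, 289, 3712914919, 73799312, 301, 193, 297, 6768816535, 189, 4472991415, 73766264,
   63035756, 68677862, 85, 301, 3392683399, 193, 3392329105, 195, 267, 255, 3392349517, 183,
   3392582797, 25978352, 72032216, 34901816, 87, 303, 3392696521, 267, 3392578423, 265, 229, 255,
   3392454493, 219, 3392571133, 75888770, 38090138, 62584538, 193, 229, 183, 3392451577, 219,
   3392334937, 189, 4453859539, 225, 5219134579, 297, 261, 301, 6768816535, 265, 6003541495,
   66220646, 43781036, 35266316, 195, 303, 267, 297, 6854909977, 291, 3392350975, 189, 4559084857,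
   255, 3392349517, 25936556, 69740420, 38090138, 35821328, 267, 303, 231, 255, 3392703811, 261,
   6108766813, 297, 6874041853, 219, 3392702353, 47074316, 34758610, 75775922, 71839778],
  [181, 3388719017, 253, 3388719053, 217, 3388719035, 289, 3388719071, 49, 229, 3388720007, 301,
   3388720043, 193, 3388719989, 187, 225, 5130915373, 261, 5905756351, 44755952, 295, 225,
   5159613187, 261, 5934454165, 44755952, 26289374, 53, 305, 3388720367, 197, 3388720313, 269,
   3388720349, 233, 3388720331, 89, 255, 3388811069, 291, 3388811087, 25588094, 193, 229, 183,
   3388725839, 219, 3388727279, 83093054, 79266940, 59088214, 51, 231, 3388720169, 195, 3388720151,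
   267, 3388720187, 87, 183, 3388797911, 291, 3388797965, 73643756, 229, 301, 291, 3388730213, 219,
   3388727333, 73563116, 59086636, 64085672, 295, 225, 5159613187, 261, 5934454165, 189,
   4384772209, 85, 193, 3440158795, 265, 3440394991, 62819312, 303, 159, 3782118115, 123,
   3441995875, 125, 161, 255, 3821019013, 183, 3821016097, 44983382, 72180492, 78333612, 229, 265,
   219, 3440400823, 255, 3440284183, 16485782, 59394470, 26242718, 195, 231, 219, 3388727441, 183,
   3388726001, 259, 225, 5150047249, 297, 6699729205, 24650582, 37269284, 301, 305, 269, 197, 193,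
   85, 3388796165, 291, 3388730555, 255, 3388729115, 87, 3388804931, 187, 121, 3412235179, 161,
   3839513743, 60373932, 25580804, 26358872, 25415708, 78496988, 78499870, 59365114, 265, 301, 291,
   3388730231, 255, 3388728791, 187, 225, 5130915373, 261, 5905756351, 44711222, 25580804,
   59352154, 59355032],
  [183, 253, 3388725685, 217, 3388725667, 289, 3388725703, 125, 269, 3395745199, 305, 3395863297,
   233, 3395627101, 187, 225, 5130915373, 197, 3414360943, 261, 5905756351, 44758868, 259, 225,
   5150047249, 189, 4375206271, 85116308, 34340450, 123, 267, 3394682317, 303, 3394800415, 231,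
   3394564219, 15, 295, 3440093397, 259, 3430527459, 187, 195, 3413298061, 37514192, 24917072, 305,
   233, 295, 3443456791, 223, 3424561111, 187, 195, 3413298061, 25383632, 24917072, 83243472,
   85356114, 15, 267, 3388725699, 231, 3388725681, 303, 3388725717, 305, 233, 295, 3443456791, 223,
   3424561111, 181, 195, 3388719021, 25383632, 73799312, 71175398, 71204198, 17, 305, 3388725719,
   233, 3388725683, 269, 3388725701, 267, 195, 223, 3421280611, 295, 3440412487, 197, 181,
   3388719023, 83368130, 82188770, 85342992, 71204198, 193, 49, 3388725739, 85, 3388790539, 53, 87,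
   51, 197, 3388726063, 195, 3388803661, 121, 3393327349, 73228650, 77153604, 77389764, 67928964,
   223, 297, 6690163267, 189, 4365640333, 265, 229, 3422317249, 28182992, 63288752, 229, 121,
   3393501337, 13, 3388725679, 231, 303, 305, 295, 3442393909, 301, 49, 87, 3388808845, 197, 53,
   3388726063, 69703044, 82558572, 161, 87, 3870757225, 77257284, 67966728, 25265534, 63063294,
   75547518, 77437086, 295, 225, 5159613187, 261, 5934454165, 45419792, 25239614, 291, 217,
   3388730041, 181, 3388730023, 253, 3388730059, 125, 233, 3395631475, 269, 3395749573, 197,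
   3395513377, 187, 261, 5905756351, 297, 6680597329, 81925268, 295, 225, 5159613187, 261,
   5934454165, 305, 3443058757, 45694868, 82305410, 123, 267, 3394686691, 195, 3394450495, 231,
   3394568593, 15, 187, 3411749877, 259, 3430881753, 295, 289, 3434306595, 73447952, 73685552, 269,
   305, 223, 3421298107, 187, 3411732169, 295, 303, 3441995875, 75772112, 28079312, 85342992,
   80317994, 15, 267, 3388730073, 231, 3388730055, 305, 233, 259, 3430745947, 187, 3411614071, 289,
   303, 3388719075, 34102832, 73447952, 71174912, 71204198, 89, 305, 3388821157, 267, 195, 187,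
   3413818567, 259, 3432714247, 233, 219, 3388818241, 295, 3440303137, 37505444, 34104290,
   85342992, 71204198, 301, 49, 3388730113, 85, 3388794913, 79382724, 187, 225, 5130915373, 261,
   5905756351, 265, 193, 3412755685, 44717072, 66201872, 13, 193, 3388730035, 259, 225, 5150047249,
   297, 6699729205, 26096432, 34830014, 231, 267, 49, 157, 259, 3432832345, 223, 3423384505, 297,
   6306479713, 193, 189, 4432601899, 35423258, 34830014, 79305450, 79266084, 67779194, 73689198,
   255, 289, 3388728619, 181, 3388728565, 217, 3388728583, 187, 225, 5130915373, 261, 5905756351,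
   44748662, 259, 225, 5150047249, 297, 6699729205, 189, 4375206271, 261, 253, 295, 5934454165,
   223, 5915322289, 13, 229, 3388728595, 265, 3388719055, 63846032, 15, 303, 3388728633, 267,
   3388719057, 75535952, 17, 305, 3388728635, 269, 3388719059, 85457642, 85, 229, 3430710955, 265,
   3388793455, 63846032, 195, 123, 3394449037, 87, 3388804417, 53, 161, 3799008019, 69808650,
   69808164, 269, 229, 267, 89, 3388819699, 53, 3388720339, 121, 3393504253, 51, 3388728817,
   58247844, 72504770, 72504828, 77421146, 26089142, 44748662, 34236644, 219, 253, 3388727143, 289,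
   3388727161, 181, 3388727107, 187, 225, 5130915373, 261, 5905756351, 44983382, 223, 297,
   6690163267, 189, 4365640333, 261, 5915322289, 225, 217, 295, 5159613187, 259, 5150047249, 13,
   193, 3388727119, 229, 3388719037, 47091686, 15, 267, 3388727157, 231, 3388719039, 73643756, 17,
   269, 3388727159, 233, 3388719041, 83247170, 85, 193, 3421026919, 229, 3388791997, 47091686, 195,
   87, 3421040041, 123, 3394447579, 53, 161, 3799008001, 69808650, 69808164, 233, 231, 89,
   3388818241, 53, 3388727521, 159, 3762986239, 71829126, 47093144, 83251602, 18611222, 26087702,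
   18389444, 295, 225, 5159613187, 261, 5934454165, 189, 4384772209, 85, 193, 3440158795, 265,
   3440394991, 62937410, 87, 267, 3440408113, 195, 3440171917, 72503348, 89, 269, 3440421235, 233,
   3440303137, 83447366, 297, 223, 6690163267, 187, 6680597329, 45065516, 121, 301, 3440932993,
   193, 229, 187, 3412235179, 223, 3421801117, 47087276, 43785410, 44953250, 123, 303, 3441995875,
   231, 267, 223, 3422863999, 259, 3432429937, 46954796, 75769268, 43812788, 17, 181, 197,
   3388719023, 269, 305, 253, 3388719059, 289, 3388719077, 25000502, 47781446, 82046246, 217, 253,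
   233, 3388719041, 269, 3388719059, 83447366, 46967702, 28187222, 157, 159, 301, 3696024673, 303,
   3782118115, 66763698, 71816010, 70040490, 187, 225, 5130915373, 261, 5905756351, 297,
   6680597329, 259, 223, 189, 4375206271, 85, 193, 3421026919, 301, 3421381213, 44953250, 87, 231,
   3411592201, 267, 3421276237, 73568948, 89, 305, 3411841519, 269, 3421289359, 85335206, 121, 193,
   3412235179, 265, 3431367055, 62914370, 123, 195, 3413298061, 231, 3422863999, 47080148, 125,
   269, 3433492819, 233, 3423926881, 83447366, 157, 193, 3667326859, 265, 3686458735, 62914370, 53,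
   17, 51, 15, 181, 197, 3388719023, 161, 3799007983, 195, 3388719021, 73282740, 217, 231,
   3388720159, 233, 3388719041, 74319702, 28187222, 79422090, 79501452, 77180010, 78242892,
   45102956, 44945996, 223, 189, 4365640333, 261, 5915322289, 44040236, 259, 225, 5150047249, 297,
   6699729205, 28191596, 301, 85, 181, 3388795633, 253, 3388795669, 18389444, 121, 189, 4387960855,
   261, 5937642811, 44014316, 13, 289, 3388719073, 181, 253, 193, 3388719019, 265, 3388719055,
   62937392, 24882404, 37269284, 157, 297, 6757124833, 261, 189, 265, 5982283855, 193, 4432601899,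
   62937392, 25936556, 47087276, 305, 125, 225, 5164927597, 189, 4390086619, 34567916, 53, 289,
   3388720357, 181, 253, 197, 3388720303, 269, 3388720339, 82070708, 24882404, 37269284, 123, 189,
   231, 4369891861, 303, 4389023737, 34339010, 225, 267, 5154298777, 195, 5135166901, 72504770,
   34567916, 87, 181, 303, 3388808755, 231, 3388805839, 34339010, 289, 195, 3388804435, 231,
   3388805893, 35970530, 37269284, 78242892, 197, 233, 269, 17, 181, 3388719023, 217, 3388719041,
   37385924, 229, 193, 265, 53, 181, 3388720303, 253, 3388720339, 18389444, 89, 181, 3388819123,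
   217, 3388817683, 37385924, 125, 225, 5222323225, 189, 4380520681, 34567916, 161, 189,
   4604788783, 225, 5379629761, 34567916, 51, 181, 195, 3388720141, 87, 267, 3388807459, 72504770,
   15746628, 289, 253, 303, 3388720195, 267, 3388720177, 75665570, 18389444, 37269284, 87, 303,
   253, 3388808953, 181, 3388808755, 18389444, 85878422, 78451044, 58451090, 85342176, 35797010,
   85454708, 34366388, 35272148, 193, 265, 229, 49, 181, 3388719979, 217, 3388719997, 37385924, 85,
   289, 3388792771, 217, 3388791277, 34236644, 157, 189, 4432601899, 261, 5982283855, 44014316,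
   195, 87, 253, 3388804417, 289, 3388804435, 24882404, 231, 267, 51, 217, 3388720159, 181,
   3388720141, 37385924, 123, 225, 5240392219, 189, 4369891861, 34567916, 17, 181, 197, 3388719023,
   89, 269, 3388820581, 82070708, 34993652, 289, 253, 305, 3388719077, 269, 3388719059, 85454708,
   18389444, 37269284, 125, 305, 225, 5164927597, 189, 4390086619, 34567916, 68850096, 77179848,
   69701342, 52897666, 87, 267, 181, 3388807459, 217, 3388807315, 37385924, 72504770, 25309650,
   34219472, 66334352, 25978352],
  [259, 3430304173, 223, 3420738235, 257, 3392512813, 187, 3411172297, 221, 3392394715, 185,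
   3392276617, 47, 219, 3388727035, 217, 3388719835, 255, 3388728493, 181, 3388719817, 183,
   3388725577, 253, 3388719853, 289, 293, 3391791391, 295, 291, 3435502591, 18389444, 37505444,
   295, 291, 3435502591, 35299364, 37269284, 87, 267, 3392578423, 231, 3392460325, 195, 3392342227,
   183, 51, 3392264467, 293, 295, 3436725205, 68725634, 34860992, 291, 303, 3388808035, 51, 293,
   3389430115, 219, 3392382565, 75782210, 293, 295, 225, 5112373987, 189, 4337533009, 261,
   5887214965, 155, 3562692031, 255, 3436728121, 217, 3435502681, 159, 3723681475, 297, 289, 11,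
   3434306591, 15, 3389414595, 13, 301, 3388719073, 265, 3435502711, 66500762, 265, 301,
   6787948411, 49, 3436728931, 85, 3392565301, 17, 305, 3388719077, 233, 3435502697, 68851058, 197,
   89, 3392355349, 79475220, 82403820, 58010792, 75550352, 49789168, 68725634, 34860992, 293, 303,
   3389507875, 75654050, 35970530, 89, 197, 3392355349, 233, 3392473447, 269, 3392591545, 183, 53,
   3392264629, 295, 293, 3436725205, 78290132, 78291572, 291, 305, 3388821157, 49, 301, 3388730113,
   193, 181, 3388719979, 161, 3809797597, 157, 3669452623, 289, 3392327773, 62674738, 34838798,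
   265, 193, 85, 3392565301, 157, 3688584499, 255, 3392336395, 231, 293, 159, 3765112003, 53,
   3389430277, 83, 3391931071, 69795062, 35429108, 83767066, 85644104, 59166824, 305, 293,
   3389520997, 83248628, 85218548, 161, 233, 3851205445, 197, 3841639507, 269, 3860771383, 195,
   267, 231, 159, 3755546065, 189, 4549518919, 261, 6080068999, 225, 5305228021, 219, 3392348059,
   85, 265, 3392565301, 157, 51, 3637613791, 295, 291, 3637588033, 49758496, 49758370, 62513132,
   229, 49, 3392585065, 157, 3679018561, 297, 305, 6929311717, 70144982, 49640290, 79447622,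
   34994804, 70116404, 34878164, 159, 267, 3774677941, 195, 3755546065, 231, 3765112003, 197, 233,
   269, 189, 4626046423, 225, 5391321463, 219, 3392361181, 255, 3392480737, 85, 265, 3392565301,
   229, 3392447203, 157, 53, 3637611037, 301, 293, 3389494753, 49874992, 64638106, 62629718, 229,
   49, 3392361991, 157, 3679018561, 295, 303, 3782118115, 79592822, 69818018, 69881684, 79551284,
   70116404, 70103444, 85, 265, 3392565301, 193, 3392329105, 229, 3392447203, 189, 157, 4337113105,
   233, 197, 4626046423, 62663270, 62674790, 293, 301, 3389494753, 297, 157, 6403355713, 269, 197,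
   267, 51, 3392363611, 79502102, 70094714, 62663270, 81558950, 35895686, 49, 219, 3392382403, 255,
   3392500501, 291, 301, 3388730113, 34363472, 34802672, 59158256, 157, 229, 3679018561, 265,
   3688584499, 197, 195, 269, 261, 6166162441, 51, 3392596891, 301, 297, 6757124833, 60370196,
   79474742, 79444706, 79444772, 82166372, 193, 189, 229, 4453859539, 195, 267, 4549518919,
   70094714, 79444772, 219, 229, 3392334937, 83, 3388778875, 293, 295, 3436726663, 79354520,
   35818898, 291, 301, 3392337853, 51, 53, 303, 3388730275, 49, 297, 6306507415, 267, 231, 233,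
   3392585389, 83332268, 69907926, 72033674, 79592822, 78295382, 79474742, 297, 301, 6768816535,
   231, 269, 233, 51, 3392598349, 79474742, 60413560, 79469636, 62629720, 34592396, 231, 233, 269,
   255, 3392480737, 51, 3392598349, 225, 5410453339, 305, 297, 6960135295, 291, 3392482195,
   34334636, 68732342, 81558950, 36056066, 79431812],
  [255, 3388780333, 185, 3389127337, 221, 3389245435, 257, 3389363533, 219, 3388778875, 183,
   3388777417, 155, 223, 3590799355, 259, 3600365293, 225, 5121349435, 189, 4346508457, 261,
   5896190413, 187, 3581233417, 291, 295, 3551494591, 297, 293, 6403342591, 37522796, 47202476,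
   293, 297, 6403342591, 46956236, 34567916, 123, 195, 3394441747, 267, 3394677943, 231,
   3394559845, 187, 159, 3734563987, 293, 291, 3411062947, 52990720, 28289282, 295, 303,
   3441995875, 51, 259, 3430188505, 291, 3435502915, 75665570, 121, 301, 3440932993, 265,
   3393615061, 66793784, 193, 265, 49, 3388778227, 301, 3441208555, 181, 3388781215, 291, 293, 289,
   261, 5876017525, 189, 4326335569, 225, 5101176547, 47, 3389429791, 157, 3688475149, 159,
   3734878915, 15, 3434306595, 11, 3389414591, 17, 305, 3388719077, 269, 3389429915, 85803062, 197,
   125, 3395504629, 77416008, 82403820, 75534476, 59368560, 59367102, 61291112, 76104392, 303, 293,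
   3394756675, 72739490, 75887330, 51, 267, 3388781305, 231, 3388779847, 195, 3388778389, 291, 293,
   303, 3388730275, 253, 3389429899, 47, 3389429791, 223, 3420628885, 217, 3389429881, 181,
   3389429863, 187, 3411062947, 289, 295, 11, 3389414591, 15, 3388729155, 261, 5876017525, 189,
   4326335569, 159, 3712914595, 297, 13, 157, 6209624353, 265, 3434307151, 62288528, 193, 121,
   3393378865, 157, 3669343273, 49, 3388778227, 301, 3388778353, 17, 305, 3388719077, 269,
   3389429915, 85803062, 197, 125, 3395504629, 77416008, 66803064, 73767930, 47677748, 75901730,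
   16256876, 70849760, 74706720, 125, 197, 3395504629, 233, 3395622727, 269, 3395740825, 195, 181,
   53, 3394980469, 267, 3388781377, 69039086, 187, 161, 3820657429, 267, 3413809819, 74729400, 217,
   53, 3394980487, 231, 3388778479, 26361806, 223, 231, 3423139561, 161, 3820775527, 81420422, 253,
   267, 3388778497, 53, 3394980505, 69049130, 259, 161, 3820893625, 267, 3432705499, 74729400, 267,
   289, 303, 3388778515, 11, 293, 3389414591, 305, 3395791883, 35272148, 15, 53, 3394980519, 295,
   3434307153, 69049168, 17, 305, 3388719077, 295, 3434306597, 38214068, 231, 291, 295, 293, 47,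
   3388771711, 159, 3764995813, 189, 4326335569, 53, 3435503077, 225, 5101176547, 161, 3820972357,
   13, 301, 3388719073, 229, 3388781407, 64323178, 121, 193, 3393378865, 77305982, 58287048,
   67976592, 37804370, 77225774, 77438444, 295, 305, 3443058757, 85101872, 37269284, 293, 305,
   3395819557, 74716926, 70849904, 293, 305, 3395819557, 85671788, 73304124, 53, 269, 3388781467,
   233, 3388780009, 197, 3388778551, 231, 293, 195, 291, 267, 223, 3423139561, 181, 3388779919, 15,
   3389429877, 259, 3430194823, 305, 3388730437, 295, 289, 303, 3442507633, 17, 3388729157, 13,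
   301, 3388719073, 229, 3388781407, 80657888, 193, 157, 3669343273, 85867062, 77305982, 84271200,
   82162932, 71177810, 84272658, 80612690, 80415860, 80625650, 121, 265, 3393615061, 193,
   3393378865, 229, 3393496963, 293, 301, 3393693793, 195, 267, 197, 187, 3413809819, 161,
   3844277029, 295, 157, 3648785473, 69032184, 66321392, 69045306, 74714010, 66539912, 49, 157,
   253, 3392854741, 187, 3411056467, 289, 295, 3626821153, 64119632, 15672218, 28287986, 78395460,
   49, 229, 3388779685, 267, 269, 197, 291, 159, 3778142149, 301, 3388730113, 78478584, 26266064,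
   25440512, 84272352, 78513252, 197, 181, 269, 3388781539, 231, 195, 3388779919, 72616290,
   80625650, 223, 233, 3424202443, 293, 291, 3420628885, 83209776, 83093136, 295, 305, 3443334319,
   159, 157, 303, 3782118115, 301, 3696024673, 161, 187, 3839513743, 189, 4604788783, 297,
   6504434479, 267, 195, 3844277029, 78411048, 76008326, 59402904, 69082584, 71920824, 195, 289,
   233, 303, 3388778515, 305, 3388778677, 159, 3759128371, 59519544, 69054054, 24556964, 72478896,
   231, 229, 265, 267, 15, 3388781247, 157, 3691103923, 13, 3388781407, 78426888, 69039086,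
   59473148, 82166208, 26361806],
  [219, 3388727035, 217, 3388719835, 255, 3388728493, 181, 3388719817, 183, 3388725577, 253,
   3388719853, 155, 223, 3590799355, 259, 3600365293, 225, 5121349435, 189, 4346508457, 261,
   5896190413, 187, 3581233417, 289, 295, 3540727711, 291, 297, 6306479551, 47188040, 43806920,
   297, 291, 6306479551, 45064040, 46848200, 85, 265, 3388794103, 193, 3388791187, 229, 3388792645,
   185, 121, 3392990227, 289, 291, 3389126005, 18708908, 63958344, 293, 301, 3389494753, 13, 221,
   3389244007, 289, 3389414593, 15205658, 87, 303, 3389507875, 231, 3388805767, 66805268, 267, 231,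
   195, 303, 3389515813, 15, 3388719867, 221, 3389279617, 291, 289, 121, 3392993953, 159,
   3755297035, 123, 3394676611, 223, 3420489205, 259, 3430055143, 295, 157, 3637588033, 17, 305,
   3388719077, 233, 3388719851, 67762266, 269, 89, 3388820347, 79360020, 77305982, 61285424,
   69784038, 75649734, 63967588, 66526952, 69792854, 291, 301, 3388794913, 15231578, 63843098, 13,
   265, 3388719865, 193, 3388719829, 291, 289, 221, 3389244103, 301, 3388719073, 257, 3389362201,
   11, 3388729151, 293, 223, 3420489205, 259, 3430055143, 187, 3410923267, 295, 121, 3434306593,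
   225, 5090409667, 189, 4315568689, 261, 5865250645, 297, 157, 6209624353, 15, 123, 3434306595,
   231, 3388719849, 62288528, 231, 303, 3389514355, 159, 3764862973, 17, 305, 3388719077, 233,
   3388719851, 66927794, 269, 89, 3388820347, 79475220, 77469134, 63153690, 66452468, 25978352,
   50731000, 60218186, 60219464, 89, 269, 3388820347, 197, 3388817431, 233, 3388818889, 193, 185,
   17, 3389125913, 265, 3389148397, 58408790, 221, 125, 3395117449, 229, 3389263579, 81930138, 257,
   125, 3395118907, 265, 3389381677, 83124240, 291, 305, 3388821157, 229, 289, 293, 11, 3388729151,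
   301, 3389501233, 157, 3669203593, 125, 3395119717, 223, 3420489205, 187, 3410923267, 17,
   3389414597, 295, 161, 3809774917, 225, 5090409667, 297, 15, 159, 6209624355, 123, 3434306595,
   77154090, 87, 231, 3388805767, 77438444, 69743700, 62678214, 83373234, 85333694, 85113374,
   81930148, 305, 293, 3389520997, 82973534, 25588094, 305, 291, 3388821157, 50730982, 85657208,
   17, 233, 3388719851, 269, 3388719869, 197, 3388719833, 289, 265, 193, 291, 305, 3388719077, 257,
   3389381677, 121, 3393613729, 293, 301, 3389502691, 223, 3420489205, 187, 3410923267, 295, 225,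
   5090409667, 297, 161, 6209624357, 15, 159, 6209624355, 123, 3434306595, 71843226, 87, 195,
   3388804309, 58300332, 69743700, 34992246, 79472516, 28264496, 18698702, 15628154, 60546074,
   16923182, 87, 231, 3388805767, 267, 3388807225, 195, 3388804309, 291, 303, 3388808035, 233, 193,
   265, 269, 257, 3389381677, 185, 3389148397, 121, 3393660907, 293, 289, 15, 3389414595, 60478098,
   24562796, 28542956, 79360268, 60228374, 76091252, 72367126, 15, 185, 3389125911, 257,
   3389362107, 293, 289, 3389414595, 73563116, 73409036, 79351452, 15, 231, 3388719849, 289, 193,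
   265, 197, 303, 3388719075, 125, 3395525689, 77274258, 81931608, 58378172, 79559928, 16805084,
   159, 157, 221, 267, 3775032235, 193, 3669806917, 69862856, 257, 193, 3669925015, 231,
   3765584395, 79430346, 193, 187, 3667326859, 121, 195, 3756608947, 293, 289, 3669203593,
   79349994, 50850556, 303, 295, 3782118115, 231, 293, 3389514355, 28057604, 50862076, 60478098,
   267, 293, 289, 3774428911, 69784038, 50731000, 67737110, 125, 303, 305, 3787432525, 85683060,
   79593300, 77390250, 301, 125, 305, 121, 265, 3395879983, 233, 3393779005, 58261532, 58377930,
   71920980, 77273610, 79475220],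
  [223, 3590799355, 259, 3600365293, 225, 5121349435, 189, 4346508457, 261, 5896190413, 187,
   3581233417, 121, 229, 3593988001, 193, 3584422063, 265, 3603553939, 185, 85, 3580223023, 295,
   297, 6501206467, 60223892, 60222614, 293, 301, 3393693793, 85, 295, 3436733953, 221, 3589788961,
   66322886, 295, 297, 157, 3648785473, 219, 6403348423, 255, 6403349881, 221, 6501324565, 183,
   6403346965, 291, 181, 6306479623, 49, 3435502753, 289, 11, 6209624351, 13, 3434306593, 15, 159,
   6209624355, 231, 6306479655, 45530132, 231, 123, 3595050883, 51, 6403349395, 303, 3595641373,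
   17, 305, 3388719077, 269, 6306479675, 85867358, 269, 305, 3606270193, 68850096, 77305982,
   73887318, 65971490, 44394548, 60223892, 60222614, 295, 301, 3440932993, 43929446, 63056966, 123,
   267, 3604616821, 231, 3595050883, 195, 3585484945, 193, 229, 221, 3584776357, 185, 3594224197,
   257, 265, 3584894455, 87, 3599368021, 65384754, 293, 301, 3594578491, 303, 3394756675, 295, 297,
   87, 3436747075, 219, 6403348423, 85, 6501258955, 49, 6403347775, 291, 181, 6306479623, 253,
   6306479659, 217, 6306479641, 51, 3435502915, 289, 15, 3434306595, 17, 305, 3388719077, 269,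
   6306479675, 85776746, 233, 305, 3596704255, 85656654, 44417822, 69902114, 50851996, 35663864,
   75901784, 303, 295, 3441995875, 73802264, 43930904, 303, 295, 3441995875, 64671306, 64204746,
   303, 295, 3441995875, 63634668, 63273084, 125, 233, 3596113765, 269, 3605679703, 197,
   3586547827, 295, 305, 3443058757, 267, 195, 193, 257, 3585957337, 185, 3604853017, 293, 297,
   303, 3605207311, 89, 3436760197, 49, 6403347775, 76443540, 85587242, 35626442, 63169566,
   72735504, 74966244, 89, 221, 3589815205, 257, 3599381143, 293, 305, 3395819557, 85457642,
   82397642, 44558168, 193, 185, 265, 3603790135, 231, 195, 3595287079, 72833046, 73766166, 221,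
   229, 3584776357, 297, 295, 6501324565, 64317012, 64226616, 257, 219, 3389369365, 265,
   3584894455, 291, 295, 3599324281, 65379894, 65390100, 229, 89, 233, 3584855089, 195, 293, 297,
   87, 3594289807, 305, 3389520997, 303, 3586075435, 49, 6403347775, 85891380, 83358492, 83329332,
   44457224, 233, 85, 197, 3586954609, 297, 295, 6501258955, 44558168, 34992246, 303, 197, 265,
   269, 87, 301, 3585078163, 231, 3586967731, 293, 3389507875, 73881510, 183, 13, 3388726183, 49,
   3388725739, 17, 3388725863, 70041444, 49, 181, 3388719979, 17, 3388720013, 255, 3388728655, 11,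
   3388720007, 253, 3388720015, 301, 291, 3388730113, 293, 3594578491, 18389444, 70041138, 305,
   293, 3596704255, 195, 231, 291, 13, 3388730377, 17, 3388730363, 70041444, 45064076, 50867890,
   79550196, 85643700, 293, 231, 3595641373, 73797432, 79352852, 231, 293, 3595641373, 79353222,
   73646610, 267, 293, 3605207311, 28264548, 74834052, 53, 11, 3388720331, 13, 3388720333,
   79370898, 76080660, 195, 293, 297, 87, 3594289807, 301, 3594578491, 303, 3586075435, 49,
   6403347775, 79594260, 83358492, 83329332, 72839508, 195, 293, 269, 297, 197, 301, 3585012553,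
   53, 6403351015, 49, 6403347775, 87, 3605981509, 78412020, 35006468, 64226616, 84275268,
   64341798, 35834450, 233, 231, 297, 269, 295, 221, 3606033997, 87, 3606099607, 89, 6501521395,
   293, 305, 3596704255, 219, 6403348423, 53, 6403351015, 49, 291, 301, 3388730113, 70054260,
   63146238, 70144980, 63265794, 63280374, 84524424, 63150612, 73908726, 83474664],
  [259, 3430540369, 223, 3420974431, 255, 3389134627, 219, 3389133169, 231, 51, 3389134141, 159,
   3765348199, 217, 267, 3389135689, 291, 295, 3435505597, 71914262, 71911382, 225, 267,
   5324596093, 291, 295, 5129874361, 71914262, 71911382, 261, 267, 6089871133, 291, 295,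
   5904715339, 71914262, 71911382, 253, 195, 3389160169, 183, 3388725685, 267, 3389134249, 295,
   291, 3435505615, 68722754, 72478898, 87, 187, 3411592201, 221, 3389271679, 181, 3388805839, 195,
   3389153581, 291, 293, 289, 303, 3388808035, 11, 3389430215, 123, 3394056835, 15, 3389414595, 13,
   301, 3388719073, 229, 3389430217, 72365174, 229, 265, 121, 3393523207, 157, 3681034975, 301,
   3389134105, 49, 3389133979, 17, 305, 3388719077, 269, 3388806053, 85750556, 125, 197,
   3395465263, 66803064, 77179848, 58010648, 35795048, 52979200, 72713636, 49786198, 53, 233,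
   3389134303, 269, 3389135761, 11, 125, 3394979993, 289, 295, 3434306627, 84524892, 84520518, 197,
   125, 3395465263, 291, 289, 3389165371, 84520518, 18711824, 267, 303, 289, 3389134267, 297,
   6874278049, 89, 183, 3389075983, 82046210, 16923182, 289, 305, 3388720357, 49, 265, 3389135437,
   301, 3388720033, 85, 13, 161, 189, 4078857595, 66916220, 66554690, 65896344, 60466046, 265, 157,
   3688820695, 161, 125, 295, 3799008037, 187, 3820618063, 181, 3394979983, 85451846, 85919064,
   85658102, 85917632, 89, 161, 183, 3389075983, 297, 291, 6306480037, 82066370, 82046210,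
   81475826, 16923182, 125, 295, 291, 3435503077, 69785618, 83372468, 83479830, 193, 121,
   3393339499, 85, 3389140459, 161, 305, 233, 3851441641, 297, 6929311717, 69055514, 60374580,
   60373932, 229, 157, 3679254757, 49, 3389133979, 197, 125, 3395465263, 78362412, 69703856, 269,
   161, 3861007579, 49, 265, 3389135437, 289, 303, 3389134267, 305, 3389135887, 301, 3388720033,
   85, 157, 291, 3388784833, 189, 4078832779, 44394494, 78219062, 85776182, 85, 183, 3389075659,
   291, 301, 3388730113, 44755934, 62934476, 60218222, 295, 121, 301, 3440932993, 78412022,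
   59466732, 37814540, 297, 157, 301, 6757124833, 78295982, 78243476, 78293012, 291, 217, 295,
   3435505597, 123, 87, 3394053199, 37829138, 37842260, 225, 295, 5129874361, 123, 87, 5129918101,
   37829138, 37842260, 253, 295, 3435505615, 123, 87, 3394053217, 37829138, 37842260, 261, 295,
   5904715339, 87, 123, 5904759079, 37842260, 37829120, 289, 295, 11, 3434306627, 297, 49, 301,
   3388730113, 265, 3389135437, 15, 159, 6209624355, 66553196, 66500762, 265, 157, 3688820695, 301,
   6788184607, 13, 193, 3434306629, 183, 3388725697, 159, 303, 3782118115, 36016682, 45530132, 121,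
   189, 4378394917, 193, 3393339499, 15, 303, 3388719075, 63273086, 73887318, 85, 187, 3411697177,
   193, 3389140459, 123, 15, 3434306595, 63153690, 73767930, 161, 233, 3851441641, 53, 3799008037,
   303, 15, 3388719075, 74305782, 66816342, 15, 159, 6209624355, 195, 3434306631, 123, 3434306595,
   89, 197, 3389166703, 73282740, 72192012, 269, 305, 3389135887, 123, 51, 3435502915, 68850738,
   67669782, 81499136, 123, 303, 3441995875, 59165510, 73794336, 87, 51, 3388797955, 47381990,
   47395112, 87, 51, 3388797955, 45489830, 45502952, 87, 159, 303, 3388808035, 195, 3389153581,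
   189, 4078845901, 35624948, 45529142, 16805084, 87, 159, 123, 195, 3389153581, 189, 4078845901,
   261, 5904759079, 297, 303, 6843218275, 44512646, 35974886, 35950100, 35963222, 35936978],
  [183, 3389249809, 187, 3411526591, 259, 3430658467, 255, 3389252725, 269, 161, 3861125677, 53,
   3389253859, 189, 197, 4635966655, 295, 291, 4364599321, 35018438, 37817312, 253, 197,
   3389251051, 295, 291, 3435507073, 35018438, 37817312, 261, 197, 6166516735, 295, 291,
   5914281277, 35018438, 37817312, 181, 219, 3388727107, 89, 3388820419, 233, 3389292811, 197,
   3389253931, 295, 291, 3435507037, 44558132, 49918750, 89, 233, 3389284801, 257, 3389402899, 223,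
   3421289359, 217, 3388820437, 291, 289, 297, 293, 295, 305, 3388821157, 11, 3389430395, 17,
   3389414597, 13, 301, 3388719073, 265, 3389430397, 66554690, 265, 301, 3441484117, 121,
   3393654427, 15, 267, 3434307639, 159, 6209624355, 71816558, 87, 159, 3723681475, 58287048,
   69743700, 58012214, 37817456, 36041972, 47422814, 49921612, 53110276, 49, 265, 3389253535, 193,
   3389250619, 11, 121, 3392854247, 289, 295, 3434306645, 61285280, 34769102, 229, 85, 3389258557,
   295, 291, 3435507127, 49873516, 37827500, 125, 225, 5155361659, 233, 3395583361, 301, 289,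
   3388720033, 50988868, 57114220, 297, 305, 6960489589, 301, 291, 3388730113, 157, 6757124833,
   62277206, 51, 267, 3389253697, 123, 15, 159, 231, 3394520479, 289, 6209624355, 74153642,
   72272750, 75227544, 75227712, 267, 303, 6874396147, 85, 157, 219, 3389193757, 293, 6403355713,
   34363472, 78531864, 78531542, 69084176, 121, 217, 3392854237, 291, 301, 3388730113, 47555294,
   46960574, 47406560, 231, 123, 3394520479, 87, 3389271679, 121, 157, 301, 193, 3669806917, 295,
   3440932993, 44308850, 70055700, 70093932, 70092492, 195, 159, 3755900359, 51, 3389250781, 229,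
   121, 3393457597, 59350092, 79267058, 229, 85, 3389258557, 121, 3393457597, 267, 159, 3775032235,
   51, 3389253697, 60490572, 51, 289, 305, 3389253985, 303, 3388720195, 123, 217, 3393917119, 293,
   3393917155, 34364912, 76430580, 123, 87, 217, 3393917119, 293, 291, 3389430115, 73446494,
   73447952, 49874956, 34887200, 87, 303, 291, 3388808035, 78485858, 79386902, 60373932, 87, 303,
   291, 3388808035, 49691266, 78389630, 78388658, 291, 181, 295, 3435507037, 161, 53, 3799012681,
   78291392, 81480038, 189, 295, 4364599321, 161, 53, 4364594623, 78291392, 81480038, 253, 295,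
   3435507073, 161, 53, 3799012717, 78291392, 81480038, 261, 295, 5914281277, 89, 125, 5914338139,
   80417138, 79354256, 289, 293, 295, 11, 3434306645, 297, 49, 301, 3388730113, 193, 3389250619,
   89, 53, 3389430277, 78295802, 79358630, 193, 301, 6769170829, 157, 3669806917, 121, 219,
   3393384697, 229, 3393457597, 89, 53, 3389430277, 78380366, 79358810, 13, 219, 3388727119, 229,
   3434306647, 89, 17, 3389414597, 63994956, 79358810, 159, 15, 6209624355, 267, 3775032235, 125,
   53, 3394980037, 78242576, 84802254, 17, 305, 3388719077, 53, 3388729157, 267, 303, 3389253823,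
   59519544, 62579076, 267, 303, 3389253823, 89, 125, 3395119717, 77300502, 79360020, 84856176,
   161, 125, 3820972357, 84515010, 81392540, 53, 125, 3394980037, 80418614, 78292886, 89, 125,
   3395119717, 80417138, 79354256, 89, 53, 3388811077, 78289988, 79352852, 89, 161, 233,
   3389284801, 305, 3388821157, 225, 4853700001, 45692006, 81475718, 79349936, 161, 89, 125, 233,
   3389284801, 225, 4853700001, 219, 3395116801, 297, 293, 6403381957, 83131988, 83484824,
   84390756, 79351394, 81477158],
  [219, 3389369365, 223, 3421210627, 187, 3411644689, 183, 3389367907, 49, 229, 3389370175, 193,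
   3389368717, 189, 157, 4374160237, 295, 291, 4374165259, 52872622, 63962720, 217, 157,
   3626827273, 295, 291, 3435508513, 52872622, 63962720, 11, 121, 3392854265, 289, 295, 3434306663,
   64080816, 63026682, 181, 13, 3389367757, 295, 291, 3435508495, 64077894, 64080810, 225, 157,
   5149001215, 295, 291, 5149006237, 52872622, 63962720, 265, 85, 3389376655, 291, 289, 3389375323,
   50733880, 50749774, 291, 301, 3388730113, 85, 255, 3389311855, 289, 3388784833, 65984414, 293,
   289, 297, 121, 3392854273, 13, 3388729153, 157, 6306479713, 51, 87, 3389430115, 195, 3389368879,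
   63967578, 195, 303, 3389369005, 159, 3756018457, 17, 305, 3388719077, 53, 3388729157, 66867858,
   89, 125, 3395119717, 77300502, 79360020, 68651236, 50743996, 50733880, 50731000, 85, 121, 255,
   3389311855, 293, 289, 3392854273, 63144716, 63843098, 63146238, 50749774, 157, 229, 3679490953,
   193, 3669925015, 293, 295, 291, 301, 3696024673, 121, 3648785473, 217, 3435508513, 85,
   3637588033, 181, 3435508495, 289, 11, 3434306663, 51, 87, 3389430115, 195, 3389368879, 63967578,
   195, 303, 3389369005, 159, 3756018457, 17, 305, 3388719077, 53, 3388729157, 59519544, 89, 53,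
   3389430277, 78531534, 79478100, 68651236, 49669540, 49685434, 49682554, 49685452, 53, 197,
   3389369041, 233, 3389370499, 189, 161, 4374160561, 295, 291, 4374165259, 53110276, 83212694,
   193, 217, 161, 3799014157, 229, 3389368807, 82048076, 11, 125, 3394980029, 289, 295, 3434306663,
   83094594, 82158558, 181, 229, 3389370247, 17, 3389367761, 82048068, 229, 225, 5219606971, 269,
   89, 3389402899, 289, 291, 3389401567, 18698610, 50970076, 291, 305, 3388730437, 51, 195,
   3389368879, 303, 3388730275, 87, 159, 261, 5628527857, 85927154, 72368090, 85658700, 267, 87,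
   3389389777, 161, 89, 297, 6306480037, 293, 3389430277, 261, 5628540979, 81925268, 59324822,
   85658102, 85682912, 125, 253, 3394980019, 305, 295, 3443058757, 83133392, 85232912, 83445972,
   289, 293, 125, 3394980037, 82166658, 63843164, 52874062, 295, 125, 291, 3435503077, 52859662,
   83098320, 62912960, 267, 87, 3389389777, 123, 3394638577, 125, 89, 269, 3395701459, 51,
   3395119231, 255, 3395118259, 293, 291, 3395119717, 69064260, 78289934, 70055052, 78359532, 269,
   89, 3389402899, 125, 3395701459, 161, 233, 3851677837, 295, 291, 3857604607, 50984512, 49918750,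
   181, 233, 3389409451, 295, 291, 3435508495, 53110276, 83212694, 189, 233, 4371427135, 295, 291,
   4374165259, 53110276, 83212694, 217, 197, 3389408011, 291, 295, 3435508513, 49905790, 49907212,
   195, 51, 3389368879, 159, 3756018457, 265, 85, 3389376655, 79425132, 81590262, 159, 231,
   3765584395, 295, 303, 3782118115, 123, 297, 6503096035, 259, 3734760817, 76005446, 78360504,
   123, 51, 259, 3734760817, 297, 291, 6306479875, 72594050, 73530086, 49786234, 78291492, 293,
   123, 303, 3394756675, 76093622, 79266732, 72713636, 87, 303, 123, 293, 3389507875, 259,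
   3427181137, 78290132, 75369462, 78360512, 78359540],
  [181, 3388719017, 253, 3388719053, 217, 3388719035, 53, 197, 3388720313, 269, 3388720349, 233,
   3388720331, 183, 89, 3388811033, 293, 289, 3389414645, 50970076, 79352960, 291, 305, 3388730437,
   49, 301, 3388730113, 229, 3388720007, 25506104, 265, 193, 301, 3388730231, 255, 3388728737, 289,
   293, 89, 3388811077, 17, 3388729157, 125, 3394980037, 85, 3389430035, 15, 51, 3388729155, 87,
   3389414595, 79503540, 195, 51, 3388720151, 85656654, 77421146, 85346654, 85113374, 85644104,
   59166824, 289, 305, 3388720357, 26561534, 26522654, 49, 229, 3388720007, 193, 3388719989, 265,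
   3388720025, 197, 183, 269, 3388726181, 89, 3388816783, 85, 3388784789, 79444652, 233, 219,
   3388727603, 289, 301, 3388720033, 291, 293, 305, 3388730519, 13, 3388729153, 89, 3389430359,
   121, 3392854273, 15, 51, 3388729155, 87, 3389414595, 66880500, 51, 267, 3388720187, 67737110,
   58247844, 66203258, 25262618, 301, 291, 3388730113, 64077818, 24653498, 291, 301, 3388730113,
   66515270, 49917256, 289, 301, 3388720033, 63850786, 49913026, 51, 231, 3388720169, 195,
   3388720151, 267, 3388720187, 289, 303, 3388720195, 269, 265, 193, 255, 3388728737, 89,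
   3388820591, 183, 3388725857, 291, 293, 301, 3388730231, 123, 3393917155, 76198740, 75780716,
   25586636, 76078130, 59165528, 78297242, 159, 123, 259, 3712914587, 187, 3712914551, 295, 293,
   3734878915, 73447952, 37278032, 73642380, 26397266, 193, 183, 229, 3388725839, 293, 289,
   3389414645, 26239802, 28248602, 255, 265, 3388728737, 293, 289, 3389414681, 59155322, 59158202,
   219, 121, 3393384697, 229, 3388727279, 293, 289, 3389414663, 64076442, 28248602, 265, 89, 269,
   3388820591, 291, 231, 293, 305, 3388821157, 303, 3388730375, 85, 3389430035, 125, 3395119717,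
   85879860, 78289916, 78496988, 78288656, 87, 267, 3388807469, 291, 293, 303, 3388808035, 301,
   3388730231, 123, 3394056835, 76198740, 68723978, 69004418, 123, 157, 261, 5982283855, 195,
   3671578387, 291, 297, 6306479831, 47394914, 50851996, 125, 305, 295, 3443058757, 293,
   3395819557, 269, 259, 3433492819, 37505444, 79352960, 59324822, 79502892, 301, 157, 291,
   3388730231, 261, 5982283855, 297, 6757124833, 46967702, 70055052, 70055700, 195, 197, 231, 233,
   291, 89, 3388817855, 85, 3388791611, 87, 3388806335, 305, 3388730519, 157, 123, 3671578387,
   68772660, 60374582, 59156780, 59486090, 59368010, 59473148, 59352134, 233, 269, 267, 231, 293,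
   219, 3388727639, 87, 3388807811, 89, 3388819331, 291, 305, 3388730555, 121, 301, 3393693793,
   125, 159, 3768300649, 70146422, 79503540, 59324820, 49668100, 28248440, 26358872, 68799992,
   78365930, 25180970],
  [181, 3388728565, 217, 3388728583, 125, 233, 3395630017, 197, 3395511919, 187, 17, 3411631781,
   289, 293, 3411631855, 81925272, 82158552, 223, 161, 3820782817, 289, 293, 3421197793, 82975040,
   53108800, 189, 269, 4380520681, 53, 4372965001, 295, 289, 4372964317, 49921612, 78291572, 225,
   269, 5155361659, 53, 5147805979, 295, 289, 5147805295, 49921612, 78291572, 269, 89, 3388819699,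
   289, 293, 3395688625, 28264548, 50970076, 297, 161, 305, 6929311717, 295, 6504158917, 85457642,
   295, 289, 293, 305, 3443058757, 17, 3434306597, 53, 3394980037, 13, 301, 3388719073, 229,
   3388728595, 64323178, 229, 265, 121, 3393504253, 301, 3441333943, 157, 6403363003, 15, 159,
   6209624355, 123, 3434306595, 71933928, 87, 159, 6403368835, 58287048, 69743700, 58012250,
   64086966, 82279574, 53097298, 83212694, 295, 305, 3443058757, 85587242, 83487722, 17, 233,
   3388728599, 197, 3388728581, 289, 293, 305, 3388719077, 223, 3421197793, 187, 3411631855, 89,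
   3389414597, 269, 3389414687, 295, 189, 4372964317, 297, 161, 6209624357, 13, 301, 3388719073,
   229, 3388728595, 81484592, 193, 265, 121, 3393386155, 301, 3441215845, 49, 3388728655, 15, 159,
   6209624355, 123, 3434306595, 71843226, 87, 267, 3388806577, 84802254, 69743700, 58051454,
   63037692, 85574282, 82162932, 82975038, 83208318, 123, 195, 3394449037, 231, 3394567135, 233,
   187, 159, 3734571277, 197, 3414761893, 81931914, 223, 197, 3424209733, 15, 3421197717, 82167468,
   189, 51, 4372964839, 289, 295, 4372964317, 49786234, 49802056, 269, 89, 3388819699, 53,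
   3388728979, 161, 225, 5379629761, 51, 3856404187, 297, 293, 6403389247, 78500436, 49789168, 225,
   267, 5154298777, 51, 5406086143, 289, 295, 5406085621, 68725634, 49802056, 267, 51, 3388728817,
   289, 293, 3394625743, 78500436, 49804972, 289, 305, 3388729105, 15, 295, 3434306595, 303,
   3388719075, 75891704, 295, 297, 293, 159, 6503096035, 87, 3436747075, 51, 3393917155, 13, 229,
   3388729081, 301, 3388719073, 81694908, 301, 121, 3440932993, 78451044, 69743700, 67578512,
   73928628, 72360792, 295, 303, 3441995875, 75535952, 73799312, 15, 289, 295, 3434306595,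
   84275574, 84284322, 77421146, 293, 303, 3394756675, 83218524, 83801724, 265, 49, 3388728655, 85,
   3388793455, 51, 87, 267, 3388728817, 13, 3388797949, 293, 303, 3389507875, 77271378, 71103956,
   77140644, 77153604, 195, 15, 3388728579, 187, 231, 3413699011, 289, 293, 3411631855, 73409100,
   73642380, 223, 231, 3423146851, 197, 269, 3421060453, 73678992, 73416552, 267, 51, 3388728817,
   87, 3388806577, 13, 229, 3388728595, 193, 3388728901, 289, 301, 3388719073, 121, 295,
   3434306593, 66319934, 77376336, 121, 295, 301, 3440932993, 65970014, 62820734, 69784206, 49,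
   301, 289, 3388720033, 58092278, 77348976, 77257284, 301, 49, 289, 3388720033, 67658216,
   77141454, 77233308, 289, 301, 13, 3388719073, 72613194, 72614490, 77224236],
  [253, 3388727143, 181, 3388727107, 121, 193, 3393384697, 265, 3393620893, 259, 157, 3648712573,
   293, 289, 3430645633, 62343806, 28287806, 189, 49, 4363398739, 295, 289, 4363398379, 25176920,
   37814378, 261, 49, 5913080695, 295, 289, 5913080335, 25176920, 37814378, 187, 13, 3411513679,
   293, 289, 3411513757, 58092278, 44295710, 229, 223, 3421801117, 49, 3388727197, 295, 293,
   3436739785, 59158256, 59159696, 289, 13, 301, 3388719073, 295, 3434306593, 37992254, 293, 295,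
   297, 301, 3393693793, 49, 3392854273, 85, 3436733953, 157, 3648785473, 15, 159, 6209624355, 231,
   3389414667, 62556710, 195, 267, 231, 123, 3394447579, 303, 3442277269, 51, 3388727359, 87,
   3388805119, 17, 305, 3388719077, 197, 3388727123, 60465902, 125, 269, 3395772901, 77469134,
   77179848, 73650150, 67753004, 72601362, 47367392, 58096688, 44295710, 295, 301, 3440932993,
   43903472, 26289374, 13, 193, 3388727119, 265, 3388727155, 293, 291, 289, 259, 3430645633, 301,
   3388719073, 229, 3389414665, 49, 3388729153, 85, 3389414593, 295, 189, 4363398379, 261,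
   5913080335, 297, 157, 6209624353, 15, 159, 6209624355, 231, 3389414667, 62556710, 195, 231, 123,
   3394447579, 303, 3442277269, 51, 3388727359, 87, 3388805119, 17, 305, 3388719077, 197,
   3388727123, 60465902, 125, 233, 3436766029, 64728654, 77179848, 73650150, 72601362, 61286720,
   63044178, 25203164, 25203182, 28274684, 125, 197, 3395510461, 269, 3395746657, 193, 187, 17,
   3411513683, 265, 3412752769, 61187576, 229, 49, 3388727197, 85, 3388791997, 259, 3430598689,
   157, 53, 3674651527, 295, 289, 3674650843, 50689978, 59501238, 189, 53, 4363399063, 295, 289,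
   4449491821, 50689978, 59501238, 233, 89, 3388818241, 293, 295, 3436766029, 79383956, 79352852,
   297, 161, 305, 6929311717, 295, 6504158917, 38228450, 295, 289, 293, 291, 305, 3443058757, 301,
   3441214387, 53, 3394980037, 15, 159, 6209624355, 231, 3389414667, 73652912, 87, 159, 3723681475,
   58287048, 69743700, 25452500, 82190978, 81496544, 83212694, 295, 305, 3443058757, 34602602,
   83214122, 53, 305, 289, 3388720357, 64076436, 64088106, 64086966, 293, 305, 3395819557,
   85630982, 28274684, 231, 51, 3388727359, 87, 3388805119, 53, 89, 233, 3388727521, 291, 289,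
   3388811077, 83208318, 26502260, 79500804, 78451044, 197, 17, 3388727123, 229, 49, 3388727197,
   85, 3388791997, 259, 193, 3430598689, 269, 3433774213, 77167256, 123, 267, 3394683775, 195,
   3394447579, 293, 303, 3394756675, 295, 87, 3436747075, 77233938, 38110352, 87, 159, 295, 291,
   3723681475, 18395276, 37527152, 28289264, 69804878, 289, 303, 51, 3388720195, 77153604,
   77271378, 73642380, 293, 87, 303, 3389507875, 77234586, 77325774, 77227296, 289, 15, 303,
   3388719075, 82168764, 82167468, 81954618],
  [253, 3388725685, 217, 3388725667, 121, 229, 3393501337, 265, 3393619435, 223, 13, 3420961519,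
   293, 289, 3420961597, 58092440, 28235498, 193, 49, 3388725739, 293, 295, 3436738327, 59159696,
   59158202, 289, 13, 301, 3388719073, 295, 3434306593, 25265534, 293, 295, 259, 3430527535, 301,
   3393693793, 49, 3392854273, 157, 3648785473, 261, 5903514397, 225, 5128673419, 297, 15, 267,
   3388725699, 159, 6209624355, 71813714, 195, 231, 123, 3394389547, 51, 3388725901, 303,
   3389512249, 17, 233, 3388726007, 305, 3388719077, 64833470, 125, 269, 3395745199, 77305982,
   77179848, 66500762, 72601362, 47419898, 58096778, 28235498, 295, 301, 3440932993, 16255418,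
   25239614, 13, 229, 3388725679, 265, 3388725697, 289, 291, 293, 301, 3388719073, 49, 3388729153,
   259, 3430527535, 223, 3420961597, 193, 3389414647, 295, 261, 5903514397, 225, 5128673419, 297,
   157, 6209624353, 15, 267, 3388725699, 159, 6209624355, 64112244, 195, 231, 123, 3394389547, 51,
   3388725901, 303, 3389512249, 17, 233, 3388726007, 305, 3388719077, 64833470, 125, 269,
   3395745199, 77377424, 77179848, 66500762, 72601362, 47545250, 37814540, 28274846, 18708908,
   16700108, 123, 267, 3394682317, 231, 3394564219, 193, 49, 3388725739, 85, 3388790539, 223, 159,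
   3734686459, 265, 3421267489, 65043906, 229, 259, 3430715329, 157, 51, 3665085427, 295, 289,
   3665084905, 68721242, 68725634, 195, 51, 3388725901, 289, 293, 3394389547, 59368562, 52814446,
   301, 303, 3394813537, 289, 3388725865, 16256876, 303, 293, 3394756675, 295, 3441995875,
   37514192, 265, 289, 295, 261, 5989607839, 15, 3434306595, 297, 159, 6503096035, 17, 305,
   3388719077, 269, 3388725863, 62579076, 197, 89, 3388816783, 79475220, 66803064, 47663330,
   25383632, 16256876, 60228410, 293, 303, 3394756675, 76065170, 74069528, 15, 303, 289,
   3388719075, 63026682, 63050010, 67740008, 197, 89, 3388816783, 53, 3388726063, 51, 87, 195,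
   3388725901, 291, 293, 3389430115, 72624876, 25321280, 70052964, 69003204, 195, 51, 3388725901,
   87, 3388803661, 17, 233, 3388725683, 269, 3388725701, 289, 305, 3388719077, 291, 53, 3388729157,
   69081936, 25498814, 53, 291, 305, 3388730437, 25497374, 25472894, 78452240, 53, 289, 305,
   3388720357, 68732016, 82158552, 58364484, 89, 291, 305, 3388821157, 73333464, 25321280,
   73254732],
  [225, 5150047249, 189, 4375206271, 85, 229, 3430710955, 193, 3430592857, 297, 157, 293,
   6403355713, 301, 6757124833, 28416290, 291, 293, 181, 6306483997, 301, 3388794913, 217,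
   6306484015, 121, 3392993953, 289, 13, 3389414593, 15, 159, 6209624355, 267, 6209624409,
   64112244, 231, 267, 87, 3430724077, 303, 3430732825, 51, 3432180907, 159, 3772552177, 17, 305,
   3388719077, 53, 3388729157, 69084018, 233, 89, 3432862963, 79360020, 64728654, 67737110,
   73887318, 52872604, 28287986, 52872622, 293, 301, 3389494753, 26096450, 28195970, 157, 265,
   3686458735, 297, 293, 291, 301, 6757124833, 181, 6306483997, 49, 6306479713, 289, 13,
   6209624353, 87, 51, 3389430115, 231, 3430724077, 58010792, 231, 303, 3430732825, 17, 305,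
   3388719077, 53, 3388729157, 59519214, 161, 89, 6403381957, 79592814, 81485460, 66526952,
   65968538, 60219662, 60221102, 60224018, 89, 197, 3430619101, 233, 3430737199, 181, 161,
   3809774179, 291, 297, 6306483997, 83096054, 53095858, 217, 17, 3430630799, 291, 297, 6306484015,
   82164384, 83445966, 265, 121, 3431367055, 301, 297, 6785822647, 293, 3431957545, 28187222, 49,
   161, 3809774269, 293, 289, 3431118025, 62674738, 62673316, 269, 125, 3433492819, 291, 293,
   3433383469, 28277618, 83445972, 305, 291, 3388821157, 293, 3389520997, 82973534, 291, 289, 293,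
   297, 53, 3388811077, 17, 3389414597, 161, 6403381957, 13, 6209624407, 15, 159, 6209624355, 267,
   6209624409, 84856176, 87, 159, 6403368835, 58287048, 69743700, 85572806, 28665446, 85116290,
   25588094, 17, 305, 289, 3388719077, 60218204, 62355470, 60124730, 267, 123, 3432429937, 159,
   3772552177, 53, 305, 289, 3388720357, 291, 3388730437, 253, 269, 3388720339, 79423286, 25000502,
   71961306, 71960172, 233, 269, 125, 3433492819, 161, 3858645619, 87, 231, 3433912723, 195,
   3430605979, 291, 303, 3388808035, 159, 297, 293, 6403368835, 28547348, 25385108, 79426266, 297,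
   159, 303, 6843218275, 25009268, 81674502, 73568948, 291, 303, 51, 3388730275, 81524652,
   81525786, 69857348, 291, 51, 303, 3388730275, 79423394, 79422260, 79423286, 159, 297, 303,
   6843218275, 76094348, 62349898, 71842838],
  [225, 5130915373, 261, 5905756351, 85, 229, 3411579079, 265, 3411697177, 193, 121, 3412235179,
   291, 293, 3412125829, 64341798, 65153904, 297, 157, 293, 6403355713, 301, 6757124833, 66203330,
   291, 293, 301, 3388794913, 253, 6306481117, 217, 6306481099, 121, 3392993953, 289, 13,
   3389414593, 15, 159, 6209624355, 195, 6209624373, 62543678, 195, 231, 303, 6852784213, 87,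
   6403486933, 51, 3413049031, 159, 3753420301, 17, 305, 3388719077, 53, 3388729157, 69084018, 233,
   89, 3413731087, 79360020, 64728654, 66500762, 72601362, 15205658, 28287986, 52872622, 293, 301,
   3389494753, 47545250, 28195970, 121, 193, 3412235179, 297, 291, 293, 295, 253, 6306481117, 217,
   6306481099, 157, 6502033153, 49, 3435502753, 289, 13, 3434306593, 87, 231, 3411592201, 51,
   3389430115, 15613574, 267, 303, 3411719047, 17, 305, 3388719077, 53, 3388729157, 60465302, 161,
   89, 3809774917, 79592814, 81485460, 69864368, 15624104, 37827536, 28261580, 50733898, 47393456,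
   89, 233, 3411605323, 269, 3411723421, 193, 157, 3667326859, 301, 293, 3412825669, 305,
   3412904401, 85335206, 197, 161, 3839513743, 293, 297, 6403500055, 81599774, 62673316, 265, 295,
   125, 305, 3443058757, 293, 3436760197, 85335206, 291, 293, 297, 161, 3809774917, 305,
   3388821157, 53, 3389430277, 253, 6306481279, 289, 13, 6209624371, 15, 159, 6209624355, 195,
   6209624373, 78244736, 87, 159, 3723681475, 58287048, 69743700, 26516822, 82046292, 28277618,
   80486168, 291, 305, 3388821157, 38214068, 45654584, 291, 305, 3388821157, 62355470, 65849370,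
   293, 125, 291, 3395119717, 50733898, 25207232, 28274702, 195, 123, 3413298061, 159, 3753420301,
   53, 305, 17, 289, 3388720357, 291, 3388730437, 217, 233, 3388719041, 60548082, 44748662,
   71816010, 71920986, 71829132, 291, 51, 303, 3388730275, 265, 295, 269, 297, 301, 3411705925,
   123, 3435502915, 305, 3411732169, 159, 6306479875, 71843226, 25385108, 79360124, 38097410,
   61291112, 265, 269, 301, 3411705925, 305, 3411732169, 87, 303, 3388808035, 60581940, 66880500,
   79268252, 65148396, 123, 303, 295, 3441995875, 44945996, 44875508, 25321280],
  [223, 189, 4365640333, 261, 5915322289, 85, 193, 3421026919, 265, 3421263115, 295, 157, 301,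
   3696024673, 291, 3637588033, 34828592, 297, 291, 293, 181, 6306482539, 301, 3388794913, 121,
   3436733953, 229, 3421691767, 49, 3389429953, 289, 13, 3389414593, 15, 51, 3388729155, 231,
   6209624391, 58010792, 195, 231, 87, 3421040041, 51, 6306482791, 123, 3422863999, 17, 305,
   3388719077, 53, 3388729157, 69084018, 125, 233, 3423926881, 64728654, 77179848, 62249198,
   72601362, 62343824, 62346866, 52859662, 62349638, 293, 301, 3389494753, 66321392, 62911472, 87,
   267, 3421276237, 195, 3421040041, 265, 295, 159, 303, 3782118115, 291, 3723681475, 75665570,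
   293, 297, 229, 291, 301, 3422391607, 157, 3676892797, 253, 6306482737, 51, 3389430115, 289, 13,
   6209624389, 15, 3389414595, 17, 305, 3388719077, 53, 3388729157, 69084018, 269, 89, 3421289359,
   79475220, 77299970, 25335842, 34900340, 71839922, 71915576, 28289282, 303, 291, 3388808035,
   72738050, 75887330, 303, 293, 3389507875, 60221102, 60228266, 89, 269, 3421289359, 197,
   3421053163, 291, 305, 3388821157, 295, 265, 293, 231, 161, 3809774917, 301, 3421271863, 125,
   3395119717, 159, 3762986239, 81642426, 85658846, 44632166, 60229724, 38214068, 125, 305, 295,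
   3443058757, 82159988, 35064788, 44571254, 193, 301, 291, 3421035667, 229, 297, 6776256709,
   34592396, 26252942, 291, 295, 123, 231, 3422863999, 51, 3435502915, 303, 3441995875, 233, 125,
   3423926881, 79477620, 60555706, 49, 181, 3388719979, 121, 3435502753, 17, 53, 197, 3388719995,
   289, 3388729157, 70099458, 70054260, 70041138, 305, 53, 3388730437, 70055700, 70146420, 231,
   233, 159, 3762986239, 123, 3422863999, 125, 3423926881, 79475226, 37830614, 60429472, 233, 231,
   125, 3423926881, 161, 3849079681, 159, 3762986239, 81642426, 26372498, 26490596, 233, 231, 291,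
   125, 3423926881, 161, 3849079681, 159, 3762986239, 301, 49, 3388730113, 81641292, 81642426,
   50733898, 26372012, 26490110, 293, 301, 85, 3389494753, 121, 3393693793, 49, 291, 3388730113,
   289, 3388720033, 193, 181, 3388719979, 35299364, 63146238, 157, 295, 3696024673, 297,
   6757124833, 193, 261, 5909535487, 47202476, 37814396, 229, 181, 3389501305, 189, 4369419469,
   253, 3389501341, 261, 5919101425, 217, 265, 3389502781, 291, 3388730203, 65153904, 225, 193,
   5134694509, 295, 5245706629, 37827500, 231, 51, 3389501557, 159, 3766765375, 89, 305,
   3389520997, 161, 297, 6403381957, 233, 3852858817, 34602566, 59351064, 125, 305, 3395819557,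
   68732342, 79425132, 193, 265, 289, 13, 3388719073, 291, 295, 297, 17, 197, 3388730201, 305,
   3388719077, 87, 15, 3389414595, 73535940, 81931606, 15, 159, 6209624355, 123, 3434306595, 269,
   53, 3389503177, 71933928, 77182070, 269, 125, 3395762695, 159, 87, 3723681475, 77390250,
   77416008, 77438444, 303, 159, 3782118115, 73412018, 26447810, 159, 297, 15, 6209624355,
   73806012, 37743098, 37855400, 295, 87, 123, 3436747075, 73407642, 60429978, 44869676, 87, 297,
   159, 6403368835, 26397266, 46849622, 16805084, 303, 51, 289, 3388720195, 60218222, 59369522,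
   60228410, 87, 15, 289, 3389414595, 49669540, 63153690, 69700890, 295, 291, 195, 197, 267, 269,
   51, 87, 3389430115, 125, 3395746171, 17, 3388720193, 123, 3435502915, 77180010, 87, 125,
   3395530873, 53, 3388807711, 303, 3388808035, 78530100, 17, 181, 3388719023, 303, 3388730363,
   289, 305, 3388719077, 53, 3388729157, 60465302, 52874062, 125, 89, 3395119717, 59323524,
   77142084, 161, 125, 3820972357, 84292098, 64113702, 159, 123, 3734878915, 70943072, 64112244,
   53, 305, 3388730437, 64088106, 35809646, 87, 123, 3394056835, 35834450, 63967578, 52872622,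
   63962720, 305, 125, 3395819557, 89, 3389520997, 53, 289, 3388720357, 291, 3388730437, 253, 233,
   3389527585, 50984512, 24882404, 161, 297, 6929311717, 295, 3868211557, 193, 197, 265, 261,
   5997754693, 47202476, 66334352, 49905790, 25978352, 303, 87, 3389507875, 123, 3394756675, 49,
   121, 85, 289, 3392854273, 295, 3436733953, 181, 233, 3389527549, 83212694, 37269284, 78295380,
   70054260, 78412020, 85, 49, 291, 3389429953, 197, 193, 3389526181, 34828592, 49907212, 123, 87,
   291, 3394056835, 267, 265, 3394691065, 59438480, 75665570, 79594260, 76198740, 123, 159, 295,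
   3734878915, 269, 267, 3778457077, 75901730, 78291572, 81720186, 78217620, 303, 87, 3389507875,
   123, 3394756675, 159, 295, 3782118115, 297, 6843218275, 231, 261, 5920164307, 47202476,
   37829156, 13, 181, 231, 3389514427, 193, 3388719019, 73769228, 85, 51, 3389506447, 289,
   3389414593, 295, 231, 229, 3442402657, 26323898, 49802056, 37269284, 161, 125, 53, 295,
   3820972357, 289, 3394980037, 37269284, 69913142, 85773786, 72272346, 161, 125, 295, 3820972357,
   195, 197, 3844355761, 38214068, 37828976, 85747542, 72272022, 85, 121, 295, 3436733953, 291,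
   3392993953, 193, 261, 5908944997, 225, 5134104019, 44869676, 25978352, 291, 49, 3389429953, 51,
   87, 3389430115, 125, 53, 89, 3395119717, 289, 3394980037, 295, 3435503077, 123, 161, 195, 181,
   3799008631, 37269284, 15746628, 79594262, 76443540, 59519220, 85891380, 161, 89, 53, 3389430277,
   295, 3809774917, 159, 195, 265, 3756070945, 59159696, 59356896, 59519544, 59402580, 59402904,
   267, 265, 233, 51, 3388794427, 123, 3394691065, 17, 3388794209, 68628336, 24892628, 65153904,
   75665570, 89, 291, 53, 3389430277, 125, 3395119717, 123, 51, 87, 3394056835, 17, 3393925811,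
   295, 3435502915, 49, 15, 231, 229, 3388720011, 85473072, 60429472, 85776018, 78337140, 78531540,
   78217620, 267, 233, 181, 3388818961, 15, 3388819011, 159, 3775110967, 289, 17, 3389414597,
   85773780, 35299364, 24892628, 75665570, 15, 51, 229, 13, 231, 3388720171, 265, 291, 253,
   3388719055, 87, 3389430115, 289, 3388729155, 16805084, 34339010, 60228410, 159, 123, 295,
   3734878915, 289, 3393917155, 195, 181, 3388719021, 37269284, 25383650, 76444818, 60582420, 291,
   267, 289, 3388729155, 253, 3388719057, 15205658, 76256060, 79444672, 121, 157, 161, 295,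
   3648785473, 197, 193, 3842702389, 25978352, 38214068, 79477622, 60581942, 60581940, 121, 157,
   161, 295, 3648785473, 197, 193, 3842702389, 25978352, 38214068, 76212180, 76445460, 60581778,
   265, 193, 229, 195, 231, 267, 233, 197, 181, 87, 3388807459, 17, 3388719023, 49, 3388719979, 85,
   3388794175, 53, 3388720303, 15, 3388719021, 123, 161, 3853331209, 81392166, 69821124, 289, 269,
   53, 123, 3394568269, 87, 3388807711, 85, 3388793131, 13, 3388720315, 253, 3388720339, 305,
   3388720357, 291, 17, 3388729157, 69809298, 18389444, 189, 121, 4627109305, 125, 4380520681, 157,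
   4432601899, 159, 4518695341, 303, 15, 3388719075, 78192168, 78297144, 297, 17, 85, 3388794515,
   305, 3388719077, 87, 3388804433, 49, 3388720013, 123, 6209625059, 69822420, 89, 157, 3672129511,
   51, 3388820671, 13, 3388817533, 303, 3388817881, 78530418, 125, 303, 6858098623, 13, 6209625199,
   301, 6781571119, 51, 3395641195, 79268814, 157, 87, 3669990625, 301, 6757124833, 13, 6209624353,
   123, 3671578387, 77349138, 15, 85, 3388794675, 159, 6209624355, 303, 3388719075, 79426266, 13,
   301, 3388719073, 159, 303, 6843218275, 77468982, 77417142, 51, 85, 3388792969, 303, 3388720195,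
   76080654, 69003846, 35423276, 17, 305, 3388719077, 85335188, 77227250, 35260484, 305, 125, 261,
   5920636699, 189, 4457048185, 295, 3443058757, 44041676, 28277618, 35272148, 305, 125, 161, 295,
   3443058757, 297, 6929311717, 197, 261, 6083257645, 47087276, 28067828, 83093138, 83329332,
   34366388, 87, 159, 303, 253, 3388804417, 217, 3388804561, 295, 3782118115, 37505444, 75772130,
   71912678, 69787076, 159, 87, 303, 253, 3388804417, 217, 3388804561, 295, 3782118115, 37505444,
   36010850, 50863516, 73763396, 159, 303, 123, 295, 3782118115, 297, 6843218275, 231, 261,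
   5919573817, 47087276, 28079330, 72477438, 35427650, 28289282, 85, 301, 181, 3388794175, 253,
   3388791295, 291, 3388794913, 18389444, 34219472, 35818898, 121, 301, 225, 5153235895, 189,
   4378394917, 295, 3440932993, 37522796, 28414832, 28274702, 49, 301, 291, 3388730113, 289,
   3388720033, 193, 181, 3388719979, 35299364, 62937392, 66216272, 59158256],
  [223, 3420738235, 187, 3411172297, 221, 3392394715, 185, 3392276617, 299, 295, 3439870111, 293,
   3392630911, 47, 219, 3388727035, 217, 3388719835, 289, 3388719871, 181, 3388719817, 183,
   3388725577, 291, 3388729951, 253, 257, 3391791373, 259, 255, 3425936653, 24556964, 37269284,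
   259, 255, 3425936653, 18389444, 37505444, 87, 303, 3392696521, 231, 3392460325, 195, 3392342227,
   183, 51, 3392264467, 259, 257, 3427159267, 49803548, 49789472, 255, 267, 3388806577, 51, 257,
   3389312017, 291, 3392618761, 72504770, 259, 257, 289, 3425936779, 181, 3425936725, 217,
   3425936743, 159, 3723680017, 83, 3391929613, 123, 3427181137, 189, 4337414911, 155, 3562573933,
   297, 6661937845, 225, 5112255889, 291, 3427163641, 253, 261, 11, 3424740653, 13, 193,
   5434783717, 85, 3389296495, 68651098, 229, 49, 5531667895, 85, 3392447203, 17, 305, 3425936795,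
   125, 3424740659, 85221528, 197, 89, 3392355349, 68771372, 82403820, 64361556, 49799210,
   49790876, 49803548, 49789472, 267, 257, 3389389777, 28079330, 75901730, 85, 301, 3392683399,
   193, 3392329105, 229, 3392447203, 183, 49, 3392264305, 257, 259, 3427159267, 49710254, 49685450,
   255, 265, 3388793455, 53, 269, 3388728979, 197, 181, 3388720303, 11, 3388720313, 13, 3392353921,
   253, 3392353999, 48648776, 82279598, 305, 233, 197, 269, 3392716933, 89, 3392709643, 161,
   3870337321, 291, 3392482195, 231, 259, 51, 3392362153, 17, 3425936795, 15, 3425936757, 157,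
   3637586575, 62602736, 64077872, 79563344, 64205078, 63155318, 64244444, 257, 265, 3389376655,
   66335792, 25978352, 159, 303, 3784243879, 195, 3755546065, 231, 3765112003, 229, 193, 301, 157,
   3679018561, 183, 3392451577, 219, 3392334937, 89, 197, 3392355349, 161, 49, 3809797597, 259,
   255, 3809773459, 49638938, 49638812, 82312154, 305, 53, 3392457085, 161, 3870337321, 259, 267,
   3772552177, 69860660, 49875494, 15746628, 25309650, 63031090, 69878770, 157, 229, 3679018561,
   193, 3669452623, 301, 3698150437, 195, 303, 231, 297, 6854909977, 183, 3392700895, 291,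
   3392350975, 189, 4559084857, 89, 197, 3392355349, 161, 51, 3809802133, 257, 261, 5628540979,
   49755470, 49755596, 82166372, 305, 53, 3392470207, 161, 3870337321, 261, 265, 5982283855,
   60412820, 49874054, 79444672, 34758610, 69878770, 34875250, 89, 197, 3392355349, 305,
   3392709643, 233, 3392473447, 189, 161, 4337139349, 303, 195, 4559084857, 62676310, 62676796,
   257, 269, 3389402899, 261, 161, 5628540979, 231, 229, 301, 51, 3392690203, 81524660, 82310714,
   82166372, 85454810, 83368202, 53, 291, 3392618923, 183, 3392264629, 255, 269, 3388819699,
   82070708, 24892628, 49922132, 161, 233, 3851205445, 193, 195, 301, 51, 3392688745, 269, 259,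
   3858645619, 49758530, 79425140, 79542876, 79550166, 36056068, 193, 183, 301, 3392687773, 195,
   231, 3392464699, 79563338, 25309650, 189, 301, 4472991415, 195, 231, 4539952981, 79563338,
   25309650, 219, 229, 3392334937, 83, 3388778875, 259, 257, 3427160725, 50748818, 50747378, 255,
   265, 3392336395, 51, 267, 3388728817, 49, 181, 3388719979, 253, 3392327755, 197, 305,
   3392714827, 72266918, 71960738, 72193460, 60529460, 261, 265, 5993975557, 303, 51, 305, 197,
   3392365069, 60536030, 60576692, 60529460, 60457136, 44041676, 231, 233, 303, 291, 3392469073,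
   225, 5333925835, 53, 3392703487, 267, 255, 3392703811, 261, 6089634937, 45065516, 69860660,
   72194056, 36056068, 79431812, 47, 219, 3388727035, 217, 3388719835, 181, 3388719817, 183,
   3388725577, 253, 257, 3391791373, 291, 295, 3435502591, 56766956, 56522174, 291, 295,
   3435502591, 56768378, 56520680, 229, 157, 3679018561, 85, 3392447203, 183, 193, 3392451577, 83,
   3388777417, 259, 257, 3427159267, 50735372, 50733932, 189, 155, 4346508457, 193, 4453859539,
   295, 293, 4337533009, 63147698, 63031058, 219, 193, 3392334937, 49, 3388727197, 295, 293,
   3436726663, 49672492, 49671052, 225, 155, 5121349435, 193, 5219134579, 257, 259, 5112255889,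
   52858238, 52861136, 261, 265, 6003541495, 49, 255, 5531667895, 293, 295, 3436727473, 56772770,
   56640254, 13, 253, 5434783735, 217, 3388719037, 291, 193, 295, 3435502675, 56759792, 49670996,
   56520680, 269, 197, 6166162441, 161, 6154470739, 233, 6175728379, 257, 293, 259, 291, 295, 255,
   297, 89, 3389402899, 155, 3562573933, 83, 3427154893, 305, 3434083309, 301, 3392455951, 217,
   3435502681, 289, 253, 11, 3434306591, 17, 6209624411, 15, 51, 6269262009, 267, 3434306667,
   68771372, 87, 159, 3723071023, 62487230, 69743700, 57106796, 60534556, 82427174, 62661794,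
   62663648, 49666480, 49666514, 82190978, 49666496, 155, 121, 3593988001, 259, 5726129293, 293,
   291, 295, 3562692031, 89, 125, 3395119717, 84434838, 79383956, 56520734, 59158256, 231, 267,
   6089634937, 159, 3765112003, 305, 89, 197, 3392355349, 291, 3388821157, 82160024, 79383380,
   85644032, 159, 195, 3755546065, 267, 6068377297, 293, 291, 295, 301, 3392455951, 83, 3391931071,
   303, 3782118115, 233, 161, 3851205445, 81522914, 83218550, 72743630, 73880042, 73881500, 255,
   233, 291, 53, 5531668219, 303, 87, 3388808035, 78336500, 78363392, 52990720, 83793308, 52993634,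
   295, 291, 293, 301, 3392455951, 217, 3435502681, 155, 3562692031, 289, 11, 3434306591, 15, 195,
   3435502677, 51, 3388729155, 49787708, 195, 159, 3755546065, 17, 305, 3388719077, 233,
   3435502697, 57360398, 89, 233, 3392473447, 48855884, 79475220, 48726284, 56414156, 56640308,
   56522210, 56756948, 257, 293, 83, 255, 3391929613, 295, 3436720831, 219, 3388778875, 56756894,
   259, 219, 3427160725, 189, 4337414911, 155, 3562573933, 183, 3427159267, 225, 5112255889, 255,
   181, 3425936725, 217, 3425936743, 261, 289, 11, 3425799161, 291, 295, 253, 297, 89, 53,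
   3389430277, 197, 3392355349, 301, 13, 5434783447, 64086966, 64323178, 197, 269, 6166162441, 53,
   3392354017, 17, 5434783721, 305, 3392364097, 15, 51, 6269262009, 231, 3425936757, 85, 157,
   3637095661, 64626110, 78505304, 49, 85, 6355356247, 157, 5617259785, 195, 159, 3755546065,
   78216966, 79441848, 195, 267, 3392349517, 301, 13, 5434783447, 79266092, 67929944, 72482130,
   157, 49, 5617259785, 79266952, 52875652, 13, 157, 5520522523, 63964178, 63846072, 157, 301,
   3696024673, 57124130, 52875518, 157, 265, 5982283855, 63962726, 63962720, 85, 157, 5628514735,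
   52872622, 50749774, 157, 265, 5982283855, 63958352, 52874062, 85, 49, 3389311855, 49682570,
   50748368, 301, 85, 3389494753, 50749772, 57125606, 85, 301, 3389494753, 57124184, 50746892, 49,
   265, 85, 3389376655, 83, 3391930423, 50748334, 64197464, 49685452, 49, 301, 291, 3388730113,
   289, 3388720033, 183, 217, 3388725667, 56417036, 56522174, 57125624, 49685450],
  [185, 3389127337, 221, 3389245435, 219, 3388778875, 183, 3388777417, 299, 291, 3388781791, 293,
   3389481631, 155, 223, 3590799355, 297, 6671031391, 225, 5121349435, 189, 4346508457, 295,
   3609931231, 187, 3581233417, 255, 259, 3551493133, 261, 257, 5628501613, 37754636, 46954796,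
   261, 257, 5628501613, 25003436, 47087276, 123, 195, 3394441747, 231, 3394559845, 303,
   3394796041, 187, 159, 3734563987, 257, 255, 3411061489, 52978082, 53015522, 259, 267,
   3432429937, 51, 295, 3439754443, 255, 3425936977, 75888770, 121, 265, 3431367055, 193,
   3393378865, 73566104, 193, 301, 229, 49, 3388778227, 265, 3431642617, 289, 3388778353, 255, 257,
   253, 225, 5101175089, 189, 4326334111, 47, 3389311693, 159, 3734760817, 15, 3424740657, 11,
   3389296493, 17, 233, 3388782707, 125, 3424740659, 83099292, 197, 125, 3395504629, 77415540,
   82403820, 73643756, 59394642, 59353818, 64125852, 66212250, 63036726, 267, 257, 3394638577,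
   34946690, 75665570, 51, 303, 3388782763, 231, 3388779847, 195, 3388778389, 255, 257, 267,
   3388728817, 223, 3420627427, 187, 3411061489, 295, 3439759303, 87, 3389312017, 217, 3389311783,
   289, 3389311819, 259, 253, 225, 5101175089, 189, 4326334111, 297, 6650857045, 15, 3388727697,
   11, 3389296493, 159, 3712914577, 13, 193, 3389311777, 85, 3389296495, 15626698, 229, 301, 265,
   3388779793, 121, 3393496963, 17, 233, 3388782707, 125, 3424740659, 83335326, 125, 305,
   3395858923, 73810212, 77415540, 72862520, 64361556, 72504734, 75667380, 75652800, 51954242, 125,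
   197, 3395504629, 233, 3395622727, 305, 3395858923, 195, 181, 53, 3394980469, 303, 3388782835,
   69050608, 187, 53, 3411056791, 303, 3413927917, 69050608, 217, 53, 3394980487, 231, 3388778479,
   78499888, 223, 231, 3423139561, 161, 3820775527, 73574664, 231, 253, 267, 3388779955, 11, 269,
   3395673785, 257, 3389296493, 82973534, 15, 53, 3394980501, 259, 3424741179, 69039122, 17, 259,
   3424740659, 269, 3388719059, 85231508, 259, 257, 255, 303, 159, 3764995795, 53, 3394980019, 161,
   3820854259, 89, 3427194259, 47, 3388771693, 295, 3439759303, 289, 3389311819, 13, 301,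
   3388778527, 85, 3389296495, 60534556, 193, 121, 3393378865, 58287048, 69079824, 75660414,
   48858746, 67974764, 68013986, 259, 269, 3433492819, 85232912, 35310992, 269, 257, 3395701459,
   73566402, 73693248, 257, 269, 3395701459, 72630366, 73330206, 53, 233, 3388780009, 197,
   3388778551, 255, 195, 303, 257, 269, 3388728979, 289, 3388778515, 181, 3388782835, 187,
   3413927917, 295, 3442271437, 223, 3420627427, 159, 3784133071, 217, 3389311783, 89, 3389312179,
   253, 259, 11, 3389296493, 161, 3799008019, 13, 301, 3388778527, 85, 3389296495, 60534556, 301,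
   265, 3431996911, 72258900, 83373234, 83247170, 83093054, 83092974, 83093172, 83132052, 52045934,
   121, 193, 3393378865, 301, 3393733159, 229, 3393496963, 257, 265, 3393575695, 305, 231, 233,
   159, 3768930505, 217, 3388783015, 49, 253, 3392854255, 63053978, 78399222, 69058266, 78506106,
   85342668, 49, 157, 187, 3411056467, 181, 3392854705, 259, 253, 3626821135, 27841658, 34219472,
   52871666, 78382176, 195, 181, 303, 3388782835, 255, 257, 3389311765, 78526518, 51954242, 187,
   303, 3413927917, 255, 257, 3411061489, 78526518, 51954242, 259, 267, 3432705499, 157, 265,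
   3686458735, 161, 159, 269, 3858645619, 253, 3755429857, 229, 301, 303, 3785700421, 80650418,
   80532320, 51809720, 78478422, 65688342, 78517302, 233, 197, 229, 15, 3388780095, 157,
   3682482769, 13, 3388778653, 78426888, 63962556, 69040770, 83094432, 233, 301, 229, 305, 17,
   3388782707, 157, 3682837063, 13, 3388783027, 68979048, 85348212, 72620016, 72477456, 26478448,
   155, 223, 3590799355, 225, 5121349435, 187, 3581233417, 255, 259, 3551493133, 293, 297,
   6403342591, 56887988, 56637374, 297, 293, 6403342591, 56640254, 56889410, 125, 197, 3395504629,
   233, 3395622727, 255, 187, 161, 3820657429, 257, 3411061489, 53094416, 223, 257, 3420627427,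
   161, 3820775527, 53094416, 257, 47, 3389311693, 217, 3389311783, 269, 3395701459, 181,
   3389311765, 289, 291, 293, 295, 53, 3394980037, 11, 3389414591, 161, 3820972357, 189,
   4326335569, 225, 5101176547, 253, 259, 261, 297, 13, 301, 5434783447, 229, 3389311795, 64323178,
   229, 49, 3388779685, 265, 3388779793, 121, 3393496963, 15, 51, 6269262009, 267, 3434306667,
   59389776, 159, 51, 5728006027, 65804334, 58287048, 64086966, 83096054, 53108870, 49917290,
   49908650, 83212700, 83093144, 82160024, 82276664, 295, 305, 3443058757, 57361820, 56765660, 293,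
   305, 3395819557, 57347384, 56647544, 53, 233, 3388780009, 197, 3388778551, 255, 293, 291, 257,
   269, 3388728979, 223, 3420628885, 217, 3389429881, 305, 3388730437, 181, 3389429863, 295, 259,
   289, 253, 189, 4326335569, 161, 3799008037, 17, 3388729157, 11, 3434313863, 261, 297, 13, 301,
   5434783447, 229, 3389311795, 81931112, 193, 157, 3669341815, 121, 3393378865, 49, 3388778227,
   301, 3388778353, 265, 3431642617, 15, 51, 6269262009, 267, 3434306667, 59389776, 159, 267,
   6403376125, 77455068, 62487230, 63037692, 83096052, 57360398, 52032956, 82158558, 82162770,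
   82162932, 83092974, 83209776, 83093136, 52045934, 121, 193, 3393378865, 229, 3393496963, 197,
   187, 233, 3414754603, 157, 3648470545, 83098320, 223, 233, 3424202443, 157, 3648588643,
   83098320, 255, 17, 49, 3392854721, 257, 3389311781, 78382176, 161, 49, 3841523677, 257,
   3841528699, 78382176, 181, 265, 3393563293, 233, 3388780081, 62919608, 217, 265, 3393563311,
   233, 3388778641, 62919608, 253, 47, 3388771693, 269, 3388778659, 11, 49, 3392848181, 257,
   3389296493, 78382176, 13, 49, 3388727695, 259, 3424740655, 78380366, 259, 291, 257, 293, 289,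
   295, 265, 3431367055, 49, 3425936815, 225, 5101175089, 301, 3393680941, 157, 3648667375, 305,
   3388778677, 297, 261, 15, 51, 6269262009, 267, 3434306667, 59389776, 159, 51, 5728006027,
   78427536, 62487230, 81392774, 81481748, 81480276, 64076436, 63843156, 49847288, 77318006,
   77305982, 293, 301, 3393693793, 57109712, 56640236, 301, 293, 3393693793, 56644628, 57111188,
   293, 301, 3393693793, 82049208, 82043376, 49, 229, 3388779685, 193, 3388778227, 257, 291, 255,
   293, 301, 3388730113, 223, 3420627427, 47, 3389311693, 187, 3411061489, 265, 3388728655, 217,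
   3389311783, 197, 259, 295, 253, 289, 161, 3841530157, 269, 3433768381, 225, 5101175089, 11,
   3424749383, 13, 3388727695, 297, 261, 15, 51, 6269262009, 267, 3434306667, 78516654, 159, 51,
   5728006027, 65804334, 58287048, 64349412, 81481748, 63144788, 57109712, 62912958, 63030894,
   82049208, 63961260, 51809738, 64077900, 63961098, 123, 195, 3394441747, 231, 3394559845, 257,
   267, 3394638577, 193, 233, 197, 13, 3388780093, 181, 3388780081, 223, 3424202443, 15, 289, 295,
   3434306595, 72597002, 73524290, 78310734, 82050504, 59493786, 78376344, 291, 303, 51,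
   3388730275, 78500274, 57227846, 56540966, 51, 231, 3388779847, 257, 197, 255, 267, 3388728817,
   161, 3841528699, 75056982, 51927836, 73534830, 73527036, 265, 197, 157, 261, 5982283855, 269,
   3692048707, 301, 297, 6757124833, 59502696, 84672510, 269, 267, 13, 3388778671, 15, 3388778673,
   78426888, 78360342, 69069462, 229, 255, 259, 3431760715, 187, 3411586369, 69040770, 51870974,
   82166208, 161, 159, 305, 303, 197, 3787708087, 195, 3872738647, 82692024, 78399870, 69083070,
   78478422, 81470742],
  [219, 3388727035, 217, 3388719835, 181, 3388719817, 183, 3388725577, 299, 289, 3388719871, 291,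
   3388729951, 155, 223, 3590799355, 297, 6671031391, 225, 5121349435, 189, 4346508457, 295,
   3609931231, 187, 3581233417, 253, 259, 3540727693, 261, 255, 5531638573, 37273640, 46848200,
   261, 255, 5531638573, 18496040, 43806920, 85, 301, 3388795561, 193, 3388791187, 229, 3388792645,
   185, 121, 3392990227, 253, 255, 3389125987, 51793862, 51808748, 257, 265, 3389376655, 13, 253,
   3389296495, 221, 3389244007, 64077818, 87, 267, 3389389777, 303, 3388808683, 75546068, 195, 231,
   303, 267, 3389394799, 15, 3388719831, 221, 3389276701, 253, 255, 159, 3755297017, 295,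
   3439621063, 223, 3420489187, 121, 3392992495, 11, 3388727693, 259, 157, 3637586575, 17, 233,
   3388719851, 125, 3424740659, 83373234, 305, 125, 3395891647, 77415540, 85473432, 64077872,
   67737416, 50792522, 62825972, 65988374, 63849488, 265, 255, 3388793455, 25235258, 65980058, 13,
   229, 3388719847, 193, 3388719829, 301, 3388719883, 255, 253, 221, 3389244085, 11, 3388727693,
   265, 3388719055, 185, 3389125987, 257, 295, 3439621063, 223, 3420489187, 187, 3410923249, 259,
   297, 6640091605, 121, 3424740655, 261, 15, 87, 3389296497, 231, 3388719849, 15626698, 231, 87,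
   3388805767, 159, 5628534337, 123, 3427187617, 267, 3389396257, 17, 197, 3388719833, 125,
   3424740659, 82311522, 233, 125, 5531707099, 77415540, 69886742, 63153690, 62791934, 64077872,
   50770364, 50745866, 50743940, 87, 303, 3388808683, 231, 3388805767, 195, 3388804309, 193, 185,
   301, 3389149855, 15, 3389125911, 72474534, 221, 229, 3389263579, 15, 3389244009, 75649734, 229,
   253, 11, 267, 3388806425, 255, 3388727693, 75534476, 15, 257, 3389296497, 267, 3388719057,
   75649676, 255, 301, 257, 121, 3393495613, 293, 3389480281, 265, 3389386051, 123, 3394055377,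
   295, 3439621063, 223, 3420489187, 187, 3410923249, 259, 159, 3723680017, 17, 233, 3388719851,
   125, 3424740659, 83335326, 125, 305, 3427203655, 73810212, 77415540, 58305650, 50675432,
   72390438, 48762518, 267, 255, 3388806577, 16256876, 73643756, 267, 255, 3388806577, 50743940,
   75552854, 267, 255, 3388806577, 50731304, 73532066, 15, 231, 3388719849, 195, 3388719831, 193,
   253, 301, 255, 267, 3388719057, 185, 3389149855, 293, 3389499775, 221, 3389244085, 11,
   3388727693, 257, 295, 3439621063, 223, 3420489187, 187, 3410923249, 259, 297, 6640091605, 123,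
   3424740657, 261, 159, 5434783377, 17, 197, 3388719833, 125, 3424740659, 82285890, 305, 125,
   3427203655, 77273610, 73810212, 72594068, 50865476, 73563116, 50862524, 60429418, 50863478,
   15626698, 89, 197, 3388817431, 305, 3388821805, 233, 3388818889, 255, 269, 3388819699, 229, 231,
   303, 293, 3389514355, 121, 3393532603, 257, 125, 3395118259, 84595056, 82973534, 85866746,
   82049702, 85236890, 125, 17, 221, 3395117449, 293, 3395120365, 257, 253, 3389296499, 16297214,
   25588094, 50676872, 52030058, 161, 185, 233, 3851441641, 301, 193, 3389149855, 70112088,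
   60547516, 193, 197, 221, 3841993801, 189, 4604788783, 121, 3842702389, 269, 261, 6154470739,
   257, 3389407921, 43685942, 58261776, 301, 229, 231, 253, 293, 3389499775, 123, 3394577989, 257,
   269, 187, 3410923249, 259, 3858645619, 70103652, 67709616, 50968976, 50968616, 73416888,
   70100586, 60534556, 305, 253, 257, 3870088273, 50792072, 50792036, 70138332, 123, 267, 265, 121,
   193, 3394696087, 231, 3393647785, 15626698, 58261290, 58261298, 67709138, 67709130, 89, 197,
   3388817431, 233, 3388818889, 253, 185, 255, 3389125987, 125, 3395115991, 52030058, 221, 255,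
   3389244085, 125, 3395117449, 52030058, 257, 269, 3389402899, 223, 3420489187, 17, 3389296499,
   187, 3410923249, 293, 291, 289, 295, 305, 3389520997, 53, 3389430277, 125, 3395119717, 11,
   3388729151, 155, 3540727711, 161, 3809774917, 225, 5090409667, 189, 4315568689, 255, 259, 297,
   261, 13, 265, 3434306665, 229, 3388719847, 82403340, 193, 121, 5531679397, 157, 5628519757, 265,
   3389381677, 301, 3389499775, 15, 51, 6269262009, 267, 3434306667, 78516654, 87, 159, 3723071023,
   62487230, 69743700, 63037692, 53092994, 82164384, 57360380, 57357428, 81926744, 83090228,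
   82160024, 81925286, 305, 291, 3388821157, 56517800, 57358904, 291, 305, 3388821157, 57345908,
   56529428, 17, 233, 3388719851, 197, 3388719833, 255, 291, 289, 253, 305, 3388719077, 221,
   3389244103, 53, 3388729157, 185, 3389126005, 11, 3388729151, 269, 3388719059, 257, 293, 223,
   3420489187, 187, 3410923249, 259, 295, 125, 3424740659, 225, 5090409649, 189, 4315568671, 155,
   3541331161, 297, 261, 161, 6295245407, 13, 265, 3434306665, 229, 3388719847, 82403340, 193, 121,
   5531679397, 265, 3389381677, 301, 3389499775, 15, 51, 6269262009, 267, 3434306667, 78516654, 87,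
   51, 6355356409, 65804334, 69743700, 63037692, 82046130, 34992246, 81926744, 50967212, 50967196,
   50968652, 50981576, 50981578, 50980138, 50980136, 87, 231, 3388805767, 195, 3388804309, 233,
   185, 197, 3389173183, 123, 3394053109, 73534974, 221, 197, 3389289823, 123, 3394054567,
   73534974, 253, 255, 11, 3388727693, 267, 3388806577, 291, 293, 289, 303, 3388808035, 123,
   3394056835, 305, 3389527477, 223, 3420489205, 187, 3410923267, 257, 295, 269, 3389409379, 159,
   3723071023, 155, 3540727711, 225, 5090409667, 261, 13, 85, 5628906967, 301, 5434783447,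
   79475234, 157, 193, 5628519757, 73767930, 62578098, 57229340, 73810212, 57227846, 72592628,
   72359348, 73407650, 303, 293, 3389507875, 56646086, 57239330, 291, 303, 3388808035, 57229268,
   56520680, 303, 291, 3388808035, 50990344, 72367126, 15, 231, 3388719849, 195, 3388719831, 253,
   289, 255, 267, 3388719057, 303, 3388719075, 221, 3389244085, 11, 3388727693, 185, 3389125987,
   233, 293, 257, 305, 3389527477, 223, 3420489205, 269, 3389409379, 295, 155, 3540727711, 225,
   5090409667, 261, 159, 5434783377, 13, 85, 5628906967, 301, 5434783447, 79475234, 157, 193,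
   5628519757, 85658742, 62578098, 57229340, 15746628, 57227846, 50850556, 72485222, 50862038,
   50863480, 50863478, 85, 193, 3388791187, 229, 3388792645, 255, 265, 3388793455, 195, 197, 231,
   291, 185, 3389160061, 125, 3395537353, 293, 121, 3392993953, 77389296, 63843170, 62791952,
   62917826, 63665780, 63849488, 13, 289, 301, 3388719073, 57108272, 56408432, 50910314, 13, 229,
   3388719847, 291, 195, 289, 301, 3388719073, 123, 3394440415, 67943058, 50745382, 79441848,
   50743942, 265, 197, 257, 269, 3389407921, 121, 3393575695, 58261776, 185, 233, 3389173183, 193,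
   255, 3389147749, 50795132, 82979928, 193, 231, 195, 289, 121, 3393411589, 221, 3389276701, 267,
   303, 293, 3389514355, 255, 3388728943, 56648840, 60478098, 60477936, 56414120, 50675432,
   50862056, 50792072, 229, 255, 257, 3389383135, 221, 3389265847, 50968652, 50676872, 70100586,
   305, 303, 125, 123, 159, 3787432525, 161, 3872463085, 58287218, 70042416, 77390736, 60478106,
   60361466],
  [223, 3590799355, 225, 5121349435, 189, 4346508457, 187, 3581233417, 299, 297, 6671031391, 295,
   3609931231, 121, 301, 3613119877, 229, 3593988001, 193, 3584422063, 185, 85, 3580223023, 261,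
   259, 5726365489, 50750294, 50748368, 257, 265, 3393575695, 85, 293, 3608920837, 259, 3427168015,
   63058406, 261, 259, 291, 5628510361, 293, 5726719783, 255, 289, 5531638699, 49, 3425936815, 181,
   5531638645, 217, 5531638663, 253, 13, 3424740655, 11, 5434783373, 15, 51, 3388727697, 303,
   5531638713, 68812954, 303, 51, 3613933711, 123, 3614182759, 267, 3614655151, 87, 3614071951, 17,
   125, 3424740659, 197, 5531638661, 81930012, 233, 89, 3596002957, 68771372, 69886742, 75767832,
   50735660, 50735678, 50750294, 50748368, 259, 265, 3431367055, 66455366, 37995206, 125, 233,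
   3596113765, 305, 3615245641, 197, 3586547827, 193, 221, 229, 3584776357, 89, 3589815205,
   64323330, 229, 185, 3594224197, 257, 265, 3584894455, 269, 3395701459, 301, 261, 259, 293,
   3594578491, 291, 5628510361, 183, 5628505987, 219, 5628507445, 161, 5729317939, 89, 3427194259,
   255, 13, 5531638711, 289, 5531638699, 53, 3425937139, 253, 11, 5434783373, 15, 51, 3388727697,
   87, 3389296497, 65817612, 159, 51, 5531638897, 65804334, 58287048, 83093054, 83212628, 83214122,
   82162922, 83332274, 269, 259, 3433492819, 34602602, 85457642, 269, 259, 3433492819, 64828608,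
   64363506, 269, 259, 3433492819, 63293334, 63300624, 123, 231, 3595050883, 303, 3614182759, 195,
   3585484945, 259, 267, 3432429937, 305, 233, 193, 293, 3596704255, 221, 3615599935, 257, 261, 87,
   3427181137, 269, 3596586157, 49, 5628506797, 84828498, 72713624, 73766264, 63299166, 83493924,
   85475346, 305, 197, 87, 293, 3587138317, 185, 3615481837, 257, 267, 3389389777, 75773624,
   35624984, 50894312, 82398966, 85587612, 231, 185, 195, 3595287079, 261, 259, 5726365489,
   72833028, 72742632, 221, 303, 3614537053, 197, 233, 3586902121, 83332284, 82399164, 293, 183,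
   3389486005, 51, 3389488435, 303, 3595641373, 255, 259, 3608888761, 49831268, 51955538, 195, 89,
   197, 3595365811, 229, 257, 261, 85, 3585891727, 267, 3595523275, 269, 3389402899, 51,
   5628506959, 84815538, 82282326, 82397508, 82305510, 305, 87, 233, 3615665545, 193, 301,
   3613421683, 66462216, 83368230, 233, 265, 85, 229, 3585891727, 257, 3389376655, 79339938, 197,
   181, 53, 3388720303, 11, 3388719017, 15, 3388719021, 67577604, 49, 255, 3388728655, 253,
   3388720015, 301, 291, 3388730113, 18389444, 50774540, 269, 267, 257, 3596586157, 253, 53,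
   3388720339, 15, 3388719057, 13, 3388719055, 67708644, 25975418, 79579698, 70131858, 301, 257,
   3613592269, 50971568, 82310712, 51, 11, 3388720169, 17, 3388720175, 70040976, 79501938, 193,
   261, 257, 49, 5628506797, 267, 3595523275, 79579698, 50984528, 50983106, 83368230, 257, 261,
   229, 267, 3595523275, 51, 5628506959, 49, 5628508255, 79346418, 85574346, 51009512, 51012230,
   301, 257, 233, 305, 261, 267, 3595523275, 265, 3613592269, 87, 3615665545, 53, 5628511495,
   78218898, 72742632, 85585866, 83486346, 72713472, 72831750, 193, 259, 261, 197, 85, 5726417977,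
   185, 5726365489, 89, 5726444221, 257, 49, 5628506797, 265, 3584894455, 53, 5628507121, 267, 87,
   3389389777, 70054098, 79383858, 73763232, 82308444, 73766148, 73882788, 73921848, 123, 231,
   3595050883, 195, 3585484945, 261, 185, 259, 5726365489, 87, 3580236145, 50854946, 183, 257,
   5628505987, 51, 3578991985, 49803548, 219, 51, 3588557923, 257, 5628507445, 49803548, 221, 87,
   3589802083, 259, 5726483587, 50863532, 259, 267, 3432429937, 159, 5728255057, 293, 291, 297,
   295, 303, 3394756675, 87, 3394056835, 181, 6306479623, 217, 6306479641, 51, 3435502915, 257,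
   255, 253, 289, 11, 6391238663, 15, 5434790649, 13, 85, 5628906967, 229, 5531638675, 68651236,
   229, 301, 3594578491, 121, 3593988001, 265, 3594460393, 17, 305, 3388719077, 161, 6295245407,
   66906914, 197, 125, 3586547827, 77455068, 82403820, 64203606, 73760486, 50863478, 57245162,
   57227846, 72597002, 73648220, 73880042, 73881500, 303, 293, 3394756675, 56637374, 57232238, 295,
   303, 3441995875, 57243758, 56764238, 125, 233, 3596113765, 197, 3586547827, 195, 185, 231,
   3595287079, 89, 3580249267, 73889268, 221, 89, 3589815205, 231, 3585839239, 73889268, 231, 257,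
   267, 3595523275, 269, 3395701459, 295, 297, 293, 305, 3443058757, 87, 6501272077, 219,
   6403348423, 51, 6403349395, 89, 3436760197, 303, 3595641373, 261, 259, 255, 15, 5531638677, 53,
   5532228091, 181, 5531638645, 253, 289, 11, 6391238663, 17, 3424740659, 13, 85, 5628906967, 301,
   5434783447, 69912986, 193, 121, 3584422063, 58247844, 83452010, 49758316, 57198488, 57350300,
   57360380, 57360398, 75429888, 82282496, 83448896, 295, 305, 3443058757, 57361820, 56765660, 259,
   269, 3433492819, 73653882, 73882788, 305, 295, 3443058757, 72833190, 72722382, 121, 229,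
   3593988001, 193, 3584422063, 259, 265, 3431367055, 197, 195, 295, 233, 301, 3440932993, 221,
   3586902121, 87, 3596415571, 293, 305, 3596704255, 85839072, 63147704, 83453100, 64317020,
   72719304, 82403340, 49, 301, 183, 3578991823, 291, 3388730113, 56526566, 57127100, 49686926,
   261, 185, 259, 5726365489, 231, 195, 3595287079, 72833028, 73882788, 221, 259, 5726483587, 231,
   195, 3585839239, 72833028, 73882788, 183, 257, 5628505987, 217, 3388725667, 295, 289,
   3578991463, 56417036, 56759828, 219, 181, 3388727107, 257, 5628507445, 295, 289, 3588557401,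
   56405534, 56759828, 181, 11, 3388719017, 255, 5531638645, 233, 195, 193, 89, 3388818961, 15,
   3388719021, 51, 3388720141, 49, 3388719979, 79254564, 51798236, 51917792, 52045934, 291, 217,
   297, 6306479641, 255, 5531638663, 56889410, 257, 11, 253, 5434783373, 229, 195, 297, 265,
   3594460393, 51, 5628506959, 289, 6209624351, 61433006, 56876432, 51917774, 51811178, 255, 253,
   289, 297, 13, 301, 3388719073, 229, 5531638675, 49, 3388727695, 265, 3388719055, 197, 195, 269,
   3587020219, 87, 3585374137, 84697458, 72719466, 82285404, 51, 267, 3389388445, 15, 3388727697,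
   89, 53, 3388811077, 78283374, 79346256, 15, 159, 6209624355, 87, 3389296497, 161, 53,
   6306480037, 78451044, 81626568, 305, 269, 3388729105, 84581934, 85644816, 197, 193, 195, 269,
   3587020219, 49, 3584173015, 265, 3584894455, 87, 3585374137, 84697458, 72716550, 63032514,
   82046292, 231, 197, 229, 51, 3594801835, 89, 3586437019, 269, 3587020219, 85, 3593877193,
   68719218, 63958344, 82158558, 73642380, 229, 195, 197, 49, 5628508255, 265, 3594460393, 51,
   5628506959, 89, 3586437019, 79344978, 52035872, 51917774, 51811178, 197, 297, 195, 193, 269,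
   3587020219, 267, 3585957337, 15, 6306479637, 49, 5628506797, 84802254, 51798236, 51917792,
   56889410, 52030058, 193, 233, 297, 229, 17, 6306479657, 13, 6306479635, 89, 3584855089, 303, 51,
   3388730275, 68653284, 76093458, 63843000, 56872094, 82974876, 62911338, 193, 257, 233, 195, 197,
   49, 5628506797, 265, 3584894455, 269, 3596586157, 87, 3596415571, 84697458, 82278114, 72830274,
   83445972, 56522174, 63146238, 231, 197, 229, 233, 221, 3586902121, 85, 3586954609, 87,
   3586967731, 293, 305, 3596704255, 51, 297, 6403349395, 85602858, 85645140, 56653268, 83332086,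
   64200210, 82282326, 73766148],
  [223, 3421040041, 183, 3388803661, 185, 3389153581, 217, 3388804399, 187, 231, 3411592201, 123,
   3413298061, 221, 3411526591, 255, 257, 3413187253, 219, 181, 3388727107, 73408938, 73527036,
   51927836, 181, 231, 3388805839, 11, 3388719017, 219, 3388727107, 15, 3388719021, 257, 255,
   3389312089, 48740648, 48737750, 221, 231, 3389271679, 159, 3755900359, 51, 3389250781, 253, 255,
   257, 259, 267, 3389250889, 123, 3394055377, 11, 3389312099, 189, 4498520995, 261, 13, 85,
   3389296495, 193, 3389312101, 73413962, 193, 157, 5727493981, 49, 3388804471, 265, 3431668861,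
   121, 3393405109, 17, 125, 3424740659, 233, 3388804415, 83791698, 125, 53, 3394980019, 71815856,
   77179848, 73767930, 49799210, 52987838, 52992194, 52992176, 52992158, 219, 123, 3394447579, 231,
   3388805119, 255, 257, 259, 253, 267, 3388806577, 11, 3389312099, 51, 3389312017, 159,
   3723680017, 189, 4498520995, 261, 13, 85, 3389296495, 193, 3388727119, 73413962, 193, 121,
   3393384697, 157, 5727493981, 49, 3388804471, 265, 3431668861, 17, 233, 3389296571, 125,
   3424740659, 83791698, 125, 53, 3394980019, 71815856, 77179848, 73767930, 49799210, 51927818,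
   73410396, 73408938, 51929294, 299, 295, 3440171917, 289, 3388804435, 267, 257, 3389389777, 255,
   3388806577, 24556964, 303, 291, 3388808035, 293, 3389507875, 197, 161, 3842295607, 125,
   3395530873, 53, 3388804795, 17, 3388808771, 269, 253, 3388804903, 259, 3433794625, 37505444, 11,
   51, 3388720205, 305, 3388804931, 255, 257, 3389312153, 69077012, 53135222, 193, 157, 3670108723,
   49, 3388804471, 159, 123, 15, 51, 189, 4518695341, 297, 6843218275, 225, 5135166901, 253, 255,
   3388727697, 257, 3389296497, 28187222, 259, 261, 5728255057, 46967702, 37743098, 84817296,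
   67968176, 81509622, 84856176, 255, 49, 265, 3388728655, 259, 121, 3425936815, 159, 3723680017,
   77182260, 63052574, 257, 253, 259, 123, 3394055377, 13, 121, 3424740655, 75004494, 75355854,
   78369188, 78370592, 49669898, 85, 265, 257, 3389376655, 24556964, 63147632, 50735678, 231, 253,
   255, 51, 3388797937, 11, 257, 3389312153, 259, 3424741517, 37269284, 257, 123, 3394055377, 259,
   159, 3723680017, 297, 6823043929, 225, 5273361973, 261, 49, 301, 3388808845, 121, 3425936815,
   53, 17, 3388727699, 66330672, 69039492, 17, 233, 3388808789, 125, 3424740659, 89, 3389296499,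
   301, 265, 3388808953, 79344978, 83137236, 301, 157, 5727848275, 125, 269, 3433492819, 84856176,
   77179848, 81956214, 125, 269, 3433492819, 81925268, 82046166, 89, 53, 3388811059, 69039122,
   74834052, 269, 89, 3388819699, 50971568, 82070708, 53, 269, 3388720339, 81952592, 49907534, 269,
   53, 255, 3388728979, 18389444, 49908650, 82305410, 253, 269, 53, 3388720339, 73416722, 82184522,
   73643756, 255, 257, 259, 253, 123, 3394055377, 11, 3389312099, 51, 3389312017, 159, 3723680017,
   189, 4498520995, 15, 3389296497, 261, 13, 229, 3388804411, 85, 3389296495, 75552840, 193, 229,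
   157, 5727493981, 49, 3388804471, 265, 3431668861, 17, 233, 3388804577, 125, 3424740659,
   83021532, 125, 53, 3394980019, 71815856, 77179848, 75552530, 62825796, 75901784, 75900254,
   75533054, 75535952, 75901730, 267, 257, 3389389777, 255, 3388806577, 291, 289, 295, 293, 303,
   3388808035, 51, 3388797955, 11, 3434307437, 159, 3723681475, 123, 3394056835, 15, 3389414595,
   259, 3432320587, 253, 3389430223, 231, 13, 301, 3388719073, 229, 3389430217, 53022938, 229, 193,
   157, 3679320367, 121, 3393523207, 49, 3388805929, 301, 3388806055, 17, 305, 3388719077, 233,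
   3388804577, 48656228, 125, 269, 3395767069, 66738588, 77179848, 48609590, 52918016, 57239330,
   56648840, 56766956, 56417036, 56522174, 303, 291, 3388808035, 293, 3389507875, 253, 231, 257,
   259, 255, 15, 3389296497, 123, 3427181137, 11, 3424741517, 51, 3388797937, 289, 3389312143, 159,
   3723680017, 189, 4498520995, 225, 5273361973, 261, 13, 229, 3389312119, 85, 3389296495,
   50749774, 229, 193, 157, 5727612079, 265, 3431786959, 49, 3388805929, 17, 233, 3388804577, 125,
   3424740659, 83018166, 125, 305, 3395885167, 62487230, 77179848, 67737488, 63843156, 56414156,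
   56648840, 56520734, 56522174, 73407650, 56520680, 197, 125, 3395530873, 53, 3388804795, 11, 233,
   3388804895, 255, 257, 3389312099, 82974876, 52045934, 17, 233, 3388804415, 255, 257, 3389312105,
   82974876, 52045934, 161, 189, 4604788783, 233, 3851507251, 261, 259, 5729619745, 48854408,
   48855884, 193, 49, 3388804471, 301, 265, 289, 3388804597, 259, 3431668861, 56415596, 78402750,
   76199072, 231, 229, 13, 3388804411, 259, 265, 3431786959, 76119710, 77307630, 253, 269,
   3388804903, 13, 265, 3388719055, 295, 289, 121, 3434306593, 81486276, 77224388, 81480128, 295,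
   121, 301, 3440932993, 66829950, 84907068, 84904956, 293, 121, 301, 3393693793, 57109712,
   51811178, 56640236, 49, 265, 255, 3388728655, 57239330, 63154994, 73768100, 231, 255, 289, 11,
   257, 3389312099, 295, 3434307455, 75887330, 51, 253, 3388797937, 291, 3388797955, 56520680, 257,
   123, 3394055377, 15, 295, 3434313867, 253, 3389296497, 49829756, 253, 291, 259, 159, 3723680017,
   189, 4498520995, 225, 5273361973, 261, 293, 295, 297, 157, 193, 3671462197, 49, 5617259785, 17,
   269, 6209624411, 82572674, 68810738, 17, 305, 3388719077, 161, 6295245407, 85, 121, 6396828247,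
   67669782, 85878422, 193, 49, 3388804471, 125, 269, 3433492819, 84856176, 77179848, 82614906, 89,
   53, 3389430277, 69042392, 34992246, 17, 53, 3388729157, 69042040, 82309086, 17, 161, 5434783379,
   72228120, 82397664, 125, 305, 3395806705, 68732798, 82046166, 89, 53, 3388811077, 69039122,
   74834052, 269, 53, 3388720339, 49907212, 82075622, 53, 305, 3388720357, 48774164, 49908650, 17,
   305, 3388719077, 49837082, 76067960, 269, 89, 3388819699, 50970076, 82276664, 125, 295, 305,
   3443058757, 76480718, 75901730, 52030058, 305, 291, 53, 3388730437, 73416722, 73407650,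
   73654052],
  [187, 3413298061, 219, 3394447579, 185, 3394402381, 225, 5135166901, 183, 221, 3389249809, 51,
   3388725901, 231, 3394564219, 259, 257, 3427185511, 223, 189, 4365640333, 50867888, 49803548,
   49802108, 189, 159, 4518695341, 231, 4369891861, 259, 257, 4509601795, 52989278, 52989296, 231,
   221, 3394520479, 223, 3422863999, 197, 89, 3394481113, 161, 3843765271, 53, 3394565353, 193, 49,
   3394565029, 157, 3671578387, 85, 3394454869, 267, 257, 3394638577, 259, 3432429937, 291, 299,
   3394450495, 293, 303, 3394756675, 78337142, 56637374, 305, 297, 6943129183, 34242476, 49944974,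
   70055060, 233, 229, 49, 3394487755, 157, 3681144325, 257, 267, 3394638577, 70055060, 49673948,
   49, 181, 157, 3626821747, 259, 255, 3425937049, 52861118, 52858238, 17, 157, 3626821763, 253,
   261, 5434784045, 50962856, 50962622, 11, 217, 3388719035, 157, 3626821757, 253, 261, 5434784057,
   50962856, 52861100, 13, 85, 217, 3394492807, 157, 291, 301, 3388730113, 299, 3394450495, 253,
   255, 3388727695, 57114104, 57109712, 253, 257, 3389296495, 255, 3388727695, 303, 295,
   3441995875, 25239632, 50889920, 299, 297, 6694414795, 261, 257, 5628514735, 25026422, 46967702,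
   56520680, 255, 253, 3388727695, 52861100, 52856744, 253, 255, 3388727695, 50749772, 49873496,
   257, 255, 267, 3394638577, 265, 3388728655, 70092338, 48609590, 49847288, 257, 259, 267,
   3394638577, 121, 157, 3648667375, 70055060, 59441298, 49686926, 49685450, 121, 265, 259,
   3431367055, 53108852, 63037382, 63155310, 233, 89, 3394599211, 161, 3853331209, 53, 3394448713,
   257, 255, 259, 267, 3394638577, 269, 3394606501, 51, 3425936977, 11, 3425937059, 181,
   3425937049, 159, 3734760817, 253, 15, 3424740657, 13, 193, 3425937061, 85, 3389296495, 69874268,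
   157, 121, 3648667375, 58287048, 62578098, 49758314, 50970128, 50971550, 50971568, 267, 257,
   3394638577, 259, 3432429937, 89, 125, 161, 53, 269, 3394717309, 261, 6059008189, 11, 3799008641,
   181, 3799008631, 17, 289, 293, 3394980037, 305, 3388719077, 35272148, 293, 295, 3820972357,
   37269284, 83247170, 48855884, 49918730, 53097332, 82397508, 50971568, 229, 157, 3681144325, 85,
   3394572967, 49, 3394448389, 193, 53, 11, 161, 3799008641, 259, 255, 3425937059, 69861398,
   49666514, 13, 161, 3799008643, 259, 255, 3425937061, 69861398, 49666514, 161, 181, 3799008631,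
   217, 3799008649, 17, 89, 125, 289, 305, 3388719077, 303, 3394729007, 255, 259, 3809773459,
   50899982, 76482176, 253, 257, 3394980019, 255, 3388811059, 299, 297, 6694414795, 26087702,
   56411366, 301, 305, 3394582849, 259, 255, 3809773459, 15208574, 34222352, 69701324, 255, 257,
   3389312179, 82974876, 52030058, 261, 255, 5531639059, 50983052, 49640288, 261, 255, 5531639059,
   69808910, 69808802, 269, 255, 3388728979, 69861398, 62694738, 261, 161, 125, 259, 5729317939,
   69821906, 78336978, 69860660, 49907264, 261, 161, 269, 6154470739, 82611068, 69874268, 69864368,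
   49, 193, 3394565029, 89, 125, 53, 157, 217, 3626821765, 181, 3626821747, 11, 3626821757, 13,
   121, 161, 17, 85, 297, 295, 6504043087, 303, 6833822923, 265, 255, 3388811071, 75901730,
   75900362, 253, 255, 3798520825, 259, 3424807709, 303, 305, 3637641655, 35665304, 76008326, 303,
   305, 3637641655, 259, 269, 3433492819, 85587206, 34602566, 76005392, 259, 261, 5713339069,
   69864368, 69881684, 261, 259, 5713339069, 48854408, 48855884, 261, 253, 5434783375, 53098754,
   53108870, 257, 253, 3626899705, 51811178, 62911338, 255, 253, 3388811059, 69687878, 48609590,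
   269, 259, 3433492819, 52881404, 82611068, 257, 259, 3427194259, 49926038, 49926020, 255, 265,
   3388728655, 82403340, 52045934, 265, 255, 3388728655, 50983052, 70100600, 269, 161, 259,
   3858645619, 49686926, 82402370, 82284278, 255, 259, 257, 51, 3425936977, 11, 3425937059, 181,
   3425937049, 267, 3432429937, 159, 3734760817, 253, 13, 193, 3425937061, 85, 3389296495,
   73532066, 193, 49, 3427186321, 85, 3394454869, 17, 197, 3425937065, 125, 3424740659, 82404312,
   197, 89, 3394481113, 68771372, 82403820, 63272106, 49804970, 50867888, 50863532, 50867870],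
  [183, 3388725901, 11, 3388720151, 181, 3388720141, 221, 3389250781, 185, 223, 3420974431, 231,
   3389134141, 219, 3389133169, 253, 255, 3389152231, 187, 217, 225, 5130915373, 257, 3413049013,
   15, 3389133021, 189, 259, 4487755555, 13, 121, 3413048953, 85, 3411498919, 60432738, 229, 49,
   3389133979, 49612694, 50792234, 50867870, 50862038, 51929294, 50863478, 231, 217, 3388720159,
   219, 3388727359, 197, 89, 3388817755, 17, 3388720157, 125, 3395511433, 49, 157, 187, 193,
   3667326859, 85, 3637584631, 253, 257, 3413049013, 69865998, 50733878, 223, 159, 3762986239, 85,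
   3637586089, 13, 121, 3422614891, 77181450, 77273610, 291, 301, 3388730113, 297, 6306479713, 303,
   3388730275, 261, 265, 5982283855, 79346112, 77217432, 253, 259, 3626821135, 265, 3388720015,
   303, 301, 13, 3388720207, 70042416, 66083756, 75667380, 303, 305, 289, 3388720195, 257, 259,
   269, 3389412619, 121, 3648667375, 265, 3686458735, 69691056, 35380004, 24882404, 48882218,
   51952766, 85, 13, 229, 3388792969, 257, 253, 3389296495, 52871144, 52869722, 77296650, 77180010,
   13, 85, 193, 3388720153, 253, 257, 3389296495, 49668116, 49670996, 77140644, 70041444, 267, 255,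
   3388728817, 125, 53, 17, 89, 161, 233, 3395628073, 187, 3413048957, 259, 3432180833, 223,
   3422614895, 269, 3388720193, 257, 3389388353, 289, 293, 3394980037, 305, 3388719077, 35272148,
   293, 295, 3820972357, 37269284, 83247170, 53092940, 50970092, 48844328, 49904294, 52030058, 233,
   125, 3395628073, 89, 3388819213, 17, 3388720175, 255, 253, 257, 15, 3388727697, 161, 3853082161,
   223, 3422614951, 269, 3389409703, 259, 225, 5262596533, 159, 3712914577, 261, 13, 85,
   3389296495, 49, 3388727695, 81392166, 157, 229, 5628521539, 82047956, 62578098, 82046166,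
   50967212, 81925116, 50834318, 52030058, 229, 121, 3393502309, 85, 3388792969, 13, 3388720171,
   53, 17, 89, 125, 187, 3413048957, 157, 3680895221, 223, 3422614895, 161, 189, 4487755517, 225,
   5262596495, 289, 305, 3388719077, 303, 3388720195, 255, 259, 3809773459, 50899982, 76482176,
   253, 257, 3394980019, 255, 3388811059, 303, 297, 6812278451, 26087702, 75535952, 303, 293,
   3395120689, 269, 255, 3388819699, 16485782, 83093054, 48589484, 269, 257, 3389402899, 48603776,
   69861624, 255, 257, 3389312179, 82974876, 52030058, 253, 255, 3388727699, 50983052, 51766142,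
   257, 253, 125, 3394980019, 77220816, 48842852, 58410492, 253, 269, 17, 3388719059, 69703044,
   75367374, 69703916, 49, 89, 85, 193, 3388791511, 17, 13, 53, 121, 223, 3422614891, 187,
   3413048953, 125, 157, 189, 4487755513, 225, 5262596491, 161, 291, 305, 3388784849, 303,
   3388730275, 255, 259, 3648655387, 50899982, 76482176, 253, 255, 3798520825, 259, 3424807709,
   301, 303, 3388720207, 75665570, 34573748, 303, 305, 3872213977, 259, 269, 3433492819, 85232912,
   35310992, 51952766, 261, 253, 5434837307, 53098754, 53108870, 269, 255, 3388819699, 52856744,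
   82611068, 255, 257, 3392861471, 82974876, 52030058, 257, 269, 3389402899, 75427962, 62911338,
   257, 255, 3389311855, 49904294, 74728914, 257, 253, 3389296499, 69687878, 74712714, 257, 255,
   3389311855, 70753694, 48841430, 257, 269, 3389402899, 69887868, 69879120, 265, 255, 3388728655,
   50983052, 70100600, 255, 269, 89, 3388819699, 79266952, 83634584, 49681058, 255, 253, 267,
   3388728817, 15, 3388727697, 13, 49, 3388727695, 193, 3388720153, 63035912, 193, 121, 3393403759,
   85, 3388791511, 257, 265, 3389382001, 157, 3671329339, 187, 3413049013, 259, 159, 3712914577,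
   17, 125, 3424740659, 89, 3389296499, 79370736, 125, 53, 3394980019, 71933928, 77415540,
   73646610, 58305516, 73649840, 51927818, 50864954],
  [189, 4518695341, 221, 3755900359, 187, 3753420301, 185, 223, 3420974431, 231, 3765348199, 219,
   3389133169, 261, 259, 5728491253, 225, 183, 15, 5128673361, 217, 3388725667, 257, 5628532231,
   181, 11, 3388719017, 13, 121, 5127477619, 49, 3388724779, 59369856, 265, 229, 6003777691,
   50792234, 58010792, 50862074, 50863532, 73882788, 73766148, 267, 259, 3772552177, 261,
   6068377297, 231, 223, 3762986239, 225, 5293536319, 297, 303, 6843218275, 293, 295, 299,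
   3756136555, 219, 6403374667, 183, 6403373209, 257, 6503568427, 291, 11, 6306479957, 217,
   6306479965, 253, 6306479983, 289, 15, 6209624355, 13, 121, 3434306593, 193, 6306479959,
   62911338, 229, 49, 3765925855, 121, 3766174885, 301, 3766765375, 17, 305, 3388719077, 233,
   6306479981, 48656228, 269, 305, 3778457077, 68850096, 66738588, 50792234, 50888480, 56536610,
   75891912, 50891414, 303, 299, 293, 3756136555, 181, 255, 3388728889, 291, 3388730023, 34567916,
   289, 255, 3388728943, 219, 3388727161, 47074316, 43687418, 56887988, 50894312, 73646592, 231,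
   223, 3762986239, 225, 5293536319, 125, 233, 3768300649, 197, 3758734711, 183, 53, 3751179031,
   257, 261, 5628532231, 49907264, 74728914, 219, 53, 3760744969, 257, 261, 5628533689, 49907264,
   74728914, 181, 11, 3388719017, 17, 3749982551, 261, 255, 5531638969, 48858746, 48855884, 217,
   17, 3759548489, 15, 3388719039, 255, 261, 5531638987, 67979346, 67992080, 305, 303, 3787432525,
   295, 3443058757, 253, 53, 255, 89, 3388811059, 75896934, 75901730, 69049168, 49829756, 255, 269,
   259, 3433492819, 89, 3388819699, 70103652, 85, 193, 3765400687, 229, 3755952847, 265,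
   3388793455, 157, 49, 297, 291, 6306479713, 85221518, 85584398, 82571702, 82611068, 193, 301,
   121, 3756608947, 293, 3757199437, 53, 161, 261, 5531639059, 85335206, 75407064, 60374418,
   85773308, 75421626, 303, 295, 3782118115, 259, 269, 3433492819, 85454708, 38215508, 76482176,
   229, 85, 3755952847, 121, 3766174885, 269, 53, 161, 261, 6154470739, 233, 11, 3388720331, 89,
   3755979091, 13, 3388720333, 79370736, 83479830, 81393612, 78516978, 84815538, 197, 89,
   3765426931, 49, 85, 193, 3765400687, 121, 183, 3751178707, 219, 3760744645, 157, 53, 13,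
   3758485603, 11, 3388720313, 257, 255, 3392992495, 48609590, 74712714, 181, 17, 3388719023, 13,
   3749982547, 257, 259, 3648667375, 77307630, 49847288, 301, 295, 3440932993, 299, 3765754981,
   261, 257, 5628514735, 68725634, 68725508, 253, 257, 3392854255, 259, 3626821135, 305, 293,
   3759325201, 34219472, 71209904, 303, 295, 3782118115, 259, 257, 3648667375, 25978334, 37995170,
   76254548, 257, 259, 3427168015, 69740258, 52861136, 257, 265, 3389376655, 79501938, 79339938,
   261, 265, 157, 5982283855, 79422252, 79464498, 50748368, 265, 157, 261, 5982283855, 68815904,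
   79305612, 79344978, 265, 85, 257, 3389376655, 82397508, 82402530, 82403340, 261, 259, 121, 265,
   3431367055, 193, 3756608947, 63035762, 193, 85, 5728543741, 257, 49, 5628533041, 183,
   5628532231, 265, 3757081339, 255, 11, 5531638979, 13, 5531638981, 181, 5531638969, 253, 17, 197,
   5531638985, 125, 3424740659, 82167792, 89, 197, 3758623903, 82167804, 68771372, 60430874,
   50864954, 60431280, 63036726, 73646592, 50865008],
  [181, 3388727107, 185, 3389133169, 15, 3388727121, 11, 231, 3388727441, 217, 3388719035, 257,
   253, 3389296565, 221, 187, 3411526591, 223, 189, 4365640333, 261, 13, 193, 3388727119, 157, 85,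
   5628514735, 73413962, 50844524, 193, 121, 3393384697, 51738440, 50792036, 49799210, 52992158,
   49802054, 73408938, 197, 17, 3388727123, 125, 3395510461, 229, 49, 3388727197, 85, 3388791997,
   77389764, 193, 121, 3393384697, 13, 3388727119, 85, 53, 3388791673, 78451044, 77414730, 13, 49,
   217, 3388726237, 187, 85, 3411514279, 121, 3411513679, 77414730, 85, 221, 3389193757, 121, 223,
   3416370877, 189, 4363398739, 157, 231, 233, 89, 3388818241, 53, 3388727521, 161, 3846838087,
   289, 305, 3388727647, 301, 3388719073, 265, 259, 3431367055, 49952444, 66906914, 253, 267,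
   3388727467, 257, 3389296495, 259, 3626821135, 303, 295, 3442337857, 37289534, 75535952, 303,
   301, 3393765235, 261, 257, 5628514735, 24889694, 43903472, 50964566, 265, 259, 3431367055,
   48854408, 83713146, 261, 265, 5982283855, 63035762, 50865008, 253, 257, 3389296495, 52869722,
   50844524, 265, 257, 3389376655, 63843000, 77415540, 253, 157, 259, 3626821135, 48692570,
   77390250, 52944044, 257, 253, 85, 3389296495, 77389764, 48679394, 48679430, 85, 257, 265,
   3389376655, 77336340, 77306172, 77273610, 233, 89, 3388818241, 53, 3388727521, 253, 257, 269,
   3388727629, 187, 3411513739, 125, 3395570509, 259, 267, 3432711331, 161, 3846837709, 13, 85,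
   3389296495, 193, 3388727119, 69874268, 157, 121, 3648667375, 78451044, 62578098, 70103652,
   48695468, 52946960, 193, 121, 3393384697, 13, 3388727119, 17, 53, 217, 3388726241, 161, 189,
   4363398323, 225, 4756798081, 89, 187, 3411514603, 221, 3389194081, 223, 3809772001, 125, 229,
   157, 3674651527, 231, 289, 305, 3388719077, 301, 3388727323, 253, 261, 5434783379, 66916464,
   48656228, 253, 257, 3394980019, 255, 3388811059, 259, 3424740659, 291, 293, 3389430277,
   36087170, 25471454, 303, 305, 3395890999, 259, 257, 3820854259, 25942370, 34576646, 51791252,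
   261, 269, 6154470739, 82403672, 50865008, 257, 253, 3394980019, 51811178, 50792234, 257, 261,
   5628540979, 82413888, 82974876, 253, 261, 5434783379, 52947032, 52946960, 253, 269, 3388720339,
   58288020, 50847440, 269, 253, 3388719059, 48682310, 58248654, 257, 89, 269, 3389402899,
   71907540, 71841930, 58410492, 17, 49, 229, 3388727197, 125, 187, 3411513683, 85, 223,
   3416303213, 217, 3388784797, 221, 3389193757, 89, 157, 225, 4756797757, 13, 189, 4363398319,
   121, 161, 231, 295, 297, 6504043087, 299, 3440211497, 257, 265, 3685474585, 62796326, 56872094,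
   253, 259, 3424807709, 257, 3626899705, 289, 299, 3388727161, 56765660, 37289534, 303, 301,
   3393765235, 259, 261, 5713339069, 44047490, 37995170, 49829756, 261, 269, 6134292829, 82403672,
   50865008, 261, 253, 5434837307, 53098754, 53108870, 253, 257, 3626899705, 63843000, 51811178,
   257, 259, 3626826911, 52918016, 50792234, 253, 269, 3388719059, 83676830, 50844524, 259, 253,
   3424740659, 52946960, 70103652, 253, 259, 3424740659, 48692570, 52944044, 265, 253, 3388720015,
   50834318, 83713146, 253, 269, 3388719059, 82574906, 48679394, 85, 257, 265, 3389376655,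
   63665780, 52920752, 82587528],
  [221, 3389249809, 217, 3388725667, 233, 125, 3395627101, 17, 3388725683, 11, 53, 3388720331, 181,
   3388719017, 197, 3388726163, 231, 3388726001, 73416716, 193, 49, 3388725739, 85, 3388790539,
   77153604, 15, 89, 3388818975, 231, 3388725681, 253, 257, 3389296551, 79563156, 52000880, 229,
   121, 3393501337, 13, 3388725679, 85, 53, 3388793131, 78451044, 77414730, 121, 223, 13,
   3420961519, 157, 3648593017, 77296650, 231, 13, 225, 49, 5128673779, 157, 5300860243, 77179848,
   49, 181, 3388724779, 187, 3406804939, 85, 185, 3389075659, 157, 189, 3981956779, 197, 161,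
   3837272149, 89, 3388816783, 289, 295, 3434306593, 303, 3388726027, 253, 259, 3626821135,
   53037896, 49829756, 253, 257, 3389296495, 255, 3388727695, 303, 295, 3442219759, 24556964,
   53014064, 303, 295, 3442219759, 257, 265, 3389376655, 63267170, 26289374, 50964566, 255, 265,
   3388728655, 82403340, 52030058, 253, 255, 3388727695, 52856744, 50844524, 253, 257, 3392854255,
   69879120, 52944044, 255, 85, 257, 3392992495, 48679592, 77389764, 48679574, 257, 85, 259,
   3427168015, 52918016, 77273610, 50792234, 265, 259, 3431367055, 77438850, 77220024, 265, 85,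
   255, 3388793455, 49768700, 77414730, 77415540, 197, 89, 3388816783, 53, 3388726063, 253, 257,
   255, 269, 3388726171, 267, 3388726009, 15, 3389296551, 11, 3389296547, 125, 3395452411, 17,
   3389296553, 223, 3420961579, 259, 13, 85, 3389296495, 49, 3388727695, 68771372, 157, 121,
   3648667375, 78451044, 62578098, 49732286, 52947140, 52947158, 52947122, 11, 181, 3388719017,
   231, 3388726001, 53, 269, 253, 3388720339, 52999448, 81931442, 73416716, 15, 181, 3388719021,
   231, 3388725681, 53, 269, 253, 3388720339, 52999448, 81931442, 73416716, 267, 253, 3388726009,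
   53, 89, 161, 125, 17, 181, 3388811023, 259, 3432654145, 223, 3420962443, 187, 3809770543, 225,
   5128674103, 269, 3395771443, 261, 6075701965, 289, 293, 3394980037, 305, 3388719077, 44995082,
   293, 303, 3389512249, 50888480, 83247170, 51857996, 50834480, 48721838, 52947122, 51871118, 229,
   121, 3393501337, 13, 3388725679, 53, 89, 181, 3388811023, 185, 3389075983, 223, 3420962443, 17,
   125, 225, 5128674103, 187, 3406805263, 161, 189, 3981957103, 193, 295, 301, 3441156281, 289,
   3799008037, 261, 257, 5628540979, 48644438, 74954598, 253, 257, 3394980019, 255, 3388811059,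
   301, 289, 3388725865, 24556964, 48648974, 303, 297, 6850542943, 259, 257, 3820854259, 25975418,
   37743098, 49829756, 269, 257, 3389402899, 74712714, 83452010, 257, 253, 3394980019, 50847440,
   67617392, 255, 257, 3389312179, 82974876, 52030058, 253, 255, 3388811059, 70753694, 67989146,
   269, 253, 3388720339, 67591274, 58326576, 89, 269, 257, 3389402899, 74728914, 58248654,
   58247844, 13, 89, 121, 223, 3420961519, 17, 53, 181, 3388811023, 193, 3393327511, 185,
   3389075983, 187, 3406763515, 85, 125, 225, 5128674103, 49, 157, 189, 3981956779, 161, 295, 297,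
   6504043087, 303, 3442219759, 253, 255, 3798520825, 76008326, 49831376, 253, 255, 3798520825,
   259, 3424807709, 303, 301, 3393763777, 37988060, 75888770, 303, 297, 6850542619, 259, 257,
   3426983711, 25975418, 37743098, 49829756, 265, 257, 3685474585, 72230666, 72227822, 253, 269,
   3392855227, 82611068, 50844524, 259, 257, 3426984031, 48679430, 71826656, 255, 265, 3388811071,
   83713146, 52030058, 259, 269, 3433243711, 75421626, 71839778, 253, 257, 3389296499, 74728914,
   51871118, 259, 253, 3424740655, 71816558, 49732286, 257, 269, 3389402899, 64820184, 64112244,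
   265, 253, 3388719055, 67591274, 71842910, 53, 253, 269, 3388720339, 83624342, 69687878,
   64741770],
  [11, 3388719017, 15, 3388719021, 193, 49, 3388719979, 13, 3388719019, 17, 197, 3388719023, 53,
   85, 3388790393, 221, 3389249663, 89, 233, 3388818961, 185, 3389060303, 223, 3420946763, 125,
   157, 3663889109, 225, 5127477623, 187, 3405608783, 161, 189, 3885101423, 291, 297, 6306480037,
   301, 3388730185, 261, 259, 5729317939, 49713170, 48719318, 255, 269, 3388819699, 259,
   3809773459, 303, 305, 3388822201, 85221464, 82075622, 301, 293, 3395120599, 259, 261,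
   5729317939, 45065516, 34567916, 51868544, 257, 269, 3389402899, 69861624, 49666496, 255, 269,
   3388819699, 84593616, 52045934, 269, 255, 3388728979, 52946978, 79386260, 89, 255, 269,
   3388819699, 78310256, 52933856, 67695684, 269, 89, 255, 3388819699, 233, 3388818961, 67988094,
   70041444, 77260172, 231, 267, 257, 3389396329, 255, 3388728889, 121, 49, 13, 85, 157, 185,
   3392854219, 225, 5127477619, 261, 6074505481, 187, 3405608779, 259, 3432638461, 229, 3388793041,
   223, 3423072523, 189, 3885101419, 291, 301, 3388730113, 295, 3637588033, 44397428, 301, 295,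
   3440932993, 44869676, 34573748, 48718778, 51881180, 67738776, 48679412, 49768538, 197, 17,
   3388719023, 53, 3388720303, 13, 49, 221, 3389249659, 89, 3388816633, 85, 185, 3389060299, 229,
   3388793041, 125, 3395437591, 223, 3423072523, 121, 225, 5127477619, 161, 3836075989, 187,
   3405608779, 157, 189, 3885101419, 233, 291, 301, 3388730113, 299, 3388730023, 259, 265,
   3431367055, 77233308, 68730026, 255, 259, 3425936815, 257, 3392992495, 305, 293, 3389527873,
   35852432, 68013986, 303, 295, 3442204399, 265, 257, 3389376655, 25239632, 64316948, 53037860,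
   255, 261, 5531638735, 83479830, 52045934, 259, 257, 3427168015, 72003056, 81572280, 265, 257,
   3389376655, 62911338, 77415540, 265, 255, 3388728655, 69005390, 60477458, 265, 85, 255,
   3388793455, 48679412, 67928964, 71815856, 85, 265, 255, 3388793455, 67738776, 58364492,
   68978724, 13, 17, 49, 221, 3389249659, 53, 85, 185, 3389060299, 229, 3388793041, 223,
   3423072523, 89, 233, 3388818961, 121, 225, 5127477619, 187, 3405675833, 157, 189, 3885101419,
   125, 161, 295, 291, 3648773485, 303, 3442204399, 265, 257, 3685474585, 50889920, 75674372, 255,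
   253, 3798520825, 261, 5536007227, 265, 3388811071, 289, 297, 6209624353, 63962708, 44830760,
   299, 301, 3388795633, 259, 261, 5713339069, 44397428, 37988060, 71914100, 265, 257, 3685474585,
   72230666, 72227822, 261, 255, 5531638735, 52045934, 82046166, 269, 257, 3392993629, 72003056,
   82611068, 257, 255, 3389311855, 49768538, 62911338, 265, 257, 3389376655, 48695468, 70100600,
   269, 255, 3388728979, 71839742, 75421626, 265, 255, 3388728655, 71829536, 63678578, 255, 269,
   89, 3388819699, 68811056, 82571702, 48679412, 49, 255, 265, 3388728655, 69690740, 71816414,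
   68810738, 89, 269, 255, 3388819699, 67738776, 63757944, 71842734, 49, 265, 157, 259, 3686458735,
   187, 3626821099, 52989296, 62917658, 62917502, 73531898],
  [225, 5130915373, 221, 3411526591, 197, 161, 3839513743, 125, 3414360943, 49, 193, 121,
   3412235179, 157, 3667326859, 89, 3388817593, 79501452, 85, 229, 3411579079, 121, 185,
   3408036139, 89, 3414245113, 157, 17, 3626821115, 189, 4177510219, 53, 3637584793, 13, 289, 303,
   3637584757, 301, 3388719073, 257, 261, 5628514735, 49834202, 49834166, 253, 257, 3389296495,
   255, 3388727695, 303, 297, 6852784213, 26087702, 53014064, 303, 297, 6852784213, 255, 265,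
   3388728655, 63032432, 15675134, 50964566, 257, 265, 3389376655, 72168180, 49847288, 253, 265,
   3388720015, 81587544, 50844524, 257, 255, 3389311855, 49768538, 62911338, 253, 265, 3388720015,
   81642264, 52944044, 265, 157, 261, 5982283855, 193, 3667326859, 49669610, 81508812, 81470742,
   231, 267, 257, 3413770453, 255, 3411599491, 261, 6077943235, 89, 161, 53, 125, 233, 3413731087,
   269, 3413849185, 217, 3809771605, 253, 3809771623, 11, 3799007993, 185, 3408062383, 17, 289,
   293, 3394980037, 305, 3388719077, 85335206, 291, 297, 6306480037, 46849622, 26522654, 48841430,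
   82043214, 49905770, 53094416, 50968652, 233, 89, 3413731087, 253, 255, 257, 261, 269,
   3413738377, 11, 5434783391, 15, 5434783395, 13, 85, 3389296495, 49, 3388727695, 79386260, 157,
   265, 5982283855, 79306898, 62578098, 70100564, 70100528, 52946978, 52946960, 299, 297,
   6680597329, 291, 3413700469, 293, 3411762787, 257, 253, 255, 261, 217, 5531640121, 289,
   5531640157, 11, 5434783391, 15, 5434783395, 13, 85, 3389296495, 193, 5434783393, 161, 17,
   5434783379, 82587528, 82979936, 17, 89, 3389296499, 53, 3388727699, 193, 121, 3412235179,
   58247844, 71842734, 193, 121, 3412235179, 53, 161, 5531639059, 58404660, 58364808, 83483406,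
   125, 53, 3394980019, 50808308, 82046166, 53, 125, 3394980019, 50834498, 71829536, 89, 161, 261,
   5628540979, 46976450, 50847440, 52946960, 269, 161, 261, 6154470739, 45654566, 74729400,
   82046246, 255, 293, 303, 3413888551, 291, 253, 257, 261, 217, 5531640121, 11, 5434783391, 15,
   5434783395, 289, 297, 13, 193, 6209624371, 301, 3388719073, 17, 53, 3388729157, 69045314,
   82663542, 53, 125, 3394980037, 89, 3389430277, 229, 85, 3413704843, 79370736, 82047948, 229,
   301, 3411587827, 125, 269, 3395688625, 78295064, 78427536, 64741770, 269, 125, 3395688625,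
   83491044, 83490242, 89, 125, 3395118259, 83018166, 49758316, 125, 53, 3394980019, 50808308,
   82046166, 53, 89, 3389430277, 71842838, 74728914, 89, 125, 3395119717, 50834318, 57198488, 269,
   89, 3388819699, 75660746, 83139152, 89, 269, 3388819699, 75429888, 49758514, 161, 297, 305,
   6929311717, 68732906, 68727074, 74611302, 269, 253, 53, 3388720339, 82049690, 50863478,
   82049702],
  [185, 3420974431, 189, 4365640333, 229, 121, 3421801117, 157, 3676892797, 85, 193, 3421026919,
   255, 257, 3421690309, 52957202, 49768538, 233, 125, 3423926881, 161, 3849079681, 81521772, 53,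
   89, 197, 3421053163, 125, 221, 3417628321, 161, 217, 3799008001, 11, 3799008011, 225,
   4954476961, 49, 3809772811, 17, 231, 15, 3799008015, 291, 303, 3423441581, 293, 3389430277, 261,
   253, 5434783379, 48765416, 48765488, 253, 257, 3394980019, 255, 3388811059, 301, 305,
   3422470339, 25588094, 49708778, 303, 289, 3809773099, 257, 261, 5628540979, 44604770, 26522654,
   51952766, 261, 255, 5531639059, 52993634, 50865008, 261, 259, 5729317939, 48854408, 48855884,
   269, 253, 3388720339, 50847440, 69861624, 253, 269, 3388720339, 84582258, 50834318, 269, 255,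
   3388728979, 52829042, 68719218, 161, 261, 269, 6154470739, 60374418, 49918766, 60373932, 267,
   255, 3421047331, 157, 121, 49, 85, 225, 4952351197, 221, 3648549277, 11, 3626821127, 217,
   3626821117, 193, 3421026919, 231, 13, 253, 3637586197, 265, 3423388879, 289, 301, 3388719073,
   299, 3421301053, 57109712, 293, 301, 3389494753, 15205658, 64315472, 48621092, 52993634,
   51881342, 52931102, 49768700, 50844704, 193, 85, 3421026919, 255, 259, 257, 253, 261, 265,
   3421034209, 11, 5434783409, 17, 125, 3424740659, 89, 3389296499, 79464498, 233, 89, 3423816073,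
   75148656, 69886742, 50745452, 69877256, 50745416, 69877310, 51881342, 231, 303, 291, 3421048789,
   293, 3423454489, 297, 6862350151, 253, 259, 255, 257, 261, 289, 5531641939, 11, 5434783409, 17,
   53, 3388727699, 233, 5434783415, 13, 121, 3424740655, 64742586, 64741770, 13, 85, 3389296495,
   49, 3388727695, 233, 89, 3423816073, 68771372, 69886742, 197, 269, 3421060453, 49, 85,
   3389311855, 77273618, 75355854, 81949752, 85, 265, 3389376655, 64000130, 74949234, 49, 157,
   3626821135, 72003056, 49669898, 49, 157, 3626821135, 50844704, 69701018, 49, 265, 3388720015,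
   64003028, 71826656, 85, 257, 265, 3389376655, 64000058, 27841658, 52944044, 257, 295, 261, 253,
   15, 5434783413, 11, 5434783409, 255, 289, 299, 5531641615, 259, 291, 293, 297, 89, 53,
   3389430277, 233, 3423816073, 13, 85, 5628906967, 69886906, 64741770, 13, 85, 5628906967, 301,
   5434783447, 269, 17, 6209624411, 79475220, 79475234, 197, 269, 3421060453, 157, 265, 6403363003,
   79306898, 62578098, 70100586, 265, 49, 3389375323, 68806196, 76005500, 85, 13, 5628906967,
   71912718, 75775914, 85, 157, 5628514735, 75671262, 68651098, 85, 49, 5526191287, 71826656,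
   71839778, 265, 157, 5982283855, 69740206, 62826296, 121, 49, 3392854255, 48679574, 49768538,
   157, 85, 5628514735, 52944044, 50844524, 301, 157, 3696024673, 72003092, 76254620, 121, 265,
   3393575695, 63180590, 63180258, 297, 301, 157, 6757124833, 72003056, 49834166, 76007094, 255,
   49, 85, 253, 3388784815, 50863478, 73532066, 73531898, 49807904],
  [11, 3388719035, 229, 49, 3388719997, 13, 3388719037, 85, 193, 3388791277, 221, 3389258557, 255,
   257, 3389311945, 48606692, 48609590, 233, 17, 3388719041, 53, 3388720321, 68978724, 17, 53, 185,
   3389133023, 89, 121, 3393429929, 221, 3389178401, 197, 3388817521, 125, 157, 3673455047, 161,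
   291, 293, 3389430277, 299, 3388730041, 255, 259, 3809773459, 56637374, 56647544, 253, 257,
   3394980019, 255, 3388811059, 301, 305, 3388822057, 24892628, 49708778, 301, 293, 3389500439,
   255, 257, 3395118259, 27844574, 18389444, 51834506, 257, 269, 3389402899, 69861624, 49666496,
   255, 253, 3388811059, 50834318, 52045934, 269, 255, 3388728979, 49640396, 79386260, 269, 253,
   3388719059, 49918694, 78336500, 53, 255, 269, 3388728979, 77260172, 48858746, 68978724, 193, 85,
   3388791277, 259, 255, 253, 185, 3425939659, 257, 267, 3389394889, 265, 3389381767, 17, 125,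
   3424740659, 233, 3388719041, 83713146, 233, 89, 3389312269, 75148656, 69886742, 50745416,
   50745380, 51881342, 69880578, 231, 15, 3388719039, 267, 255, 3388728907, 257, 3389394889, 121,
   13, 49, 157, 85, 261, 6084071419, 221, 3392854237, 225, 4659942397, 265, 3388794517, 259,
   3637587637, 289, 301, 3388719073, 297, 6209624353, 66452468, 293, 295, 3436733953, 37269284,
   45062618, 51881180, 48718940, 48679574, 48609590, 49768538, 233, 17, 3388719041, 53, 3388720321,
   49, 89, 197, 3388817845, 121, 3392855209, 63666096, 185, 13, 3389159263, 157, 3626824357,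
   71933928, 85, 125, 157, 3626821927, 13, 3395555689, 71933928, 121, 221, 3392854237, 13, 189,
   4362202579, 161, 3845641927, 157, 225, 4659942397, 291, 299, 3388730041, 301, 3388730113, 259,
   265, 3431367055, 77233308, 68730026, 253, 257, 3389296495, 255, 3388727695, 299, 295,
   3637588771, 25239632, 56522174, 299, 295, 3637588771, 259, 255, 3425936815, 18509000, 37407596,
   69785402, 253, 259, 3424740655, 81572280, 50844524, 257, 157, 259, 3648667375, 52918016,
   71933928, 49847288, 265, 255, 3388728655, 70943072, 77415540, 259, 157, 253, 3626821135,
   52944044, 71960018, 71839778, 265, 259, 121, 3431367055, 75004494, 71826656, 71815856, 53, 157,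
   125, 221, 3394980001, 13, 225, 4659942397, 49, 185, 3389159263, 17, 189, 4362202583, 85, 89,
   197, 3388817845, 121, 161, 291, 297, 6312973645, 299, 3388730041, 269, 255, 3388819699,
   56889410, 83490242, 253, 255, 3798520825, 259, 3424807709, 301, 303, 3388795975, 75665570,
   34573748, 299, 295, 3637588771, 259, 269, 3433492819, 83133392, 37407596, 69785402, 265, 257,
   3685474585, 72230666, 72227822, 257, 255, 3636978265, 70943072, 62911338, 255, 265, 3684217465,
   70113560, 50983052, 259, 261, 5726943071, 69864368, 71839778, 259, 253, 3626821135, 67989146,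
   49732286, 259, 255, 3425937139, 48679574, 71826656, 259, 255, 3425937139, 48609590, 52918016,
   265, 259, 3686458735, 83094432, 83713146, 253, 269, 3388720339, 83676830, 50844524, 121, 259,
   265, 3431367055, 69058266, 49926038, 64742586, 13, 49, 255, 253, 3388727695, 50863478, 49807904,
   69700890, 73767930],
  [53, 11, 3388720313, 221, 3389250943, 15, 3388720317, 185, 89, 3389166703, 233, 3389134303, 253,
   255, 3389165353, 50984510, 52947122, 193, 13, 3388720315, 85, 3388791673, 121, 233, 3393385831,
   161, 3842702389, 229, 3393502471, 69743376, 49, 17, 3388719995, 89, 3388817593, 71841930, 231,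
   157, 125, 3672641269, 269, 89, 255, 3388728979, 233, 3669885649, 52045934, 79372644, 84593616,
   225, 125, 5308416667, 269, 161, 255, 3388728979, 233, 5379629761, 52045934, 81508812, 84593616,
   229, 189, 161, 4604788783, 269, 89, 125, 257, 3389402899, 233, 4457048185, 48603776, 81508812,
   72192012, 69861624, 253, 269, 3388720339, 161, 89, 125, 17, 259, 3799008019, 265, 3388817701,
   257, 3394980019, 261, 5434783379, 289, 293, 3394980037, 305, 3388719077, 85335206, 299, 293,
   3389487139, 45062618, 60218222, 77260172, 84593616, 79386260, 69861624, 301, 293, 3389500261,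
   303, 17, 291, 3388730201, 255, 259, 267, 3388728905, 269, 3388728979, 125, 3425937139, 84802254,
   35418884, 18389444, 125, 269, 297, 6858098623, 259, 3433492819, 35423258, 77260172, 77179848,
   48765416, 295, 289, 161, 3799008037, 305, 3388720357, 69743700, 50792522, 48648776, 257, 253,
   267, 3389395285, 125, 3394980019, 269, 3388720339, 84802254, 51811178, 50792234, 255, 259, 269,
   3388728979, 125, 3425937139, 84593616, 52989296, 49612694, 231, 13, 189, 157, 4573848955, 253,
   259, 4573848997, 48718814, 50844524, 229, 121, 3393528715, 89, 3388817533, 233, 3388720333,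
   70113552, 157, 49, 85, 121, 225, 125, 5308416667, 233, 5348689933, 255, 265, 3388728655,
   83713146, 52045934, 293, 299, 3389487139, 297, 6403355713, 255, 257, 3392992495, 56872094,
   56889410, 253, 257, 3389296495, 255, 3388727695, 303, 301, 3393764911, 28427792, 48765596, 299,
   301, 3393738667, 265, 255, 3388728655, 15231578, 66207632, 56640236, 257, 253, 3389296495,
   51811178, 62911338, 261, 253, 5434783375, 52944044, 48692588, 253, 261, 5434783375, 52930994,
   50805320, 253, 255, 269, 3388720339, 265, 3388719055, 89, 3388811059, 79501460, 52856744,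
   50844524, 255, 253, 269, 3388728979, 89, 3388811059, 265, 49, 3388728655, 79489292, 79306898,
   50792036, 48609590, 121, 265, 259, 3431367055, 52989296, 63035762, 63153690, 125, 185,
   3395465263, 225, 5136229783, 189, 161, 4604788783, 233, 4370954743, 259, 257, 4595695237,
   53105918, 49917290, 193, 85, 3395517751, 157, 3672641269, 89, 161, 269, 121, 3393418231, 221,
   3841993801, 259, 3433492819, 261, 6154470739, 257, 3389402899, 229, 13, 3388817533, 17, 289,
   305, 3388719077, 303, 3388817881, 60465302, 293, 295, 3820972357, 37269284, 45062618, 71933928,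
   63962556, 78479060, 69031212, 71960172, 233, 221, 3395583361, 231, 229, 85, 3395635849, 49,
   3395537515, 259, 269, 3433492819, 78336500, 50731016, 121, 49, 85, 157, 15, 3626821941, 13, 291,
   301, 3388730113, 305, 3637653643, 259, 261, 5727192175, 49952300, 49952444, 253, 257,
   3389296495, 255, 3388727695, 305, 295, 3443058757, 25239632, 49944974, 303, 297, 6858098623,
   261, 257, 5628514735, 25026422, 46967702, 51952766, 257, 259, 3648667375, 52918016, 50792234,
   253, 255, 3388784815, 52856744, 50844524, 253, 257, 3392854255, 69879120, 52944044, 255, 257,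
   89, 3395118259, 265, 3393575695, 59440820, 49685450, 49681058, 257, 255, 269, 3395701459, 49,
   85, 3389311855, 60374418, 71907702, 49768538, 62911338, 49, 255, 265, 3388728655, 63035762,
   52993634, 69700890, 261, 157, 265, 5982283855, 63155318, 62919116, 50808308, 161, 221,
   3841993801, 189, 4604788783, 185, 233, 3851441641, 259, 261, 5729554135, 49918766, 83094432, 85,
   229, 3842046289, 121, 193, 3842702389, 49, 157, 231, 233, 291, 301, 3388730113, 305, 3865969963,
   259, 261, 5727192175, 49952300, 49952444, 253, 257, 3392854255, 259, 3626821135, 303, 293,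
   3853921699, 35852432, 50889920, 303, 301, 3844408249, 259, 261, 5727192175, 44394494, 35308076,
   51952766, 253, 255, 3388784815, 52045934, 51871118, 261, 255, 5531638735, 49807904, 50865008,
   253, 255, 3388784815, 52856744, 50844524, 255, 257, 3392992495, 78382176, 49681058, 257, 265,
   3389376655, 78478422, 63843000, 121, 265, 193, 3842702389, 259, 3431367055, 50731016, 78453618,
   78477612, 89, 185, 3389166703, 193, 49, 3388817593, 121, 3393418231, 59466732, 49, 15, 231,
   3388817535, 121, 3392855205, 63154014, 13, 229, 3388817533, 11, 231, 3388817855, 121,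
   3392855201, 78244980, 121, 157, 189, 4584610873, 85, 233, 221, 3389284801, 225, 5359451851, 289,
   305, 3388821007, 301, 3388719073, 265, 259, 3431367055, 49952444, 66906914, 253, 257,
   3389296495, 255, 3388727695, 305, 297, 6909133807, 26087702, 53132324, 305, 301, 3393772525,
   255, 257, 3392992495, 24653498, 15205658, 48682796, 253, 265, 3388719055, 83713146, 51871118,
   261, 253, 5434783375, 52944044, 48692588, 253, 255, 3388727695, 52856744, 50844524, 265, 253,
   3388719055, 51811178, 81614580, 265, 253, 3388720015, 50792036, 78427374, 265, 121, 259,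
   3431367055, 53049074, 59466732, 81470742, 49, 231, 233, 255, 265, 3388728655, 85, 121, 157, 257,
   3389311855, 259, 3425936815, 261, 5531638735, 289, 301, 3388720033, 291, 3388784833, 66083756,
   297, 293, 6403355713, 34210724, 46848200, 81587544, 72192984, 60529460, 299, 303, 305, 11, 291,
   3388730519, 229, 3388720007, 301, 3388720043, 157, 253, 259, 3626821135, 34101356, 18861836,
   50844704, 157, 185, 225, 5302056223, 289, 3389173309, 297, 6950805553, 259, 253, 3626821135,
   15320840, 35653640, 225, 293, 5416847479, 295, 5159613187, 253, 259, 3626821135, 37504004,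
   16406564, 221, 193, 3672995563, 297, 6947397559, 289, 3389289949, 121, 257, 259, 3648667375,
   35653640, 24558422, 49768538, 301, 291, 3388730113, 295, 3696024673, 297, 6757124833, 253, 259,
   3626821135, 34334636, 18493124, 289, 295, 3626821153, 265, 13, 261, 5982283855, 297, 6209624353,
   47188040, 48648956, 66335792, 265, 85, 261, 5982283855, 297, 293, 6403355713, 44983382,
   46849622, 50770346, 65968538, 193, 85, 265, 295, 3440158795, 289, 3388791637, 185, 3389140459,
   257, 3389376655, 24556964, 81587544, 78242892, 52856744, 291, 295, 301, 3388730113, 121,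
   3435502753, 71843226, 52073636, 51910826, 289, 295, 301, 3388720033, 157, 3626821153, 78219062,
   51955700, 53014046, 295, 289, 301, 3388720033, 157, 3626821153, 81600504, 56404058, 56753978,
   253, 259, 265, 3388720015, 157, 3626821135, 81587544, 83094432, 51871118, 255, 259, 265,
   3388728655, 121, 3425936815, 72192984, 52989296, 50951138, 265, 157, 121, 85, 261, 5982283855,
   259, 3686458735, 257, 3393575695, 255, 3388793455, 233, 231, 193, 229, 225, 5392384345, 17,
   3388791293, 15, 3388791777, 11, 3388791773, 13, 289, 299, 3388792771, 301, 3388719073, 78411696,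
   293, 305, 3673231759, 48880616, 45062618, 70041444, 68817696, 53049074, 52989296, 83094432,
   79386252, 72192012, 79305612, 79344978],
  [231, 303, 295, 225, 5331800071, 189, 4556959093, 221, 3442350169, 185, 3442232071, 267, 261,
   6106641049, 257, 3442468267, 53, 161, 289, 3799008037, 305, 3868211557, 44758868, 53092994,
   49907264, 257, 253, 255, 259, 261, 15, 5434783449, 11, 299, 5434783445, 291, 3388730375, 53, 17,
   3388727699, 67975134, 49907212, 265, 121, 3431367055, 229, 3442409947, 53, 17, 3388727699,
   67973370, 64323168, 17, 305, 5434783451, 125, 3424740659, 89, 3389296499, 301, 49, 3440683945,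
   79344978, 85841952, 229, 85, 3442402657, 89, 269, 3388819699, 84713292, 60477458, 67979210, 125,
   53, 3394980019, 49907264, 82046166, 89, 53, 3388811059, 69039122, 70103652, 125, 53, 3394980019,
   69042002, 52030058, 89, 161, 269, 3389402899, 291, 3809774917, 305, 3868211557, 85232912,
   53098754, 52946960, 89, 161, 291, 3809774917, 305, 3868211557, 255, 259, 3809773459, 35064788,
   25588094, 72230666, 50971568, 299, 291, 221, 3389280427, 11, 3388730375, 185, 3389136085, 15,
   3388730037, 253, 267, 3388730383, 189, 259, 4382530237, 53, 125, 4382530939, 71163428, 69039122,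
   225, 259, 5157371215, 53, 125, 5157371917, 71163428, 69039122, 257, 255, 259, 261, 13, 193,
   3388730035, 85, 3389296495, 161, 17, 5434783379, 82587528, 69874268, 17, 233, 3388730057, 125,
   3424740659, 89, 3389296499, 301, 85, 3388794913, 79370736, 83373234, 301, 121, 3393680941, 53,
   161, 3799008019, 58404660, 58364808, 82162944, 125, 53, 3394980019, 49907264, 82046166, 89, 53,
   3388811059, 69039122, 70103652, 125, 53, 3394980019, 69042002, 52030058, 17, 89, 269,
   3388719059, 305, 3388821157, 85457642, 50971568, 67974764, 89, 305, 3388821157, 269, 255,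
   3388819699, 15935792, 85467650, 52946960, 253, 255, 259, 53, 89, 3388811059, 125, 3425937139,
   17, 3388727699, 161, 3799008019, 13, 49, 3388727695, 265, 3388719055, 79344978, 85, 265,
   3388793455, 72168180, 77273610, 193, 229, 301, 11, 85, 3424741337, 121, 3425936915, 161, 89,
   3809773459, 71829132, 60373932, 15, 85, 3424741359, 265, 3388728795, 89, 269, 3388819699,
   69900018, 69005778, 157, 265, 3686458735, 85, 3637586575, 89, 269, 3388819699, 69900018,
   69005778, 13, 49, 3388727695, 125, 17, 3424740659, 78362406, 78362088, 17, 125, 3424740659,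
   78242568, 71933928, 121, 265, 3431367055, 66094646, 69038034, 157, 85, 3637586575, 64205104,
   69036254, 85, 265, 3388793455, 63679226, 69044336, 89, 53, 3388811059, 69040770, 70103652, 53,
   269, 3388720339, 81926672, 49904294, 161, 125, 269, 259, 3433492819, 261, 6154470739, 233, 189,
   4543141627, 43806920, 37410512, 82303952, 50834318, 50847440, 89, 53, 255, 253, 3388811059,
   56768378, 56753978, 49905790, 70103814, 259, 289, 255, 253, 291, 295, 53, 161, 3799008037, 89,
   3388811077, 17, 3388729157, 125, 3425937139, 13, 301, 3388719073, 121, 3434306593, 81407706, 85,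
   301, 3388794913, 79268814, 77273610, 193, 229, 11, 85, 3424741337, 121, 3425936915, 161, 89,
   3809773459, 71829132, 60373932, 15, 121, 3435502839, 85, 3424741359, 161, 89, 3809773459,
   71829132, 60373932, 121, 301, 3440932993, 265, 3431367055, 269, 125, 3433492819, 78532350,
   78245312, 13, 301, 3388719073, 17, 305, 3388719077, 67578576, 66750576, 125, 161, 3819195505,
   58287048, 78451044, 301, 157, 3696024673, 69036254, 78532120, 85, 265, 3388793455, 63679226,
   69044336, 89, 53, 3388811077, 75896774, 75896934, 89, 161, 3809773459, 75661062, 82278148, 89,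
   161, 3809773459, 50847440, 52946960, 53, 295, 161, 3799008037, 49784576, 51955700, 49904294,
   161, 89, 255, 3809773459, 53014046, 70100494, 72229174, 305, 289, 53, 3388720357, 69040770,
   50888480, 50899982, 125, 269, 259, 3433492819, 52989296, 82049702, 82285890],
  [221, 3389249809, 217, 3388725667, 197, 89, 3388816783, 53, 3388726063, 11, 181, 3388719017, 233,
   3388726163, 87, 51, 3388797911, 68654152, 69703912, 17, 181, 3388719023, 233, 3388725683, 87,
   51, 3388797917, 68654152, 69703912, 125, 185, 3395465263, 233, 3395627101, 51, 87, 3395453113,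
   83217548, 83217384, 193, 49, 3388725739, 85, 3388790539, 231, 123, 3394564219, 15, 3388725681,
   67928964, 51, 181, 15, 3388724781, 87, 3388797901, 77389764, 13, 229, 3388725679, 87,
   3388797913, 70055290, 15, 123, 157, 3665085427, 225, 5128673941, 161, 3837272311, 223,
   3420961521, 187, 3406805101, 87, 185, 3394052461, 121, 3393327349, 159, 189, 3981956941, 289,
   297, 6209624355, 301, 3388725865, 259, 261, 5728255057, 48798050, 49713170, 253, 257,
   3389296497, 267, 3388719057, 299, 295, 3440093397, 73799312, 56417036, 301, 295, 3441157039,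
   267, 257, 3389389777, 26053178, 73882868, 53036384, 257, 253, 3389296497, 48602120, 62543922,
   267, 253, 3388719057, 53063762, 69860660, 267, 253, 3388719057, 49888076, 79370736, 123, 257,
   253, 3393917137, 50911754, 50911790, 67708644, 267, 123, 257, 3394638577, 78500274, 68771364,
   68771372, 13, 229, 3388725679, 51, 87, 223, 3420962281, 181, 3388797901, 185, 3389075821, 49,
   157, 189, 3981956779, 225, 5128673359, 121, 187, 3648419029, 15, 231, 3388725681, 123, 85, 293,
   297, 6391313007, 299, 3389486005, 257, 265, 3394056187, 62796326, 56872094, 253, 259,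
   3424820827, 267, 3388806427, 305, 289, 3388726189, 73447952, 85351416, 305, 303, 3394839781,
   257, 261, 5628513309, 44993570, 28550246, 49946396, 259, 257, 3426983709, 50749790, 79433394,
   265, 253, 3393548025, 51917774, 72719304, 261, 259, 5727192175, 48729182, 48726284, 253, 259,
   3626821135, 77215632, 51809720, 267, 257, 3389389777, 52869722, 72600728, 267, 257, 3389389777,
   78382176, 73009778, 253, 265, 3388719055, 63575222, 50857808, 253, 265, 3388719055, 63561938,
   49794926, 51, 267, 159, 189, 3981956941, 261, 6068377297, 77309088, 78244812, 72996980,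
   63562248, 193, 49, 3388725739, 85, 3388790539, 11, 181, 3388719017, 229, 3388725839, 53, 89,
   3388811033, 79266934, 78217174, 13, 181, 3388719019, 229, 3388725679, 53, 89, 3388811035,
   79266934, 78217174, 15, 231, 3388725681, 89, 87, 17, 233, 3388725683, 53, 181, 3388811023, 121,
   3393327511, 185, 3389075983, 223, 3420962443, 51, 123, 157, 3665085427, 225, 5128673941, 187,
   3406763517, 125, 159, 189, 3987388153, 161, 303, 289, 3388807889, 301, 3394813537, 257, 261,
   5624109631, 50770238, 48644438, 253, 255, 3723736987, 257, 3394980019, 259, 3808521469, 291,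
   293, 3389430277, 35152592, 25009268, 301, 295, 3441157039, 257, 267, 3394980033, 75897500,
   25383632, 49717652, 257, 261, 5624109631, 50729576, 49666496, 257, 253, 3394980019, 48602120,
   62543922, 257, 259, 3427181137, 83358996, 82974876, 269, 253, 3388720339, 49652042, 74383224,
   253, 269, 3388720339, 59364024, 49797842, 257, 267, 3389389777, 73243058, 50690174, 257, 267,
   3389389777, 73230260, 48851636, 257, 269, 3389402899, 82704182, 49638956, 267, 253, 3388719057,
   50977364, 73256180, 269, 125, 233, 3395627101, 265, 3395758321, 257, 3395701459, 58300934,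
   82678092, 82677938, 229, 121, 3393501337, 13, 3388725679, 15, 231, 3388725681, 253, 267,
   3388719057, 233, 17, 3388725683, 58417782, 63745314, 51804050, 53, 161, 269, 189, 3981957103,
   261, 6154470739, 58295310, 58301142, 58300656, 58300170, 231, 123, 3394564219, 15, 3388725681,
   253, 257, 223, 3420961579, 259, 225, 5128673401, 267, 3432827971, 261, 13, 85, 3389296495, 269,
   17, 3388719059, 67981452, 75421626, 125, 161, 5729317939, 67748496, 82562262, 73070682,
   73069224, 73067766, 51920690, 49, 89, 51, 85, 185, 3389075659, 223, 3420962119, 11, 3388784789,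
   181, 3388784779, 13, 87, 121, 225, 5128673779, 187, 3406804939, 15, 125, 233, 3395627101, 157,
   189, 3981956779, 123, 17, 159, 53, 161, 289, 303, 3388807889, 295, 3434399889, 299, 3388725703,
   261, 253, 5442472669, 56778584, 57229340, 257, 259, 3426983711, 265, 3394056187, 299, 293,
   3389486005, 63052574, 56415596, 299, 295, 3440093397, 259, 267, 3626821149, 73799312, 37289534,
   56411366, 261, 253, 5434837307, 53098754, 53108870, 259, 261, 5713243069, 49907264, 49927496,
   261, 253, 5434837307, 52986488, 52996604, 259, 257, 3426983709, 48841430, 48854408, 261, 265,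
   5982283855, 72719304, 74356638, 267, 257, 3389389777, 52866968, 72600728, 259, 265, 3431367055,
   82757634, 82753260, 259, 257, 3427168015, 48732080, 48726266, 257, 253, 3389296495, 51809720,
   63843000, 253, 265, 3388719055, 63035924, 50857808, 267, 253, 3388720177, 48608114, 73649840,
   269, 257, 3389402899, 50741204, 82756832, 269, 257, 3389402899, 49794962, 82640030, 265, 253,
   3388720015, 50977364, 64677632, 269, 257, 125, 3395701459, 82756662, 49678322, 82756670],
  [181, 3388727107, 185, 3389133169, 233, 89, 3388818241, 53, 3388727521, 125, 223, 3423926881,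
   221, 3395583361, 197, 3395510461, 259, 257, 3427200091, 231, 51, 3388727359, 50924750, 49914518,
   50970128, 231, 51, 3388727359, 87, 3388805119, 253, 257, 255, 267, 3388727467, 269, 3388727629,
   17, 3389296571, 11, 3389296565, 187, 3411513739, 259, 159, 3760744267, 13, 85, 3389296495, 49,
   3388727695, 68771372, 157, 121, 3648667375, 78451044, 62578098, 50924768, 51987614, 50924750,
   51987596, 11, 197, 3388727603, 217, 3388719035, 267, 253, 123, 3394610975, 73416714, 52040246,
   73416722, 17, 197, 3388727123, 217, 3388719041, 267, 253, 15, 3388719057, 81931272, 52040246,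
   73416722, 269, 257, 3389408731, 123, 15, 87, 51, 267, 3394723141, 259, 3433834203, 187,
   3411513681, 221, 3394053919, 261, 6171361183, 223, 3416371039, 161, 3846838249, 159, 225,
   4756797919, 289, 305, 3388727647, 297, 6209624355, 53138156, 293, 295, 3734878915, 73799312,
   45062618, 52990754, 48798986, 48812108, 49848746, 48825230, 193, 121, 3393384697, 13,
   3388727119, 15, 51, 217, 3388726239, 87, 187, 3411514441, 221, 3389193919, 123, 223, 3416371039,
   161, 3846838249, 189, 4363398901, 159, 225, 4756797919, 229, 289, 305, 3388727647, 297,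
   6209624355, 257, 259, 3427181137, 85587612, 53138156, 253, 255, 3388727697, 257, 3389296497,
   299, 297, 6687921835, 26087702, 77224136, 301, 295, 3441274377, 267, 257, 3389389777, 26053178,
   73882868, 53036384, 257, 253, 3389296497, 51811178, 64113702, 255, 259, 3425936977, 84411978,
   78244736, 253, 255, 3388727697, 80625650, 80612672, 255, 253, 3388727697, 52000880, 48812090,
   87, 255, 267, 3388806577, 78516654, 48798968, 78451044, 51, 253, 267, 3388720177, 58326576,
   80317994, 58247844, 13, 51, 49, 229, 3388727197, 217, 3388726237, 87, 187, 3411514441, 221,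
   3389193919, 123, 223, 3416371039, 161, 3846838249, 189, 4363398901, 15, 121, 157, 225,
   4752413131, 85, 159, 289, 305, 3388727647, 303, 3392855083, 259, 261, 5713243069, 85927154,
   53142386, 255, 265, 3684217303, 259, 3713517949, 305, 293, 3389526829, 63052574, 85101962, 305,
   297, 6946201999, 261, 257, 5628513309, 26087702, 46849622, 48880616, 255, 261, 5527254109,
   77182070, 78244736, 261, 259, 5726943069, 79433394, 78217088, 267, 257, 3389389777, 52866968,
   72600728, 257, 253, 3389296497, 51811178, 64113702, 253, 257, 3393917137, 77421146, 77438444,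
   253, 255, 3388727695, 80625650, 80612672, 253, 255, 3388727695, 48812090, 50857808, 267, 255,
   3388728817, 80329676, 73009778, 265, 253, 3388719055, 51987596, 84752658, 51, 255, 267,
   3388728817, 84869142, 51973034, 63562248, 231, 51, 3388727359, 87, 3388805119, 11, 217,
   3388719035, 53, 89, 3388811051, 68654152, 69703912, 15, 217, 3388719039, 53, 89, 3388811055,
   68654152, 69703912, 123, 221, 3394520479, 161, 89, 3809824489, 72603308, 83217554, 187, 221,
   3411526591, 89, 53, 3411514603, 83217548, 72603312, 159, 223, 3762986239, 125, 53, 3760744969,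
   72721248, 83335326, 189, 223, 4365640333, 125, 53, 4363399063, 72721248, 83335326, 217, 221,
   223, 225, 85, 193, 3421026919, 229, 3389258557, 125, 17, 3415174721, 73075380, 83689944, 17,
   197, 3388727123, 89, 3389178401, 229, 259, 265, 5236140691, 60542582, 70103652, 73308986, 229,
   121, 3421801117, 125, 89, 3395116801, 60476964, 77414730, 83650896, 89, 17, 3389178401,
   72839184, 72839508, 125, 89, 3395116801, 72721406, 83335326, 17, 53, 3388726241, 83217548,
   83217384, 17, 269, 197, 3388727123, 253, 3388719059, 49797842, 82981688, 72366792, 197, 17,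
   3388727123, 125, 3395510461, 255, 253, 257, 11, 3389296565, 187, 3411513739, 259, 269,
   3433774213, 13, 49, 3388727695, 193, 3388727119, 83806430, 193, 121, 3393384697, 123, 159,
   3734760817, 83791698, 74383224, 83806260, 48864614, 83801562, 52053206, 52053224, 229, 49,
   3388727197, 85, 3388791997, 51, 11, 193, 3388727279, 87, 3388797929, 63744500, 13, 193,
   3388727119, 87, 3388797931, 63744500, 89, 15, 217, 3388726239, 53, 121, 3393445609, 187,
   3411514603, 221, 3389194081, 123, 223, 3416329455, 157, 3674651365, 189, 4363398901, 159, 225,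
   4756797919, 17, 161, 87, 125, 297, 295, 6488084211, 299, 6687921835, 253, 257, 3394980019,
   56765660, 56778584, 253, 255, 3723736987, 257, 3394980019, 301, 293, 3389500585, 28187222,
   49713134, 299, 295, 3440211497, 259, 257, 3427181137, 25975418, 37743098, 56876432, 255, 257,
   3394055377, 82974876, 52045934, 261, 125, 259, 5729317939, 60419616, 82285890, 50865008, 257,
   261, 5628526433, 50729576, 49666496, 87, 259, 257, 3427181137, 58410492, 48854408, 82704168,
   257, 253, 3393917137, 48602120, 62543922, 269, 253, 3388720339, 49652042, 74383224, 267, 253,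
   3388719057, 50689976, 73416722, 257, 269, 3389402899, 82677938, 48747956, 255, 267, 3388728817,
   74319224, 50990342, 125, 257, 269, 3395701459, 82691222, 50688554, 83754096, 51, 121, 193,
   3393384697, 89, 49, 223, 3416370877, 189, 4363398739, 87, 187, 3411514441, 217, 3388797919, 11,
   3388797929, 221, 3389193919, 125, 53, 157, 225, 4756797757, 13, 15, 17, 123, 161, 85, 159, 297,
   295, 6488084211, 299, 6687921835, 253, 257, 3636248343, 56765660, 56778584, 253, 259,
   3424820827, 267, 3388806427, 299, 295, 3440211497, 73307012, 56887988, 299, 295, 3440211497,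
   259, 257, 3426983711, 25975418, 37743098, 56876432, 255, 261, 5536007227, 52996604, 52993634,
   159, 257, 261, 5624109631, 50748368, 50749790, 73413962, 261, 253, 5440346909, 53098754,
   53108870, 261, 265, 5982283855, 72719304, 74356638, 259, 257, 3426984031, 48841430, 48854408,
   269, 261, 6134292829, 48726284, 82403672, 261, 269, 6134292829, 82284116, 48629894, 267, 257,
   3389389777, 52866968, 72600728, 259, 257, 3427194259, 49926020, 49927496, 255, 257, 3389312017,
   82974876, 52045934, 255, 269, 3388819699, 82640192, 50873702, 255, 269, 3388819699, 83806430,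
   49691264, 257, 265, 3393575695, 64677632, 50990360, 253, 267, 3388720177, 64795074, 51818468,
   265, 121, 257, 3393575695, 49810838, 64794102, 64794110],
  [185, 3420974431, 189, 4365640333, 233, 125, 3423926881, 161, 3849079681, 89, 221, 3389284801,
   197, 3421053163, 257, 255, 3423816073, 52032974, 53094416, 231, 159, 3762986239, 255, 261, 257,
   269, 6173602615, 51, 5531641813, 267, 6087509173, 181, 5531641561, 53, 5531641975, 87,
   3422753191, 253, 11, 5434783409, 17, 5434783415, 13, 85, 3389296495, 229, 5434783411, 69005548,
   157, 85, 5628514735, 77273610, 62578098, 81393998, 50964116, 81678714, 52026980, 197, 269, 255,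
   3421060453, 261, 6173602615, 257, 3424399273, 123, 87, 159, 51, 267, 3424464883, 221,
   3417615199, 181, 3723679279, 225, 4953414079, 253, 3723679801, 17, 3712914575, 11, 3712914569,
   15, 289, 297, 6209624355, 305, 3424489701, 53138156, 305, 291, 3421061911, 73643756, 48880616,
   77427186, 49800668, 52026980, 52000898, 50951138, 305, 291, 3421061911, 297, 6948443593, 293,
   3424517371, 257, 255, 261, 289, 5531642101, 181, 5531641561, 53, 5531641975, 253, 11,
   5434783409, 13, 85, 3389296495, 229, 5434783411, 51, 159, 5531638897, 79451870, 78505304, 15,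
   51, 3388727697, 87, 3389296497, 229, 121, 3421801117, 78451044, 64625454, 229, 85, 5628750931,
   123, 51, 3393917137, 79372644, 67708644, 72383814, 159, 51, 5531638897, 51987596, 52980980, 123,
   87, 3394055377, 50850914, 73569318, 261, 159, 87, 5628527857, 81407300, 52978082, 47080148, 267,
   51, 255, 3388728817, 28184468, 49787996, 73568948, 255, 291, 299, 3424211191, 257, 261, 181,
   5531641561, 53, 5531641975, 289, 11, 297, 6209624387, 253, 5434783409, 52075076, 17, 297,
   6209624393, 253, 5434783415, 52075076, 253, 293, 297, 85, 229, 5628750931, 157, 6403355713, 51,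
   87, 3389430115, 81577296, 81577140, 15, 159, 6209624355, 51, 3388727697, 193, 265, 3424222855,
   60529460, 79438740, 193, 265, 3424222855, 123, 87, 3394055377, 60361466, 79461456, 79430346,
   159, 15, 5434783377, 78292944, 85579836, 87, 159, 5628527857, 85343640, 79550196, 15, 51,
   3388729155, 51987596, 80317994, 267, 87, 3389389777, 49874956, 84861690, 303, 51, 3388730275,
   81394070, 51016640, 87, 303, 3388808035, 81485888, 79561328, 51, 267, 3388728817, 72511466,
   81394180, 303, 87, 293, 3389507875, 51009296, 81407300, 52079468, 87, 267, 255, 3388806577,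
   53103146, 82050504, 53094496, 53, 89, 197, 3421053163, 51, 87, 123, 231, 3422863999, 221,
   3417615199, 159, 181, 3723679279, 225, 4953414079, 11, 3712914569, 217, 3712914559, 17, 125,
   289, 293, 3394980037, 303, 3388807889, 299, 3723679333, 261, 255, 5531638897, 56647544,
   57229340, 255, 253, 3723736987, 267, 3394626589, 291, 297, 6311911087, 74356718, 73643756, 299,
   291, 3734690833, 267, 269, 3388820671, 83798744, 74350904, 56405516, 255, 257, 3394055377,
   82974876, 52030058, 261, 257, 5628527857, 48841430, 48855884, 257, 255, 3394055377, 52990718,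
   52986524, 255, 269, 3388819699, 72486024, 51923624, 255, 269, 3388819699, 83099462, 50860742,
   255, 269, 3388819699, 83099300, 49797860, 159, 261, 267, 6068377297, 72485222, 50981648,
   72485216, 261, 159, 267, 6068377297, 72485060, 72485054, 49918766],
  [225, 5130915373, 221, 3411526591, 197, 161, 3839513743, 125, 3414360943, 89, 185, 3389166703,
   233, 3411605323, 255, 51, 267, 3388728817, 72603644, 83099292, 52045934, 233, 269, 257,
   3414833335, 261, 6164036677, 255, 3411612613, 51, 87, 123, 159, 231, 3411592201, 267,
   3414898945, 185, 3408049261, 217, 3723677839, 11, 3712914551, 253, 3723678343, 181, 3712914541,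
   17, 3712914557, 189, 4178573101, 15, 289, 297, 6209624355, 299, 3411735117, 56872094, 305, 291,
   3734612101, 73643756, 48880616, 48726284, 52976318, 72477276, 50850554, 49787672, 231, 87,
   3411592201, 261, 255, 257, 217, 5531640121, 267, 3411599491, 53, 5531640517, 253, 17,
   5434783397, 11, 5434783391, 13, 85, 3389296495, 49, 3388727695, 78336978, 193, 85, 3412124371,
   69808658, 84869142, 79548332, 79548368, 80344256, 50850590, 305, 297, 6938877655, 291,
   3411614071, 293, 3414951433, 261, 299, 217, 255, 5531640121, 87, 159, 3723677839, 52994120,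
   50865440, 253, 17, 5434783397, 11, 5434783391, 255, 289, 5531640157, 53, 5531640517, 257, 259,
   13, 85, 3389296495, 193, 5434783393, 87, 15, 3389296497, 79430346, 15626698, 15, 51, 3388727697,
   87, 3389296497, 193, 121, 3412235179, 78451044, 63562248, 229, 265, 3414775015, 123, 159,
   3734760817, 79306898, 67774254, 72506286, 159, 51, 5531638897, 78485504, 84411978, 51, 159,
   5531638897, 78244916, 49787672, 15, 159, 5434783377, 52994120, 79255292, 159, 87, 257,
   5628527857, 27830156, 53063762, 79307762, 159, 267, 6068377297, 81477392, 50964280, 267, 87,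
   257, 3389389777, 46962068, 50850914, 72503348, 255, 291, 299, 3414763351, 257, 293, 259, 261,
   217, 5531640121, 53, 5531640517, 253, 17, 5434783397, 11, 5434783391, 289, 295, 297, 121, 301,
   3440932993, 193, 3412235179, 51, 159, 5728006027, 81681800, 85815548, 15, 51, 6269262009, 267,
   3434306667, 193, 13, 6209624371, 78516654, 84582744, 229, 301, 3411587827, 267, 303, 3388728943,
   66738588, 77455068, 79255374, 51, 87, 5590081369, 85592628, 68654550, 87, 123, 3427181137,
   73810212, 15746628, 87, 267, 3389389777, 81475934, 85120236, 159, 87, 5628527857, 53063762,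
   79307762, 51, 87, 3389430115, 50850590, 49787708, 303, 123, 3394756675, 73797414, 81486068, 87,
   123, 3394055377, 73693248, 50850556, 51, 303, 3388730275, 79360286, 49787672, 51, 267,
   3388728817, 72511466, 81394180, 293, 123, 303, 3394756675, 52079468, 50951138, 53135222, 51,
   123, 87, 159, 267, 185, 3408049261, 217, 3723677839, 181, 3712914541, 257, 3389389777, 82974876,
   72485546, 83099778, 53107456, 72485538, 83099292, 299, 297, 6680597329, 293, 3411762787, 257,
   261, 291, 5628628459, 85, 157, 5628514735, 301, 3411815275, 267, 87, 3389389777, 62275264,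
   72508874, 301, 265, 193, 3412707571, 255, 3411822565, 185, 6022909567, 50734220, 87, 231,
   3411592201, 267, 3389389777, 89, 161, 5628540979, 73281308, 73535000, 125, 259, 161, 5729317939,
   60426428, 50850572, 82705146, 89, 269, 3389402899, 82074488, 66452548, 87, 267, 3389389777,
   72477428, 50850590, 269, 51, 89, 267, 3388820671, 72480308, 50968652, 49787672, 82046246, 257,
   293, 259, 295, 297, 87, 231, 3411592201, 267, 6403723129, 125, 305, 3443058757, 73535954,
   82050504, 121, 301, 3440932993, 265, 3431367055, 269, 305, 3443531149, 66920036, 82703876, 229,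
   85, 3411579079, 269, 161, 6504631309, 60426420, 60426906, 63967578, 125, 269, 3433492819,
   82046300, 82046292, 123, 159, 3734760817, 72478898, 72478896, 303, 87, 3389507875, 50850572,
   57227864, 87, 267, 3389389777, 72477446, 50850556, 303, 161, 123, 305, 3872463085, 57345944,
   72477276, 53094416, 57227846],
  [11, 181, 3388719017, 217, 3388719035, 231, 51, 3388720169, 255, 259, 253, 267, 3388728917, 123,
   3425937077, 87, 3424741517, 221, 3424740707, 257, 49, 121, 3425936815, 229, 3388720007,
   63967578, 229, 85, 3389311955, 121, 3425936915, 265, 3388728755, 53, 125, 3394980019, 197,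
   3388720313, 82705146, 161, 89, 3809773459, 65688018, 60373932, 72364038, 49787672, 49787636,
   49787690, 49790570, 49, 229, 3388720007, 193, 3388719989, 87, 121, 221, 3392854247, 185,
   3392854229, 51, 85, 123, 157, 159, 289, 303, 3392855083, 293, 3392854273, 299, 3388719071, 253,
   265, 3393917785, 63968558, 56640236, 255, 265, 3684217303, 261, 5531638897, 257, 3394055377,
   297, 301, 6757124833, 65975846, 62908574, 299, 303, 3388720205, 253, 265, 3393917785, 63643028,
   16256876, 56404058, 259, 255, 3425936977, 52979216, 52989296, 267, 255, 3388728817, 52856744,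
   72600728, 265, 255, 3388728655, 51929294, 72719304, 267, 253, 3392855065, 50733878, 73532066,
   255, 265, 3388728655, 64085522, 49807904, 255, 267, 3388806577, 62800530, 51804068, 253, 265,
   3388720015, 63849488, 50857808, 193, 229, 265, 255, 3388728737, 123, 51, 87, 185, 3393917111,
   85, 3393917777, 221, 3393917129, 267, 3388807469, 289, 293, 3393917155, 291, 3388797955,
   72713570, 301, 303, 3388808945, 75534476, 72390452, 50853452, 49790570, 51929294, 53, 197,
   3388720313, 233, 3388720331, 87, 159, 121, 161, 3799008497, 51, 3712915037, 83099294, 125, 85,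
   3394980641, 185, 3394979993, 221, 3394980011, 89, 305, 295, 3723682609, 301, 3388822049, 253,
   257, 3394980019, 66334352, 50774540, 253, 255, 3723736987, 257, 3394980019, 301, 291,
   3388730213, 25588094, 66913322, 301, 291, 3388730213, 259, 269, 3433492819, 85232912, 35310992,
   51844874, 253, 259, 3722441149, 49640270, 51766142, 255, 259, 3723680017, 83094432, 52030058,
   253, 269, 3388720339, 82286222, 52986488, 269, 253, 3388720339, 50863478, 82049702, 197, 89,
   3388817693, 85, 233, 3388791773, 259, 253, 3424741337, 50984492, 49927496, 123, 159, 51, 185,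
   3393917111, 121, 3712915037, 125, 3712915361, 221, 3393917129, 87, 289, 293, 3393917155, 299,
   3388719071, 257, 253, 3393917137, 56640236, 78395460, 253, 255, 3388797937, 257, 3393917137,
   299, 295, 3712914605, 24556964, 59155142, 299, 303, 3388720205, 255, 257, 3394055377, 25940912,
   16256876, 60488222, 255, 259, 3425936977, 60419616, 61566836, 259, 255, 267, 3432429937, 125,
   3425937221, 79464498, 59352134, 50924768, 259, 267, 3432429937, 71842100, 52989296, 255, 51,
   267, 3388728817, 75148818, 69005778, 51929294, 267, 255, 87, 3388806577, 82049690, 49904294,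
   73416722, 123, 259, 267, 3432429937, 72482144, 49691300, 72364038, 87, 267, 255, 3388806577,
   49672472, 73768100, 69700890, 259, 267, 123, 3432429937, 159, 3772552177, 255, 51, 3388728817,
   87, 3388806577, 229, 233, 49, 17, 3388720013, 121, 3425936815, 89, 3388819051, 265, 3388728655,
   70040976, 53, 85, 3388793131, 125, 3425937139, 269, 3388728979, 84580818, 13, 269, 3388729081,
   157, 85, 3637586575, 78336500, 71948022, 161, 89, 3809773459, 59440806, 72180168, 89, 161,
   3809773459, 72721734, 72721406, 121, 265, 3431367055, 72719304, 63967578, 51916334, 269, 125,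
   3433492819, 161, 3858645619, 233, 221, 3433847113, 225, 5408327575, 185, 197, 3433729015, 261,
   6175964575, 82046130, 189, 257, 4371427135, 197, 4633486597, 53097332, 53, 255, 3388728979, 87,
   159, 3723681151, 52979216, 50854910, 89, 255, 3388819699, 123, 159, 3734839549, 52979216,
   51917792, 17, 217, 3388719041, 253, 3388719059, 159, 51, 3712914593, 49787636, 52976282, 217,
   255, 3388729069, 87, 159, 3723681241, 52979216, 48812090, 181, 257, 3389409451, 197, 159, 87,
   3723681223, 53063636, 52979234, 50971568, 231, 87, 3433912723, 255, 257, 253, 159, 3768773041,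
   51, 3389409703, 13, 229, 3388729081, 85, 3389296495, 68651236, 121, 85, 3392992495, 77273610,
   78451044, 50851976, 53063636, 48812090, 197, 265, 121, 3431367055, 157, 3686458735, 159, 87, 15,
   123, 51, 255, 3723680017, 257, 3427181137, 253, 3424740657, 261, 5728255057, 13, 3712914589,
   289, 297, 6209624355, 295, 3434306595, 47188040, 301, 293, 3431957545, 45062618, 53036384,
   62616822, 75031224, 77454420, 79580184, 77221140, 51, 291, 299, 3433777129, 303, 3388730275,
   297, 289, 13, 157, 6209624353, 76080992, 76119710, 73760486, 73412024, 305, 301, 297,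
   6958009531, 85, 3434135797, 255, 123, 3425936977, 81406104, 72362192, 73407668, 72511466, 255,
   229, 121, 3393543619, 65688018, 64085522, 48798968, 73416722, 83100264, 265, 121, 3431367055,
   157, 3686458735, 229, 225, 5236140691, 221, 3431721349, 189, 257, 4369301371, 193, 4461299713,
   62911338, 15, 291, 299, 3431769463, 297, 293, 49, 6306484087, 301, 6785822647, 217, 6306484177,
   85, 6403710007, 289, 159, 6209624355, 89, 17, 3389414597, 84856176, 79475234, 72474530,
   72477446, 72716558, 301, 305, 297, 6785822647, 89, 3432036277, 257, 159, 123, 3734760817,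
   75381144, 62578104, 72856148, 85233038, 72508874, 233, 261, 125, 6006730141, 84802740, 48727742,
   83453432, 64204584, 233, 125, 221, 3395583361, 189, 4370954743, 217, 255, 3425937229, 159, 51,
   3712915369, 49790570, 52979216, 225, 161, 5379629761, 257, 5370536215, 197, 5136229783,
   53097332, 185, 161, 3851441641, 197, 3395465263, 229, 49, 3389133979, 73281146, 64205564, 51,
   291, 299, 3395631475, 303, 3388730275, 295, 297, 289, 229, 159, 6306479875, 161, 6504158917, 13,
   6209625199, 81718430, 63968558, 72592628, 72716558, 72597002, 299, 301, 305, 297, 6695477677,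
   49, 3395632285, 157, 3701339083, 253, 17, 3424740659, 159, 3712914577, 84856176, 72506192,
   85231580, 72594104, 72830282, 261, 229, 161, 5729317939, 85, 3395635849, 157, 3682207207,
   81521780, 64085522, 49787708, 197, 89, 185, 3389166703, 221, 3389284801, 181, 3388818961, 217,
   3388817521, 51, 231, 3388819213, 289, 299, 3388817557, 303, 3388720195, 291, 295, 229, 161,
   3809774917, 159, 3712914595, 13, 3388817533, 81718430, 63968558, 72597002, 73407650, 305, 301,
   303, 3388822129, 291, 3388821157, 121, 3393772525, 49, 3388821967, 255, 253, 15, 3388727697,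
   84802254, 73643756, 75534476, 72710744, 85100522, 229, 13, 3388817533, 49, 3388819051, 84816654,
   64085522, 15, 253, 123, 3424740657, 49, 157, 3626821135, 79306584, 79267218, 51, 289, 291,
   3388729155, 303, 3388719075, 305, 301, 17, 3388719077, 221, 3389251069, 53, 3388720357, 13,
   3388719073, 257, 123, 87, 3427181137, 70052972, 75122736, 75654050, 72712202, 72511466, 291,
   295, 303, 3388730275, 123, 3435502915, 79294964, 72478814, 72712094, 85, 193, 217, 3388791277,
   49787636, 79268342, 79464498, 193, 255, 121, 53, 3393385831, 49, 3425936815, 78401454, 79255536,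
   80318012, 79255220, 157, 255, 85, 3637586575, 82769946, 52034432, 82770270, 53, 87, 161, 123,
   125, 17, 253, 3799008019, 257, 3427181137, 289, 293, 3394980037, 303, 3388807889, 83100380, 303,
   305, 3872463085, 72722300, 83336540, 72484898, 83100264, 72486024, 72485546, 83099462, 72485060,
   51, 15, 87, 159, 123, 289, 297, 6209624355, 293, 3393917155, 303, 3388719075, 261, 257,
   5628527857, 35270690, 47661926, 255, 253, 3388727697, 267, 3388728817, 303, 291, 3388808035,
   72712094, 35270654, 189, 217, 4362202581, 303, 299, 4389023737, 56414138, 35191454, 297, 293,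
   6403368835, 303, 6843218275, 217, 221, 3393917119, 35427650, 35191454, 299, 253, 217, 267,
   3388719057, 291, 3388730041, 72856166, 35187080, 35266280, 56876450, 72478734, 52976336,
   50850572, 48724808, 49787690]]

theorem refutes_cherryTree : refutes closesLeafOrCherry cherryTree [(pathMask, 0)] = true := by
  decide +kernel

/-- Labels below `64` refer to `branches`, others are leaves in the sense of `closesLeaf`. -/
def branchLeaf (R B t : ℕ) : Bool :=
  if t < 64 then refutes closesLeaf (branches.getD t []) [(R, B)] else closesLeaf R B t

theorem refutes_rootTree :
    refutes branchLeaf rootTree [(insertEdge (insertEdge pathMask 191) 227, 0)] = true := by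
  decide +kernel


theorem lt_of_mem_alternatingLabels {k s n u : ℕ} (hs : s ≤ 1)
    (hu : u ∈ alternatingLabels k s n) : u < 18 := by
  induction k generalizing s n with
  | zero => simp [alternatingLabels] at hu
  | succ k ih =>
    rw [alternatingLabels, List.mem_cons] at hu
    rcases hu with rfl | hu
    · omega
    · exact ih (by omega) hu

theorem length_alternatingLabels (k s n : ℕ) : (alternatingLabels k s n).length = k := by
  induction k generalizing s n with
  | zero => rfl
  | succ k ih => simp [alternatingLabels, ih]

/-- Every pair recorded in the mask `M` is related by `r`. -/
def MaskHolds (r : ℕ → ℕ → Prop) (M : ℕ) : Prop :=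
  ∀ u w, w < 18 → M.testBit (pairBit u w) = true → r u w

theorem maskHolds_zero (r : ℕ → ℕ → Prop) : MaskHolds r 0 := by
  intro u w _ h
  simp at h

theorem MaskHolds.insertEdge {r : ℕ → ℕ → Prop} {M e : ℕ} (hM : MaskHolds r M)
    (hr : r (e / 18) (e % 18)) (hr' : r (e % 18) (e / 18)) (he : e < 324) :
    MaskHolds r (insertEdge M e) := by
  intro u w hw h
  simp only [_root_.insertEdge, Nat.testBit_or, Nat.testBit_two_pow, Bool.or_eq_true,
    decide_eq_true_eq, pairBit] at h
  rcases h with (h | h) | h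
  · exact hM u w hw h
  · obtain ⟨rfl, rfl⟩ : u = e / 18 ∧ w = e % 18 := by omega
    exact hr
  · obtain ⟨rfl, rfl⟩ : u = e % 18 ∧ w = e / 18 := by omega
    exact hr'

theorem hasBit_eq_testBit (M e : ℕ) : hasBit M e = M.testBit e := by
  rw [Nat.testBit_eq_decide_div_mod_eq, ← Nat.shiftRight_eq_div_pow, ← Nat.and_one_is_mod]
  exact Bool.eq_iff_iff.2 ((Iff.of_eq Nat.beq_eq).trans decide_eq_true_iff.symm)

theorem MaskHolds.of_isPathFrom {r : ℕ → ℕ → Prop} {M : ℕ} (hM : MaskHolds r M) {l : List ℕ}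
    {u U : ℕ} (hl : ∀ w ∈ l, w < 18) (h : isPathFrom M l u U = true) :
    (∀ w ∈ l, U.testBit w = false) ∧ l.Nodup ∧ (u :: l).IsChain r := by
  induction l generalizing u U with
  | nil => simp
  | cons w l ih =>
    simp only [isPathFrom, hasBit_eq_testBit, Bool.and_eq_true, Bool.not_eq_true'] at h
    obtain ⟨⟨h₁, h₂⟩, h₃⟩ := h
    obtain ⟨hU, hn, hc⟩ := ih (fun x hx => hl x (List.mem_cons_of_mem _ hx)) h₃
    have hU' : ∀ x ∈ l, U.testBit x = false ∧ w ≠ x := by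
      intro x hx
      have := hU x hx
      rwa [show Nat.lor U (Nat.pow 2 w) = U ||| 2 ^ w from rfl, Nat.testBit_or,
        Nat.testBit_two_pow, Bool.or_eq_false_iff, decide_eq_false_iff_not] at this
    refine ⟨List.forall_mem_cons.2 ⟨h₂, fun x hx => (hU' x hx).1⟩,
      List.nodup_cons.2 ⟨fun hw => (hU' w hw).2 rfl, hn⟩,
      List.IsChain.cons_cons (hM u w (hl w (by simp)) h₁) hc⟩

theorem MaskHolds.of_isPathIn {r : ℕ → ℕ → Prop} {M : ℕ} (hM : MaskHolds r M) {l : List ℕ}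
    (hl : ∀ u ∈ l, u < 18) (h : isPathIn M l = true) : l.Nodup ∧ l.IsChain r := by
  cases l with
  | nil => simp
  | cons u l =>
    obtain ⟨hU, hn, hc⟩ := hM.of_isPathFrom (fun x hx => hl x (List.mem_cons_of_mem _ hx)) h
    refine ⟨List.nodup_cons.2 ⟨fun hu => ?_, hn⟩, hc⟩
    have := hU u hu
    rw [show Nat.pow 2 u = 2 ^ u from rfl, Nat.testBit_two_pow_self] at this
    exact Bool.noConfusion this

/-- `r` has a path on `12` labels from `0` to `9`, or `b` has a cycle on `8` labels. -/
def HasPathOrOctagon (r b : ℕ → ℕ → Prop) : Prop :=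
  (∃ p : List ℕ, p.length = 10 ∧ (∀ u ∈ 0 :: (p ++ [9]), u < 18) ∧ (0 :: (p ++ [9])).Nodup ∧
    (0 :: (p ++ [9])).IsChain r) ∨
  ∃ u, ∃ l : List ℕ, l.length = 7 ∧ (∀ x ∈ u :: l, x < 18) ∧ (u :: l).Nodup ∧
    (u :: l).IsChain b ∧ b (l.getLastD u) u

theorem hasPathOrOctagon_of_closesLeaf {r b : ℕ → ℕ → Prop} {R B t : ℕ} (hR : MaskHolds r R)
    (hB : MaskHolds b B) (h : closesLeaf R B t = true) : HasPathOrOctagon r b := by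
  unfold closesLeaf at h
  split_ifs at h
  · right
    have hlen := length_alternatingLabels 8 0 (t / 2)
    have hlt := fun x => lt_of_mem_alternatingLabels (k := 8) (n := t / 2) (u := x) zero_le_one
    revert h hlen hlt
    cases alternatingLabels 8 0 (t / 2) with
    | nil => simp
    | cons u l =>
      intro h hlen hlt
      simp only [Bool.and_eq_true] at h
      obtain ⟨hn, hc⟩ := hB.of_isPathIn hlt h.1
      exact ⟨u, l, by simpa using hlen, hlt, hn, hc,
        hB _ _ (hlt u (by simp)) (hasBit_eq_testBit _ _ ▸ h.2)⟩
  · left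
    have hlt : ∀ u ∈ 0 :: (alternatingLabels 10 1 (t / 2) ++ [9]), u < 18 := by
      intro u hu
      simp only [List.mem_cons, List.mem_append, List.not_mem_nil, or_false] at hu
      rcases hu with rfl | hu | rfl
      · norm_num
      · exact lt_of_mem_alternatingLabels le_rfl hu
      · norm_num
    exact ⟨_, length_alternatingLabels _ _ _, hlt, hR.of_isPathIn hlt h⟩

/-- `r` has two edges from an odd label `w ≥ 10` to distinct even labels `u, u' ≥ 10`. -/
def HasCherry (r : ℕ → ℕ → Prop) : Prop :=
  ∃ u w u', 10 ≤ u ∧ 10 ≤ w ∧ 10 ≤ u' ∧ u < 18 ∧ w < 18 ∧ u' < 18 ∧ u % 2 = 0 ∧ w % 2 = 1 ∧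
    u' % 2 = 0 ∧ u ≠ u' ∧ r u w ∧ r w u'

theorem hasCherry_of_closesLeafOrCherry {r b : ℕ → ℕ → Prop} {R B t : ℕ} (hR : MaskHolds r R)
    (hB : MaskHolds b B) (h : closesLeafOrCherry R B t = true) :
    HasPathOrOctagon r b ∨ HasCherry r := by
  simp only [closesLeafOrCherry, alternatingLabels, Bool.or_eq_true, Bool.and_eq_true,
    Nat.ble_eq] at h
  rcases h with h | ⟨⟨⟨h₁, h₂⟩, h₃⟩, h⟩
  · exact .inl (hasPathOrOctagon_of_closesLeaf hR hB h)
  · right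
    obtain ⟨hn, hc⟩ := hR.of_isPathIn
      (fun _ => lt_of_mem_alternatingLabels (k := 3) (n := t / 2) zero_le_one) h
    simp only [alternatingLabels, List.isChain_cons_cons, List.nodup_cons, List.mem_cons] at hn hc
    exact ⟨_, _, _, h₁, h₂, h₃, by omega, by omega, by omega, by omega, by omega, by omega,
      fun h => hn.1 (.inr (.inl h)), hc.1, hc.2.1⟩

/-- A verified decision tree refutes every pair of relations covering all pairs of labels of
distinct parity. -/
theorem of_refutes {r b : ℕ → ℕ → Prop} {P : Prop} {leaf : ℕ → ℕ → ℕ → Bool}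
    (hr : ∀ u w, r u w → r w u) (hb : ∀ u w, b u w → b w u)
    (hrb : ∀ u < 18, ∀ w < 18, (u + w) % 2 = 1 → r u w ∨ b u w)
    (hleaf : ∀ R B t, MaskHolds r R → MaskHolds b B → leaf R B t = true → P)
    {ts : List ℕ} {st : List (ℕ × ℕ)} (h : refutes leaf ts st = true)
    (hst : ∃ p ∈ st, MaskHolds r p.1 ∧ MaskHolds b p.2) : P := by
  induction ts generalizing st with
  | nil =>
    cases st with
    | nil => simp at hst
    | cons => simp [refutes] at h
  | cons t ts ih =>
    match st with
    | [] => simp at hst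
    | (R, B) :: st =>
      simp only [refutes] at h
      split_ifs at h with ht
      · simp only [Bool.and_eq_true, beq_iff_eq] at h
        refine ih h.2 ?_
        obtain ⟨p, hp, hpr, hpb⟩ := hst
        rcases List.mem_cons.1 hp with rfl | hp
        · rcases hrb (t / 18) (by omega) (t % 18) (by omega) h.1 with h' | h'
          · exact ⟨(insertEdge R t, B), by simp, hpr.insertEdge h' (hr _ _ h') ht, hpb⟩
          · exact ⟨(R, insertEdge B t), by simp, hpr, hpb.insertEdge h' (hb _ _ h') ht⟩
        · exact ⟨p, by simp [hp], hpr, hpb⟩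
      · simp only [Bool.and_eq_true] at h
        obtain ⟨p, hp, hpr, hpb⟩ := hst
        rcases List.mem_cons.1 hp with rfl | hp
        · exact hleaf R B _ hpr hpb h.1
        · exact ih h.2 ⟨p, hp, hpr, hpb⟩

theorem maskHolds_pathMask {r : ℕ → ℕ → Prop} (hr : ∀ u w, r u w → r w u)
    (h : ∀ u < 9, r u (u + 1)) : MaskHolds r pathMask := by
  have key : ∀ es : List ℕ, (∀ e ∈ es, e < 324 ∧ r (e / 18) (e % 18)) → ∀ M, MaskHolds r M →
      MaskHolds r (es.foldl insertEdge M) := by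
    intro es
    induction es with
    | nil => exact fun _ M hM => hM
    | cons e es ih =>
      intro hes M hM
      have he := hes e (by simp)
      exact ih (fun x hx => hes x (List.mem_cons_of_mem _ hx)) _
        (hM.insertEdge he.2 (hr _ _ he.2) he.1)
  refine key _ ?_ 0 (maskHolds_zero r)
  intro e he
  simp only [List.mem_cons, List.not_mem_nil, or_false] at he
  rcases he with rfl | rfl | rfl | rfl | rfl | rfl | rfl | rfl | rfl
  exacts [⟨by norm_num, h 0 (by norm_num)⟩, ⟨by norm_num, h 1 (by norm_num)⟩,
    ⟨by norm_num, h 2 (by norm_num)⟩, ⟨by norm_num, h 3 (by norm_num)⟩,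
    ⟨by norm_num, h 4 (by norm_num)⟩, ⟨by norm_num, h 5 (by norm_num)⟩,
    ⟨by norm_num, h 6 (by norm_num)⟩, ⟨by norm_num, h 7 (by norm_num)⟩,
    ⟨by norm_num, h 8 (by norm_num)⟩]

section Labels

variable {r b : ℕ → ℕ → Prop}

theorem hasPathOrOctagon_or_hasCherry (hr : ∀ u w, r u w → r w u) (hb : ∀ u w, b u w → b w u)
    (hrb : ∀ u < 18, ∀ w < 18, (u + w) % 2 = 1 → r u w ∨ b u w) (h : ∀ u < 9, r u (u + 1)) :
    HasPathOrOctagon r b ∨ HasCherry r :=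
  of_refutes hr hb hrb (fun _ _ _ => hasCherry_of_closesLeafOrCherry) refutes_cherryTree
    ⟨_, List.mem_singleton_self _, maskHolds_pathMask hr h, maskHolds_zero b⟩

theorem hasPathOrOctagon_of_cherry (hr : ∀ u w, r u w → r w u) (hb : ∀ u w, b u w → b w u)
    (hrb : ∀ u < 18, ∀ w < 18, (u + w) % 2 = 1 → r u w ∨ b u w) (h : ∀ u < 9, r u (u + 1))
    (h₁ : r 10 11) (h₂ : r 12 11) : HasPathOrOctagon r b := by
  refine of_refutes hr hb hrb ?_ refutes_rootTree ⟨_, List.mem_singleton_self _,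
    ((maskHolds_pathMask hr h).insertEdge h₁ (hr _ _ h₁) (by norm_num)).insertEdge h₂
      (hr _ _ h₂) (by norm_num),
    maskHolds_zero b⟩
  intro R B t hR hB ht
  unfold branchLeaf at ht
  split_ifs at ht
  · exact of_refutes hr hb hrb (fun _ _ _ => hasPathOrOctagon_of_closesLeaf) ht
      ⟨_, List.mem_singleton_self _, hR, hB⟩
  · exact hasPathOrOctagon_of_closesLeaf hR hB ht

end Labels

section Graph

variable {V : Type*} {G H : SimpleGraph V}

theorem hasCycleLen_of_isChain {l : List V} {d : V} (hl : 2 ≤ l.length) (hn : (l ++ [d]).Nodup)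
    (hc : (d :: (l ++ [d])).IsChain G.Adj) : HasCycleLen G (l.length + 1) := by
  obtain ⟨w, hs⟩ : ∃ w : G.Walk d d, w.support = d :: (l ++ [d]) :=
    ⟨(Walk.ofSupport _ (List.cons_ne_nil _ _) hc).copy (u' := d) (v' := d) rfl (by simp),
      (Walk.support_copy _ _ _).trans (Walk.support_ofSupport _ _)⟩
  have hw : w.length = l.length + 1 := by
    have := w.length_support
    rw [hs] at this
    simpa using this.symm
  have hnil : ¬ w.Nil := by
    rw [Walk.not_nil_iff_lt_length]
    omega
  refine ⟨d, w, Walk.isCycle_iff_isPath_tail_and_le_length.2 ⟨?_, by omega⟩, hw⟩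
  rw [Walk.isPath_def, Walk.support_tail_of_not_nil _ hnil, hs]
  exact hn

/-- Ten consecutive vertices `c 0, …, c 9` of a cycle, the others being listed in `L`, with eight
vertices `c 10, …, c 17` outside of it. -/
structure IsWindow (G : SimpleGraph V) (c : ℕ → V) (L : List V) : Prop where
  injOn : Set.InjOn c (Set.Iio 18)
  nodup : L.Nodup
  notMem : ∀ u < 18, c u ∉ L
  adj : ∀ u < 9, G.Adj (c u) (c (u + 1))
  isChain : (c 9 :: (L ++ [c 0])).IsChain G.Adj

theorem nodup_map_of_injOn {c : ℕ → V} (hc : Set.InjOn c (Set.Iio 18)) {p : List ℕ}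
    (hp : ∀ u ∈ p, u < 18) (hn : p.Nodup) : (p.map c).Nodup :=
  hn.map_on fun _ hx _ hy h => hc (hp _ hx) (hp _ hy) h

theorem IsWindow.hasCycleLen_of_hasPathOrOctagon {c : ℕ → V} {L : List V} (hw : IsWindow G c L)
    (h : HasPathOrOctagon (fun u w => G.Adj (c u) (c w)) fun u w => H.Adj (c u) (c w)) :
    HasCycleLen G (L.length + 12) ∨ HasCycleLen H 8 := by
  rcases h with ⟨p, hlen, hlt, hn, hc⟩ | ⟨u, l, hlen, hlt, hn, hc, hcl⟩
  · left
    have hn' := nodup_map_of_injOn hw.injOn hlt hn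
    have hc' : ((0 :: (p ++ [9])).map c).IsChain G.Adj := (List.isChain_map c).2 hc
    have key := hasCycleLen_of_isChain (G := G) (l := L ++ (0 :: p).map c) (d := c 9)
      (by simp; omega) ?_ ?_
    · convert key using 1
      simp [hlen]
    · rw [List.append_assoc]
      refine List.Nodup.append hw.nodup (by simpa using hn') ?_
      intro x hx hx'
      have : x ∈ (0 :: (p ++ [9])).map c := by simpa using hx'
      obtain ⟨u, hu, rfl⟩ := List.mem_map.1 this
      exact hw.notMem u (hlt u hu) hx
    · have h₁ := hw.isChain
      have : c 9 :: (L ++ (0 :: p).map c ++ [c 9]) =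
          (c 9 :: L) ++ c 0 :: (p ++ [9]).map c := by simp
      rw [this, List.isChain_split]
      exact ⟨by simpa using h₁, by simpa using hc'⟩
  · right
    have hl : l ≠ [] := by
      rintro rfl
      simp at hlen
    obtain ⟨m, z, rfl⟩ : ∃ m z, l = m ++ [z] := ⟨_, _, (List.dropLast_append_getLast hl).symm⟩
    have hn' := nodup_map_of_injOn hw.injOn hlt hn
    have hc' : ((u :: (m ++ [z])).map c).IsChain H.Adj := (List.isChain_map c).2 hc
    have hcl' : H.Adj (c z) (c u) := by simpa using hcl
    have hm : m.length = 6 := by simpa using hlen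
    have key := hasCycleLen_of_isChain (G := H) (l := (u :: m).map c) (d := c z) (by simp [hm])
      (by simpa using hn') ?_
    · simpa [hm] using key
    · have := List.IsChain.cons_cons (R := H.Adj) (a := c z) (b := c u) hcl' (by simpa using hc')
      simpa using this

/-- Swapping outer labels so that a cherry `u, w, u'` becomes `10, 11, 12`. -/
def cherrySwap (u w u' : ℕ) : Equiv.Perm ℕ :=
  (Equiv.swap 11 w).trans ((Equiv.swap 12 (Equiv.swap 10 u u')).trans (Equiv.swap 10 u))

theorem IsWindow.hasCycleLen {c : ℕ → V} {L : List V} (hw : IsWindow G c L)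
    (hGH : ∀ u < 18, ∀ w < 18, (u + w) % 2 = 1 → G.Adj (c u) (c w) ∨ H.Adj (c u) (c w)) :
    HasCycleLen G (L.length + 12) ∨ HasCycleLen H 8 := by
  rcases hasPathOrOctagon_or_hasCherry (r := fun u w => G.Adj (c u) (c w))
    (b := fun u w => H.Adj (c u) (c w)) (fun _ _ h => h.symm) (fun _ _ h => h.symm) hGH hw.adj with
    h | ⟨u, w, u', hu, hv, hu', hu18, hv18, hu'18, hu2, hv2, hu'2, hne, h₁, h₂⟩
  · exact hw.hasCycleLen_of_hasPathOrOctagon h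
  · set τ := cherrySwap u w u' with hτ
    have hswap : ∀ x y z : ℕ, 10 ≤ x → 10 ≤ y → x < 18 → y < 18 → x % 2 = y % 2 →
        (z < 18 → Equiv.swap x y z < 18) ∧ (10 ≤ z → 10 ≤ Equiv.swap x y z) ∧
        (z < 10 → Equiv.swap x y z = z) ∧ Equiv.swap x y z % 2 = z % 2 := by
      intro x y z _ _ _ _ _
      rw [Equiv.swap_apply_def]
      split_ifs <;> omega
    have hs := hswap 10 u u' (by norm_num) hu (by norm_num) hu18 (by omega)
    have hs₁ := fun z => hswap 11 w z (by norm_num) hv (by norm_num) hv18 (by omega)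
    have hs₂ := fun z => hswap 12 (Equiv.swap 10 u u') z (by norm_num) (hs.2.1 hu') (by norm_num)
      (hs.1 hu'18) (by omega)
    have hs₃ := fun z => hswap 10 u z (by norm_num) hu (by norm_num) hu18 (by omega)
    have hlt : ∀ z < 18, τ z < 18 := fun z hz =>
      (hs₃ _).1 ((hs₂ _).1 ((hs₁ _).1 hz))
    have hmod : ∀ z, τ z % 2 = z % 2 := fun z =>
      ((hs₃ _).2.2.2.trans (hs₂ _).2.2.2).trans (hs₁ _).2.2.2
    have hfix : ∀ z < 10, τ z = z := by
      intro z hz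
      have e₁ := (hs₁ z).2.2.1 hz
      have e₂ := (hs₂ z).2.2.1 hz
      have e₃ := (hs₃ z).2.2.1 hz
      simp [hτ, cherrySwap, e₁, e₂, e₃]
    have hne' : Equiv.swap 10 u u' ≠ 10 := by
      rw [Equiv.swap_apply_def]
      split_ifs <;> omega
    have e10 : τ 10 = u := by
      have : Equiv.swap 11 w 10 = 10 := Equiv.swap_apply_of_ne_of_ne (by norm_num) (by omega)
      have h' : Equiv.swap 12 (Equiv.swap 10 u u') 10 = 10 :=
        Equiv.swap_apply_of_ne_of_ne (by norm_num) hne'.symm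
      simp [hτ, cherrySwap, this, h']
    have e11 : τ 11 = w := by
      have h' : Equiv.swap 12 (Equiv.swap 10 u u') w = w :=
        Equiv.swap_apply_of_ne_of_ne (by omega) (by have := hs.2.2.2; omega)
      have h'' : Equiv.swap 10 u w = w := Equiv.swap_apply_of_ne_of_ne (by omega) (by omega)
      simp [hτ, cherrySwap, h', h'']
    have e12 : τ 12 = u' := by
      have : Equiv.swap 11 w 12 = 12 := Equiv.swap_apply_of_ne_of_ne (by norm_num) (by omega)
      simp [hτ, cherrySwap, this]
    have hw' : IsWindow G (c ∘ τ) L := by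
      refine ⟨?_, hw.nodup, fun z hz => hw.notMem _ (hlt z hz), fun z hz => ?_, ?_⟩
      · intro x hx y hy hxy
        exact τ.injective (hw.injOn (hlt x hx) (hlt y hy) hxy)
      · simpa [hfix z (by omega), hfix (z + 1) (by omega)] using hw.adj z hz
      · simpa [hfix 0, hfix 9] using hw.isChain
    refine hw'.hasCycleLen_of_hasPathOrOctagon
      (hasPathOrOctagon_of_cherry (fun _ _ h => h.symm) (fun _ _ h => h.symm) ?_ hw'.adj ?_ ?_)
    · intro x hx y hy hxy
      refine hGH _ (hlt x hx) _ (hlt y hy) ?_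
      have := hmod x
      have := hmod y
      omega
    · simpa [e10, e11] using h₁
    · simpa [e11, e12] using h₂.symm

end Graph

section Sides

variable {t : ℕ} {G : SimpleGraph (Fin t ⊕ Fin t)}

theorem isLeft_eq_not_of_adj (hG : G ≤ Kbb t) {x y : Fin t ⊕ Fin t} (h : G.Adj x y) :
    y.isLeft = !x.isLeft := by
  have := hG h
  cases x <;> cases y <;> simp_all

theorem count_isLeft_of_isChain (hG : G ≤ Kbb t) (s : Bool) {k : ℕ} {l : List (Fin t ⊕ Fin t)}
    (hl : l.length = 2 * k) (hc : l.IsChain G.Adj) : l.countP (fun x => x.isLeft == s) = k := by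
  induction k generalizing l with
  | zero => simp_all
  | succ k ih =>
    match l, hl, hc with
    | x :: y :: l, hl, hc =>
      have hxy := isLeft_eq_not_of_adj hG (List.isChain_cons_cons.1 hc).1
      have := ih (l := l) (by simp at hl; omega) hc.tail.tail
      rw [List.countP_cons, List.countP_cons, this, hxy]
      cases x.isLeft <;> cases s <;> rfl

theorem exists_four_notMem {l : List (Fin t ⊕ Fin t)} (hn : l.Nodup) {s : Bool}
    (hl : l.countP (fun x => x.isLeft == s) + 4 = t) :
    ∃ a₀ a₁ a₂ a₃ : Fin t ⊕ Fin t, [a₀, a₁, a₂, a₃].Nodup ∧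
      ∀ x ∈ [a₀, a₁, a₂, a₃], x ∉ l ∧ x.isLeft = s := by
  classical
  set S : Finset (Fin t ⊕ Fin t) := Finset.univ.filter fun x => x.isLeft = s with hS
  set T : Finset (Fin t ⊕ Fin t) := (l.filter fun x => x.isLeft == s).toFinset with hT
  have hcS : S.card = t := by
    have : S = if s then Finset.univ.map Function.Embedding.inl
        else Finset.univ.map Function.Embedding.inr := by
      ext x
      cases s <;> cases x <;> simp [hS]
    rw [this]
    cases s <;> simp
  have hcT : T.card + 4 = t := by
    rw [hT, List.toFinset_card_of_nodup (hn.filter _), ← List.countP_eq_length_filter, hl]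
  have hTS : T ⊆ S := by
    intro x hx
    simp_all
  have hlen : (S \ T).toList.length = 4 := by
    rw [Finset.length_toList, Finset.card_sdiff_of_subset hTS]
    omega
  have hnd := (S \ T).nodup_toList
  have hmem : ∀ x ∈ (S \ T).toList, x ∉ l ∧ x.isLeft = s := by
    intro x hx
    simp only [Finset.mem_toList, Finset.mem_sdiff, hS, hT, Finset.mem_filter, Finset.mem_univ,
      true_and, List.mem_toFinset, List.mem_filter, beq_iff_eq, not_and] at hx
    exact ⟨fun h => hx.2 h hx.1, hx.1⟩
  match (S \ T).toList, hlen, hnd, hmem with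
  | [a₀, a₁, a₂, a₃], _, hnd, hmem => exact ⟨a₀, a₁, a₂, a₃, hnd, hmem⟩

end Sides

theorem perm_interleave {α : Type*} (a₀ a₁ a₂ a₃ b₀ b₁ b₂ b₃ : α) :
    [a₀, b₀, a₁, b₁, a₂, b₂, a₃, b₃].Perm ([a₀, a₁, a₂, a₃] ++ [b₀, b₁, b₂, b₃]) := by
  classical
  rw [List.perm_iff_count]
  intro x
  simp only [List.count_append, List.count_cons, List.count_nil]
  omega

theorem exists_isWindow {n : ℕ} (hn : 6 ≤ n) {G : SimpleGraph (Fin (n + 3) ⊕ Fin (n + 3))}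
    (hG : G ≤ Kbb (n + 3)) (hC : HasCycleLen G (2 * (n - 1))) :
    ∃ (c : ℕ → Fin (n + 3) ⊕ Fin (n + 3)) (L : List (Fin (n + 3) ⊕ Fin (n + 3))),
      IsWindow G c L ∧ L.length + 12 = 2 * n ∧
        ∀ u < 18, ∀ w < 18, (u + w) % 2 = 1 → (c w).isLeft = !(c u).isLeft := by
  obtain ⟨v, w, hw, hlen⟩ := hC
  obtain ⟨l, hl⟩ : ∃ l, w.support = v :: l := ⟨_, w.cons_tail_support.symm⟩
  have hnd : l.Nodup := by
    have := hw.support_nodup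
    rwa [hl] at this
  have hchain : (v :: l).IsChain G.Adj := hl ▸ w.isChain_adj_support
  have hll : l.length = 2 * (n - 1) := by
    have := w.length_support
    rw [hl, hlen] at this
    simpa using this
  have hlast : (v :: l).getLast (List.cons_ne_nil _ _) = v := by
    have := w.getLast_support
    simpa only [hl] using this
  obtain ⟨L, M, rfl, hL, hM⟩ : ∃ L M : List (Fin (n + 3) ⊕ Fin (n + 3)),
      l = L ++ M ∧ L.length + 12 = 2 * n ∧ M.length = 10 := by
    refine ⟨l.take (2 * n - 12), l.drop (2 * n - 12), (List.take_append_drop _ _).symm, ?_, ?_⟩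
    · rw [List.length_take]; omega
    · rw [List.length_drop]; omega
  match M, hM with
  | [c₀, c₁, c₂, c₃, c₄, c₅, c₆, c₇, c₈, c₉], _ =>
    obtain rfl : c₉ = v := by simpa using hlast
    have hcount := fun s => count_isLeft_of_isChain hG s hll hchain.tail
    obtain ⟨a₀, a₁, a₂, a₃, ha, ha'⟩ := exists_four_notMem hnd (s := c₀.isLeft)
      (by rw [hcount]; omega)
    obtain ⟨b₀, b₁, b₂, b₃, hb, hb'⟩ := exists_four_notMem hnd (s := !c₀.isLeft)
      (by rw [hcount]; omega)
    rw [show c₉ :: (L ++ [c₀, c₁, c₂, c₃, c₄, c₅, c₆, c₇, c₈, c₉]) =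
      (c₉ :: L) ++ c₀ :: [c₁, c₂, c₃, c₄, c₅, c₆, c₇, c₈, c₉] from rfl,
      List.isChain_split] at hchain
    obtain ⟨hc₁, hc₂⟩ := hchain
    set N := [c₀, c₁, c₂, c₃, c₄, c₅, c₆, c₇, c₈, c₉, a₀, b₀, a₁, b₁, a₂, b₂, a₃, b₃] with hN
    obtain ⟨hLn, hMn, hLM⟩ := List.nodup_append'.1 hnd
    have hside : ∀ u (hu : u < 18), (N.getD u c₀).isLeft = (c₀.isLeft ^^ (u % 2 == 1)) := by
      intro u hu
      have key : ∀ {x y}, G.Adj x y → y.isLeft = !x.isLeft := isLeft_eq_not_of_adj hG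
      simp only [List.isChain_cons_cons] at hc₂
      obtain ⟨h₁, h₂, h₃, h₄, h₅, h₆, h₇, h₈, h₉, -⟩ := hc₂
      simp only [List.mem_cons, List.not_mem_nil, or_false, forall_eq_or_imp, forall_eq] at ha' hb'
      interval_cases u <;> simp [hN, ha', hb', key h₁, key h₂, key h₃, key h₄, key h₅, key h₆,
        key h₇, key h₈, key h₉]
    have hperm : N.Perm ([c₀, c₁, c₂, c₃, c₄, c₅, c₆, c₇, c₈, c₉] ++
        ([a₀, a₁, a₂, a₃] ++ [b₀, b₁, b₂, b₃])) :=
      (perm_interleave a₀ a₁ a₂ a₃ b₀ b₁ b₂ b₃).append_left [c₀, c₁, c₂, c₃, c₄, c₅, c₆, c₇, c₈, c₉]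
    have hab : ∀ x ∈ [a₀, a₁, a₂, a₃] ++ [b₀, b₁, b₂, b₃],
        x ∉ L ++ [c₀, c₁, c₂, c₃, c₄, c₅, c₆, c₇, c₈, c₉] := by
      intro x hx
      rcases List.mem_append.1 hx with hx | hx
      · exact (ha' x hx).1
      · exact (hb' x hx).1
    have hNn : N.Nodup := by
      refine hperm.nodup_iff.2 (List.nodup_append'.2 ⟨hMn, List.nodup_append'.2 ⟨ha, hb, ?_⟩, ?_⟩)
      · intro x hx hx'
        have := (ha' x hx).2.symm.trans (hb' x hx').2
        exact Bool.eq_not_self _ |>.mp this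
      · exact fun x hx hx' => hab x hx' (List.mem_append_right _ hx)
    refine ⟨fun u => N.getD u c₀, L, ⟨?_, hLn, ?_, ?_, hc₁⟩, hL, ?_⟩
    · intro x hx y hy hxy
      have hx' : x < N.length := hx
      have hy' : y < N.length := hy
      simp only [List.getD_eq_getElem _ _ hx', List.getD_eq_getElem _ _ hy'] at hxy
      exact (hNn.getElem_inj_iff).1 hxy
    · intro u hu hmem
      have hu' : u < N.length := hu
      simp only [List.getD_eq_getElem _ _ hu'] at hmem
      rcases List.mem_append.1 (hperm.mem_iff.1 (List.getElem_mem hu')) with h | h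
      · exact hLM hmem h
      · exact hab _ h (List.mem_append_left _ hmem)
    · intro u hu
      have := List.isChain_iff_getElem.1 hc₂ u (by simp; omega)
      interval_cases u <;> exact this
    · intro u hu w hw huw
      rw [hside u hu, hside w hw]
      rcases Nat.mod_two_eq_zero_or_one u with h | h <;>
      rcases Nat.mod_two_eq_zero_or_one w with h' | h' <;>
      first | omega | simp [h, h']

/-- Induction step in Theorem 7: for `n ≥ 6`, if a subgraph `G` of `K_{n+3,n+3}`
contains a cycle of length `2(n-1)`, then `G` contains a cycle of length `2n` or its
bipartite complement contains a cycle of length 8. -/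
theorem stmt16 (n : ℕ) (hn : 6 ≤ n)
    (G : SimpleGraph (Fin (n + 3) ⊕ Fin (n + 3))) (hG : G ≤ Kbb (n + 3))
    (hC : HasCycleLen G (2 * (n - 1))) :
    HasCycleLen G (2 * n) ∨ HasCycleLen (Kbb (n + 3) \ G) 8 := by
  obtain ⟨c, L, hw, hL, hside⟩ := exists_isWindow hn hG hC
  rw [← hL]
  refine hw.hasCycleLen fun u hu w hw huw => ?_
  by_cases h : G.Adj (c u) (c w)
  · exact .inl h
  · refine .inr ((sdiff_adj _ _ _ _).2 ⟨?_, h⟩)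
    have := hside u hu w hw huw
    cases hx : c u <;> cases hy : c w <;> simp_all
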